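/- arXiv:1311.4748 — 2 statements merged into one kernel-verified Lean document; each statement's English description precedes it below -/
import Mathlib

section
/- For all integers N and d with N ≥ d ≥ 1, the space 𝓕_{N,d}^ℂ of complex finite unit norm tight frames of N vectors in ℂ^d is path-connected (as a subset of the space of d×N complex matrices with its standard topology). -/
noncomputable section

/-- The set of finite unit norm tight frames (FUNTFs) of `N` vectors in `𝕜^d`,
viewed as `d × N` matrices `F` with unit-norm columns and `F * Fᴴ = (N/d) • 1`. -/
def FUNTF (𝕜 : Type*) [RCLike 𝕜] (N d : ℕ) : Set (Matrix (Fin d) (Fin N) 𝕜) :=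
  {F | F * F.conjTranspose = ((N : 𝕜) / (d : 𝕜)) • 1 ∧
       ∀ n, (F.conjTranspose * F) n n = 1}

namespace FuntfAux

open Matrix

/-- Weighted frame operator. -/
def Sop {N d : ℕ} (F : Matrix (Fin d) (Fin N) ℂ) (x : Fin N → ℝ) : Matrix (Fin d) (Fin d) ℂ :=
  F * diagonal (fun n => (Real.exp (x n) : ℂ)) * Fᴴ

/-- Convex potential. -/
def Th {N d : ℕ} (F : Matrix (Fin d) (Fin N) ℂ) (x : Fin N → ℝ) : ℝ :=
  (∑ p : Fin d → Fin N, ‖(F.submatrix id p).det‖ ^ 2 *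
    Real.exp (∑ i, x (p i) - (d / N : ℝ) * ∑ n, x n)) + (∑ n, x n) ^ 2

lemma cauchyBinet {N d : ℕ} (A : Matrix (Fin d) (Fin N) ℂ) (B : Matrix (Fin N) (Fin d) ℂ) :
    (d.factorial : ℂ) * (A * B).det =
      ∑ p : Fin d → Fin N, (A.submatrix id p).det * (B.submatrix p id).det := by
  have h1 : (A * B).det = ∑ p : Fin d → Fin N, (A.submatrix id p).det * ∏ i, B (p i) i := by
    simp only [det_apply', mul_apply, Finset.prod_univ_sum, Finset.mul_sum,
      Fintype.piFinset_univ]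
    rw [Finset.sum_comm]
    refine Finset.sum_congr rfl fun p _ => ?_
    rw [Finset.sum_mul]
    refine Finset.sum_congr rfl fun σ _ => ?_
    simp only [Finset.prod_mul_distrib, submatrix_apply, id]
    ring
  have h2 : ∀ τ : Equiv.Perm (Fin d), (A * B).det =
      ∑ p : Fin d → Fin N, (A.submatrix id p).det *
        (((Equiv.Perm.sign τ : ℤ) : ℂ) * ∏ i, B (p (τ i)) i) := by
    intro τ
    rw [h1]
    refine Fintype.sum_equiv (Equiv.arrowCongr τ (Equiv.refl (Fin N))) _ _ ?_
    intro p
    have e1 : A.submatrix id ((Equiv.arrowCongr τ (Equiv.refl (Fin N))) p) =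
        (A.submatrix id p).submatrix id (τ⁻¹ : Equiv.Perm (Fin d)) := by
      ext a i
      simp [Equiv.arrowCongr]
    have e2 : ∏ i, B ((Equiv.arrowCongr τ (Equiv.refl (Fin N))) p (τ i)) i = ∏ i, B (p i) i := by
      simp [Equiv.arrowCongr]
    rw [e1, e2, det_permute', Equiv.Perm.sign_inv]
    have e3 : (((Equiv.Perm.sign τ : ℤˣ) : ℤ) : ℂ) * (((Equiv.Perm.sign τ : ℤˣ) : ℤ) : ℂ) = 1 := by
      rw [← Int.cast_mul, ← Units.val_mul, Int.units_mul_self]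
      simp
    linear_combination (-(A.submatrix id p).det * ∏ i, B (p i) i) * e3
  have h3 : ∑ τ : Equiv.Perm (Fin d), (A * B).det = (d.factorial : ℂ) * (A * B).det := by
    simp [Fintype.card_perm]
  rw [← h3, Finset.sum_congr rfl (fun τ _ => h2 τ), Finset.sum_comm]
  refine Finset.sum_congr rfl fun p _ => ?_
  rw [← Finset.mul_sum, det_apply' (B.submatrix p id)]
  rfl

lemma det_Sop {N d : ℕ} (F : Matrix (Fin d) (Fin N) ℂ) (x : Fin N → ℝ) :
    (d.factorial : ℂ) * (Sop F x).det =
      ((∑ p : Fin d → Fin N, ‖(F.submatrix id p).det‖ ^ 2 * Real.exp (∑ i, x (p i)) : ℝ) : ℂ) := by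
  rw [Sop, cauchyBinet, Complex.ofReal_sum]
  refine Finset.sum_congr rfl fun p _ => ?_
  have e1 : (F * diagonal (fun n => (Real.exp (x n) : ℂ))).submatrix id p =
      F.submatrix id p * diagonal (fun i => (Real.exp (x (p i)) : ℂ)) := by
    ext a i
    simp [mul_diagonal]
  have e2 : (Fᴴ).submatrix p id = (F.submatrix id p)ᴴ := by
    ext a i; simp
  rw [e1, e2, det_mul, det_diagonal, det_conjTranspose, Real.exp_sum]
  push_cast
  rw [mul_right_comm]
  congr 1
  exact Complex.mul_conj' _

lemma det_Sop_real {N d : ℕ} (F : Matrix (Fin d) (Fin N) ℂ) (x : Fin N → ℝ) :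
    (Sop F x).det = (((Sop F x).det.re : ℝ) : ℂ) := by
  have h := det_Sop F x
  have hf : (d.factorial : ℝ) ≠ 0 := by exact_mod_cast d.factorial_ne_zero
  apply Complex.ext
  · simp
  · have := congrArg Complex.im h
    rw [Complex.ofReal_im] at this
    have e : ((d.factorial : ℂ)) = ((d.factorial : ℝ) : ℂ) := by simp
    rw [e, Complex.im_ofReal_mul] at this
    simpa [hf] using this

lemma Th_eq {N d : ℕ} (F : Matrix (Fin d) (Fin N) ℂ) (x : Fin N → ℝ) :
    Th F x = d.factorial * (Sop F x).det.re * Real.exp (- ((d / N : ℝ) * ∑ n, x n))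
      + (∑ n, x n) ^ 2 := by
  have h := congrArg Complex.re (det_Sop F x)
  rw [Complex.ofReal_re] at h
  have e : ((d.factorial : ℂ)) = ((d.factorial : ℝ) : ℂ) := by simp
  rw [e, Complex.re_ofReal_mul] at h
  rw [h, Th, Finset.sum_mul]
  congr 1
  refine Finset.sum_congr rfl fun p _ => ?_
  rw [mul_assoc, ← Real.exp_add, sub_eq_add_neg]

end FuntfAux

namespace FuntfAux
open Matrix

/-- `x` is the strict global minimizer of the potential. -/
def SMin {N d : ℕ} (F : Matrix (Fin d) (Fin N) ℂ) (x : Fin N → ℝ) : Prop :=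
  ∀ y, y ≠ x → Th F x < Th F y

/-- The exponent as a linear map. -/
def Lp {N d : ℕ} (p : Fin d → Fin N) : (Fin N → ℝ) →ₗ[ℝ] ℝ :=
  (∑ i, LinearMap.proj (p i)) - (d / N : ℝ) • ∑ n, LinearMap.proj n

lemma Lp_apply {N d : ℕ} (p : Fin d → Fin N) (x : Fin N → ℝ) :
    Lp p x = ∑ i, x (p i) - (d / N : ℝ) * ∑ n, x n := by
  simp [Lp]

lemma Th_convex {N d : ℕ} (F : Matrix (Fin d) (Fin N) ℂ) : ConvexOn ℝ Set.univ (Th F) := by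
  have h1 : ∀ p : Fin d → Fin N, ConvexOn ℝ Set.univ (fun x : Fin N → ℝ =>
      ‖(F.submatrix id p).det‖ ^ 2 * Real.exp (∑ i, x (p i) - (d / N : ℝ) * ∑ n, x n)) := by
    intro p
    have := (convexOn_exp.comp_linearMap (Lp p)).smul (sq_nonneg ‖(F.submatrix id p).det‖)
    simpa [Function.comp_def, Lp_apply] using this
  have h2 : ConvexOn ℝ Set.univ (fun x : Fin N → ℝ => (∑ n, x n) ^ 2) := by
    have := (even_two.convexOn_pow (𝕜 := ℝ)).comp_linearMap
      (∑ n : Fin N, LinearMap.proj n : (Fin N → ℝ) →ₗ[ℝ] ℝ)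
    simpa [Function.comp_def] using this
  have h3 : ConvexOn ℝ Set.univ (fun x : Fin N → ℝ => ∑ p : Fin d → Fin N,
      ‖(F.submatrix id p).det‖ ^ 2 * Real.exp (∑ i, x (p i) - (d / N : ℝ) * ∑ n, x n)) := by
    classical
    refine Finset.induction_on (Finset.univ : Finset (Fin d → Fin N)) ?_ ?_
    · simpa using convexOn_const (0 : ℝ) convex_univ
    · intro p s hp ih
      simp only [Finset.sum_insert hp]
      exact (h1 p).add ih
  exact h3.add h2

lemma Th_cont {T : Type*} [TopologicalSpace T] {N d : ℕ} {G : T → Matrix (Fin d) (Fin N) ℂ}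
    {m : T → Fin N → ℝ} (hG : Continuous G) (hm : Continuous m) :
    Continuous (fun t => Th (G t) (m t)) := by
  unfold Th
  refine Continuous.add ?_ (by fun_prop)
  refine continuous_finsetSum _ fun p _ => ?_
  refine Continuous.mul ?_ (by fun_prop)
  refine Continuous.pow (Continuous.norm ?_) 2
  exact (hG.matrix_submatrix id p).matrix_det

lemma smin_continuous {T : Type*} [TopologicalSpace T] {N d : ℕ}
    (G : T → Matrix (Fin d) (Fin N) ℂ) (hG : Continuous G) (m : T → Fin N → ℝ)
    (hm : ∀ t, SMin (G t) (m t)) : Continuous m := by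
  rw [continuous_iff_continuousAt]
  intro t0
  rw [ContinuousAt, Metric.tendsto_nhds]
  intro ε hε
  have hK : IsCompact (Metric.sphere (m t0) ε) := isCompact_sphere _ _
  have hc1 : Continuous (fun q : T × (Fin N → ℝ) => Th (G q.1) q.2) :=
    Th_cont (hG.comp continuous_fst) continuous_snd
  have hc2 : Continuous (fun q : T × (Fin N → ℝ) => Th (G q.1) (m t0)) :=
    Th_cont (hG.comp continuous_fst) continuous_const
  have hev : ∀ᶠ t in nhds t0, ∀ y ∈ Metric.sphere (m t0) ε, Th (G t) (m t0) < Th (G t) y := by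
    refine hK.eventually_forall_of_forall_eventually ?_
    intro y hy
    have hlt : Th (G t0) (m t0) < Th (G t0) y := by
      refine hm t0 y ?_
      rintro rfl
      simp at hy
      exact hε.ne hy
    exact (hc2.continuousAt (x := (t0, y))).eventually_lt (hc1.continuousAt) hlt
  filter_upwards [hev] with t ht
  by_contra hcon
  push Not at hcon
  have hne : m t ≠ m t0 := by
    intro h; rw [h, dist_self] at hcon; linarith
  have hpos : 0 < dist (m t) (m t0) := dist_pos.mpr hne
  set r := ε / dist (m t) (m t0) with hr
  have hr0 : 0 ≤ r := by positivity
  have hr1 : r ≤ 1 := (div_le_one hpos).mpr hcon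
  have hy : m t0 + r • (m t - m t0) ∈ Metric.sphere (m t0) ε := by
    rw [mem_sphere_iff_norm, add_sub_cancel_left, norm_smul, ← dist_eq_norm, Real.norm_eq_abs,
      abs_of_nonneg hr0, hr]
    field_simp
  have hseg : m t0 + r • (m t - m t0) ∈ segment ℝ (m t0) (m t) := by
    rw [segment_eq_image']
    exact ⟨r, ⟨hr0, hr1⟩, rfl⟩
  have h1 := ht _ hy
  have h2 := (Th_convex (G t)).le_max_of_mem_segment (Set.mem_univ _) (Set.mem_univ _) hseg
  have h3 := hm t (m t0) hne.symm
  rw [max_eq_left h3.le] at h2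
  linarith

lemma sum_update {N d : ℕ} (p : Fin d → Fin N) (k : Fin d) (b : Fin N) (x : Fin N → ℝ) :
    ∑ i, x (Function.update p k b i) = ∑ i, x (p i) + (x b - x (p k)) := by
  have : ∀ i, x (Function.update p k b i) = x (p i) + if i = k then x b - x (p k) else 0 := by
    intro i
    by_cases h : i = k
    · subst h; simp
    · simp [h]
  simp [this, Finset.sum_add_distrib]

lemma inj_update {N d : ℕ} (p : Fin d → Fin N) (hp : Function.Injective p) (k : Fin d) (b : Fin N)
    (hb : ∀ i, p i ≠ b) : Function.Injective (Function.update p k b) := by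
  intro i j hij
  by_cases hi : i = k <;> by_cases hj : j = k
  · rw [hi, hj]
  · subst hi; simp [hj] at hij; exact absurd hij.symm (hb j)
  · subst hj; simp [hi] at hij; exact absurd hij (hb i)
  · simp [hi, hj] at hij; exact hp hij

lemma bound_combi {N d : ℕ} (hd : 1 ≤ d) (hN : d < N) (K : ℝ) (x : Fin N → ℝ)
    (h1 : ∀ p : Fin d → Fin N, Function.Injective p → ∑ i, x (p i) ≤ K)
    (h2 : |∑ n, x n| ≤ K) (n : Fin N) : |x n| ≤ K + N * (K + 2 * d * K) := by
  have hK : 0 ≤ K := (abs_nonneg _).trans h2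
  have : Nonempty (Fin d ↪ Fin N) := ⟨Fin.castLEEmb hN.le⟩
  obtain ⟨p, hp⟩ := Finite.exists_max (fun p : Fin d ↪ Fin N => ∑ i, x (p i))
  have hex : ∀ k b, (∀ i, p i ≠ b) → x b ≤ x (p k) := by
    intro k b hb
    have := hp ⟨Function.update p k b, inj_update p p.injective k b hb⟩
    simp only [Function.Embedding.coeFn_mk] at this
    rw [sum_update] at this
    linarith
  have hs := abs_le.mp h2
  have hpK := h1 p p.injective
  classical
  let R : Finset (Fin N) := Finset.univ.map p
  have hRsum : ∑ n ∈ R, x n = ∑ i, x (p i) := by simp [R]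
  have hRc : ∑ n ∈ Rᶜ, x n ≥ - (2 * K) := by
    have := Finset.sum_add_sum_compl R x
    linarith
  have hRcard : Rᶜ.card = N - d := by simp [R, Finset.card_compl]
  have hlow : ∀ k, - (2 * K) ≤ x (p k) := by
    intro k
    have h3 : ∑ n ∈ Rᶜ, x n ≤ Rᶜ.card • x (p k) := by
      refine Finset.sum_le_card_nsmul _ _ _ fun b hb => hex k b ?_
      intro i hi
      simp [R] at hb
      exact hb i hi
    rw [hRcard, nsmul_eq_mul] at h3
    have h4 : (1 : ℝ) ≤ ((N - d : ℕ) : ℝ) := by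
      exact_mod_cast (by omega : 1 ≤ N - d)
    by_contra hcon
    push Not at hcon
    have : ((N - d : ℕ) : ℝ) * x (p k) ≤ x (p k) := by nlinarith
    linarith
  have hup : ∀ k, x (p k) ≤ K + 2 * d * K := by
    intro k
    have h3 := Finset.add_sum_erase Finset.univ (fun i => x (p i)) (Finset.mem_univ k)
    have h4 : (Finset.univ.erase k).card • (-(2 * K)) ≤ ∑ i ∈ Finset.univ.erase k, x (p i) :=
      Finset.card_nsmul_le_sum _ _ _ fun i _ => hlow i
    have h5 : ((Finset.univ.erase k).card : ℝ) ≤ d := by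
      have := Finset.card_le_univ (Finset.univ.erase k)
      simp only [Fintype.card_fin] at this
      exact_mod_cast this
    rw [nsmul_eq_mul] at h4
    nlinarith
  have hall : ∀ n, x n ≤ K + 2 * d * K := by
    intro n
    by_cases h : ∃ i, p i = n
    · obtain ⟨i, rfl⟩ := h; exact hup i
    · push Not at h
      exact (hex ⟨0, hd⟩ n h).trans (hup _)
  have hM : 0 ≤ K + 2 * d * K := by positivity
  have hN1 : (1 : ℝ) ≤ N := by exact_mod_cast (by omega : 1 ≤ N)
  rw [abs_le]
  constructor
  · have h3 := Finset.add_sum_erase Finset.univ x (Finset.mem_univ n)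
    have h4 : ∑ i ∈ Finset.univ.erase n, x i ≤ (Finset.univ.erase n).card • (K + 2 * d * K) :=
      Finset.sum_le_card_nsmul _ _ _ fun i _ => hall i
    have h5 : ((Finset.univ.erase n).card : ℝ) ≤ N := by
      have := Finset.card_le_univ (Finset.univ.erase n)
      simp only [Fintype.card_fin] at this
      exact_mod_cast this
    rw [nsmul_eq_mul] at h4
    nlinarith
  · have := hall n
    nlinarith

lemma Th_bound {N d : ℕ} (hd : 1 ≤ d) (hN : d < N) (F : Matrix (Fin d) (Fin N) ℂ)
    (hF : ∀ p : Fin d → Fin N, Function.Injective p → (F.submatrix id p).det ≠ 0) (C : ℝ) :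
    ∃ R, ∀ x, Th F x ≤ C → ‖x‖ ≤ R := by
  set K1 : ℝ := ∑ p : Fin d → Fin N, |Real.log (C / ‖(F.submatrix id p).det‖ ^ 2)| with hK1
  set K := K1 + √C with hK
  have hK1' : 0 ≤ K1 := Finset.sum_nonneg fun _ _ => abs_nonneg _
  refine ⟨K + N * (K + 2 * d * K), fun x hx => ?_⟩
  have hKn : 0 ≤ K := add_nonneg hK1' (Real.sqrt_nonneg _)
  rw [pi_norm_le_iff_of_nonneg (by positivity)]
  intro n
  have hpos : ∀ p : Fin d → Fin N, 0 ≤ ‖(F.submatrix id p).det‖ ^ 2 *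
    Real.exp (∑ i, x (p i) - (d / N : ℝ) * ∑ n, x n) := fun p => by positivity
  have hs : |∑ n, x n| ≤ √C := by
    apply Real.abs_le_sqrt
    have := Finset.sum_nonneg (s := Finset.univ) fun p _ => hpos p
    unfold Th at hx
    linarith
  refine bound_combi hd hN K x ?_ (hs.trans (by linarith)) n
  intro p hp
  have hc : 0 < ‖(F.submatrix id p).det‖ ^ 2 := by
    have := norm_pos_iff.mpr (hF p hp)
    positivity
  have h1 : ‖(F.submatrix id p).det‖ ^ 2 *
    Real.exp (∑ i, x (p i) - (d / N : ℝ) * ∑ n, x n) ≤ C := by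
    have := Finset.single_le_sum (f := fun p : Fin d → Fin N => ‖(F.submatrix id p).det‖ ^ 2 *
      Real.exp (∑ i, x (p i) - (d / N : ℝ) * ∑ n, x n)) (fun p _ => hpos p) (Finset.mem_univ p)
    unfold Th at hx
    nlinarith [sq_nonneg (∑ n, x n)]
  have h2 : Real.exp (∑ i, x (p i) - (d / N : ℝ) * ∑ n, x n) ≤
      C / ‖(F.submatrix id p).det‖ ^ 2 := by
    rw [le_div_iff₀ hc]; linarith
  have h3 : ∑ i, x (p i) - (d / N : ℝ) * ∑ n, x n ≤
      Real.log (C / ‖(F.submatrix id p).det‖ ^ 2) :=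
    (Real.le_log_iff_exp_le (lt_of_lt_of_le (Real.exp_pos _) h2)).mpr h2
  have h4 : |Real.log (C / ‖(F.submatrix id p).det‖ ^ 2)| ≤ K1 :=
    Finset.single_le_sum (f := fun p : Fin d → Fin N =>
      |Real.log (C / ‖(F.submatrix id p).det‖ ^ 2)|) (fun p _ => abs_nonneg _) (Finset.mem_univ p)
  have h5 := le_abs_self (Real.log (C / ‖(F.submatrix id p).det‖ ^ 2))
  have h6 : (d / N : ℝ) * ∑ n, x n ≤ √C := by
    have hN0 : (0 : ℝ) < N := by exact_mod_cast (by omega : 0 < N)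
    have : (d / N : ℝ) ≤ 1 := by
      rw [div_le_one hN0]; exact_mod_cast hN.le
    have h0 : (0 : ℝ) ≤ d / N := by positivity
    calc (d / N : ℝ) * ∑ n, x n ≤ (d / N : ℝ) * √C := by
          gcongr; exact (le_abs_self _).trans hs
      _ ≤ 1 * √C := by gcongr
      _ = √C := one_mul _
  linarith

lemma exists_smin {N d : ℕ} (hd : 1 ≤ d) (hN : d < N) (F : Matrix (Fin d) (Fin N) ℂ)
    (hF : ∀ p : Fin d → Fin N, Function.Injective p → (F.submatrix id p).det ≠ 0) :
    ∃ x, SMin F x := by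
  obtain ⟨R, hR⟩ := Th_bound hd hN F hF (Th F 0)
  have hcont : Continuous (Th F) := Th_cont continuous_const continuous_id
  obtain ⟨x, hx⟩ := hcont.exists_forall_le' 0 (by
    filter_upwards [(isCompact_closedBall (0 : Fin N → ℝ) R).compl_mem_cocompact] with y hy
    by_contra hcon
    push Not at hcon
    exact hy (by simpa using hR y hcon.le))
  refine ⟨x, fun y hyx => ?_⟩
  refine lt_of_le_of_ne (hx y) fun heq => hyx ?_
  -- midpoint
  set z : Fin N → ℝ := (1/2 : ℝ) • x + (1/2 : ℝ) • y with hz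
  have hxz := hx z
  have hsumz : ∑ n, z n = (∑ n, x n) / 2 + (∑ n, y n) / 2 := by
    simp [hz, Finset.sum_add_distrib, ← Finset.mul_sum]; ring
  have hLz : ∀ p : Fin d → Fin N, Lp p z = Lp p x / 2 + Lp p y / 2 := by
    intro p; rw [hz, map_add, map_smul, map_smul]; simp; ring
  have hexp : ∀ a b : ℝ, Real.exp (a / 2 + b / 2) ≤ Real.exp a / 2 + Real.exp b / 2 := by
    intro a b
    have h1 : Real.exp a = Real.exp (a / 2) ^ 2 := by rw [← Real.exp_nat_mul]; congr 1; push_cast; ring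
    have h2 : Real.exp b = Real.exp (b / 2) ^ 2 := by rw [← Real.exp_nat_mul]; congr 1; push_cast; ring
    rw [h1, h2, Real.exp_add]
    nlinarith [sq_nonneg (Real.exp (a / 2) - Real.exp (b / 2))]
  have hexp' : ∀ a b : ℝ, a ≠ b → Real.exp (a / 2 + b / 2) < Real.exp a / 2 + Real.exp b / 2 := by
    intro a b hab
    have h1 : Real.exp a = Real.exp (a / 2) ^ 2 := by rw [← Real.exp_nat_mul]; congr 1; push_cast; ring
    have h2 : Real.exp b = Real.exp (b / 2) ^ 2 := by rw [← Real.exp_nat_mul]; congr 1; push_cast; ring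
    have h3 : Real.exp (a / 2) - Real.exp (b / 2) ≠ 0 := by
      intro h
      have := Real.exp_injective (sub_eq_zero.mp h)
      exact hab (by linarith)
    rw [h1, h2, Real.exp_add]
    have := sq_pos_of_ne_zero h3
    nlinarith
  have hThL : ∀ w, Th F w = (∑ p : Fin d → Fin N, ‖(F.submatrix id p).det‖ ^ 2 *
      Real.exp (Lp p w)) + (∑ n, w n) ^ 2 := by
    intro w; simp only [Lp_apply]; rfl
  have hle : ∀ p : Fin d → Fin N, ‖(F.submatrix id p).det‖ ^ 2 * Real.exp (Lp p z) ≤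
      (‖(F.submatrix id p).det‖ ^ 2 * Real.exp (Lp p x)) / 2 +
      (‖(F.submatrix id p).det‖ ^ 2 * Real.exp (Lp p y)) / 2 := by
    intro p
    rw [hLz]
    have := mul_le_mul_of_nonneg_left (hexp (Lp p x) (Lp p y)) (sq_nonneg ‖(F.submatrix id p).det‖)
    linarith
  have hsle : (∑ n, z n) ^ 2 = (∑ n, x n) ^ 2 / 2 + (∑ n, y n) ^ 2 / 2 -
      ((∑ n, x n) - (∑ n, y n)) ^ 2 / 4 := by
    rw [hsumz]; ring
  have hsum := Finset.sum_le_sum fun p (_ : p ∈ (Finset.univ : Finset (Fin d → Fin N))) => hle p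
  rw [Finset.sum_add_distrib, ← Finset.sum_div, ← Finset.sum_div] at hsum
  have hxx := hThL x
  have hyy := hThL y
  have hzz := hThL z
  have hSeq : ∑ n, x n = ∑ n, y n := by
    have : ((∑ n, x n) - (∑ n, y n)) ^ 2 ≤ 0 := by linarith
    have := pow_eq_zero_iff (two_ne_zero) |>.mp (le_antisymm this (sq_nonneg _))
    linarith
  have hLeq : ∀ p : Fin d → Fin N, Function.Injective p → Lp p x = Lp p y := by
    intro p hp
    by_contra hne
    have hstrict : ‖(F.submatrix id p).det‖ ^ 2 * Real.exp (Lp p z) <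
      (‖(F.submatrix id p).det‖ ^ 2 * Real.exp (Lp p x)) / 2 +
      (‖(F.submatrix id p).det‖ ^ 2 * Real.exp (Lp p y)) / 2 := by
      have hc : 0 < ‖(F.submatrix id p).det‖ ^ 2 := by
        have := norm_pos_iff.mpr (hF p hp)
        positivity
      rw [hLz]
      have := mul_lt_mul_of_pos_left (hexp' (Lp p x) (Lp p y) hne) hc
      linarith
    have hsum' := Finset.sum_lt_sum (fun p (_ : p ∈ (Finset.univ : Finset (Fin d → Fin N))) => hle p)
      ⟨p, Finset.mem_univ p, hstrict⟩
    rw [Finset.sum_add_distrib, ← Finset.sum_div, ← Finset.sum_div] at hsum'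
    have := sq_nonneg ((∑ n, x n) - (∑ n, y n))
    linarith
  -- differences are constant
  have hw : ∀ p : Fin d → Fin N, Function.Injective p → ∑ i, (y - x) (p i) = 0 := by
    intro p hp
    have := hLeq p hp
    rw [Lp_apply, Lp_apply, hSeq] at this
    simp only [Pi.sub_apply, Finset.sum_sub_distrib]
    linarith
  have hwc := fun n => bound_combi hd hN 0 (y - x) (fun p hp => (hw p hp).le)
    (by simp [Finset.sum_sub_distrib, hSeq]) n
  funext n
  have := hwc n
  simp at this
  linarith

end FuntfAux

namespace FuntfAux
open Matrix
open scoped ComplexOrder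

lemma Sop_posSemidef {N d : ℕ} (F : Matrix (Fin d) (Fin N) ℂ) (x : Fin N → ℝ) :
    (Sop F x).PosSemidef := by
  unfold Sop
  apply PosSemidef.mul_mul_conjTranspose_same
  apply PosSemidef.diagonal
  intro n
  simp only [Pi.zero_apply]
  exact_mod_cast (Real.exp_pos _).le

/-- Criticality: the weights put the frame in radial isotropic position. -/
def Crit {N d : ℕ} (F : Matrix (Fin d) (Fin N) ℂ) (x : Fin N → ℝ) : Prop :=
  (Sop F x).det ≠ 0 ∧ ∀ n, (Fᴴ * (Sop F x)⁻¹ * F) n n * (Real.exp (x n) : ℂ) = (d : ℂ) / N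

lemma Sop_single {N d : ℕ} (F : Matrix (Fin d) (Fin N) ℂ) (x : Fin N → ℝ) (n : Fin N) (t : ℝ) :
    Sop F (x + Pi.single n t) = Sop F x +
      replicateCol Unit (fun a => ((Real.exp (x n) * (Real.exp t - 1) : ℝ) : ℂ) * F a n) *
        replicateRow Unit (fun a => star (F a n)) := by
  ext a b
  rw [Matrix.add_apply, Sop, Sop, mul_apply, mul_apply, mul_apply]
  simp only [mul_diagonal, conjTranspose_apply, replicateCol_apply,
    replicateRow_apply, Finset.univ_unique, Finset.sum_singleton]
  have : ∀ k, F a k * ((Real.exp ((x + Pi.single n t : Fin N → ℝ) k) : ℝ) : ℂ) * star (F b k) =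
      F a k * ((Real.exp (x k) : ℝ) : ℂ) * star (F b k) + if k = n then
        (((Real.exp (x n) * (Real.exp t - 1) : ℝ) : ℂ) * F a n) * star (F b n) else 0 := by
    intro k
    by_cases h : k = n
    · subst h
      simp [Real.exp_add]; ring
    · simp [h]
  rw [Finset.sum_congr rfl fun k _ => this k, Finset.sum_add_distrib]
  simp

lemma det_single {N d : ℕ} (F : Matrix (Fin d) (Fin N) ℂ) (x : Fin N → ℝ) (n : Fin N) (t : ℝ)
    (hdet : (Sop F x).det ≠ 0) :
    (Sop F (x + Pi.single n t)).det = (Sop F x).det *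
      (1 + ((Real.exp (x n) * (Real.exp t - 1) : ℝ) : ℂ) * (Fᴴ * (Sop F x)⁻¹ * F) n n) := by
  rw [Sop_single, det_add_replicateCol_mul_replicateRow (isUnit_iff_ne_zero.mpr hdet)]
  congr 1
  rw [det_unique]
  simp only [Matrix.add_apply, one_apply_eq, mul_apply, replicateCol_apply, replicateRow_apply,
    conjTranspose_apply, Finset.mul_sum, Finset.sum_mul]
  congr 1
  refine Finset.sum_congr rfl fun a _ => Finset.sum_congr rfl fun b _ => ?_
  ring

lemma crit_of_smin {N d : ℕ} (hN : 0 < N) (F : Matrix (Fin d) (Fin N) ℂ) (x : Fin N → ℝ)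
    (hx : SMin F x) (hdet : (Sop F x).det ≠ 0) : Crit F x := by
  have hN0 : (N : ℝ) ≠ 0 := by exact_mod_cast hN.ne'
  have hmin : ∀ y, Th F x ≤ Th F y := by
    intro y
    by_cases h : y = x
    · rw [h]
    · exact (hx y h).le
  have hσ : ∑ n, x n = 0 := by
    have h := hmin (x - fun _ => (∑ n, x n) / N)
    have e1 : ∑ n, (x - fun _ => (∑ n, x n) / N : Fin N → ℝ) n = 0 := by
      simp [Finset.sum_sub_distrib]
      field_simp
      ring
    have e2 : ∀ p : Fin d → Fin N, ∑ i, (x - fun _ => (∑ n, x n) / N : Fin N → ℝ) (p i)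
        = ∑ i, x (p i) - (d / N : ℝ) * ∑ n, x n := by
      intro p
      simp [Finset.sum_sub_distrib]
      ring
    unfold Th at h
    simp only [e1, e2] at h
    simp at h
    exact h
  refine ⟨hdet, fun n => ?_⟩
  set q := (Fᴴ * (Sop F x)⁻¹ * F) n n with hq
  have hqre : ((q.re : ℝ) : ℂ) = q := by
    have : (Fᴴ * (Sop F x)⁻¹ * F).IsHermitian :=
      isHermitian_conjTranspose_mul_mul _ ((Sop_posSemidef F x).isHermitian.inv)
    exact this.coe_re_apply_self n
  set D := (Sop F x).det.re with hD
  have hD0 : D ≠ 0 := by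
    intro h
    apply hdet
    rw [det_Sop_real, ← hD, h]; simp
  have hdt : ∀ t, (Sop F (x + Pi.single n t)).det.re =
      D * (1 + Real.exp (x n) * (Real.exp t - 1) * q.re) := by
    intro t
    rw [det_single F x n t hdet, ← hq, ← hqre, det_Sop_real, ← hD]
    rw [← Complex.ofReal_mul, ← Complex.ofReal_one, ← Complex.ofReal_add, ← Complex.ofReal_mul,
      Complex.ofReal_re, Complex.ofReal_re]
  have hg : ∀ t, Th F (x + Pi.single n t) = d.factorial *
      (D * (1 + Real.exp (x n) * (Real.exp t - 1) * q.re)) * Real.exp (- ((d / N : ℝ) * t))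
      + t ^ 2 := by
    intro t
    rw [Th_eq, hdt]
    have : ∑ k, (x + Pi.single n t : Fin N → ℝ) k = t := by
      simp [Finset.sum_add_distrib, hσ]
    rw [this]
  have hlm : IsLocalMin (fun t => Th F (x + Pi.single n t)) 0 := by
    refine Filter.Eventually.of_forall fun t => ?_
    simpa using hmin _
  have hder : HasDerivAt (fun t => Th F (x + Pi.single n t))
      (d.factorial * (D * (Real.exp (x n) * q.re)) + d.factorial * D * (-(d / N : ℝ))) 0 := by
    simp only [hg]
    have h1 : HasDerivAt (fun t : ℝ => (d.factorial : ℝ) *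
        (D * (1 + Real.exp (x n) * (Real.exp t - 1) * q.re)))
        (d.factorial * (D * (Real.exp (x n) * Real.exp 0 * q.re))) 0 :=
      ((((((Real.hasDerivAt_exp 0).sub_const 1).const_mul _).mul_const _).const_add 1).const_mul
        D).const_mul _
    have h2 : HasDerivAt (fun t : ℝ => Real.exp (- ((d / N : ℝ) * t)))
        (Real.exp (- ((d / N : ℝ) * 0)) * (-((d / N : ℝ) * 1))) 0 :=
      (((hasDerivAt_id (0 : ℝ)).const_mul _).neg).exp
    have h3 : HasDerivAt (fun t : ℝ => t ^ 2) (2 * (0:ℝ) ^ 1 * 1) 0 := by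
      simpa using hasDerivAt_pow 2 (0 : ℝ)
    have := (h1.mul h2).add h3
    refine HasDerivAt.congr_deriv this ?_
    simp
  have h0 := hlm.hasDerivAt_eq_zero hder
  have hf : (d.factorial : ℝ) ≠ 0 := by exact_mod_cast d.factorial_ne_zero
  have h1 : Real.exp (x n) * q.re = d / N := by
    have : (d.factorial : ℝ) * D * (Real.exp (x n) * q.re - d / N) = 0 := by linarith
    have := (mul_eq_zero.mp this).resolve_left (mul_ne_zero hf hD0)
    linarith
  rw [← hqre, mul_comm, ← Complex.ofReal_mul, h1]
  push_cast
  rfl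

section
open scoped MatrixOrder Matrix.Norms.L2Operator

lemma exists_lift {T : Type*} [TopologicalSpace T] {N d : ℕ} (hd : 1 ≤ d) (hN : 0 < N)
    (G : T → Matrix (Fin d) (Fin N) ℂ) (hG : Continuous G) (m : T → Fin N → ℝ)
    (hm : Continuous m) (hc : ∀ t, Crit (G t) (m t)) :
    ∃ G' : T → Matrix (Fin d) (Fin N) ℂ, Continuous G' ∧ (∀ t, G' t ∈ FUNTF ℂ N d) ∧
      ∀ t, G t ∈ FUNTF ℂ N d → m t = 0 → G' t = G t := by
  have hdC : (d : ℂ) ≠ 0 := by exact_mod_cast (by omega : d ≠ 0)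
  have hNC : (N : ℂ) ≠ 0 := by exact_mod_cast (by omega : N ≠ 0)
  set c : ℂ := (N : ℂ) / d with hcdef
  have hc0 : c ≠ 0 := div_ne_zero hNC hdC
  have hcnn : 0 ≤ c := by
    have : c = ((N / d : ℝ) : ℂ) := by simp [hcdef]
    rw [this]; exact_mod_cast (by positivity : (0 : ℝ) ≤ N / d)
  let B : T → Matrix (Fin d) (Fin d) ℂ := fun t => c • (Sop (G t) (m t))⁻¹
  have hBnn : ∀ t, 0 ≤ B t := by
    intro t
    rw [Matrix.nonneg_iff_posSemidef]
    exact (Sop_posSemidef _ _).inv.smul hcnn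
  have hScont : Continuous fun t => Sop (G t) (m t) := by
    unfold Sop
    refine (hG.matrix_mul ?_).matrix_mul hG.matrix_conjTranspose
    apply Continuous.matrix_diagonal
    fun_prop
  have hBcont : Continuous B := by
    refine Continuous.const_smul ?_ c
    rw [continuous_iff_continuousAt]
    intro t
    have hu := (hc t).1
    have : ContinuousAt Ring.inverse (Sop (G t) (m t)).det := by
      rw [Ring.inverse_eq_inv']
      exact continuousAt_inv₀ hu
    exact ContinuousAt.comp (f := fun t => Sop (G t) (m t)) (continuousAt_matrix_inv _ this)
      hScont.continuousAt
  let A : T → Matrix (Fin d) (Fin d) ℂ := fun t => CFC.sqrt (B t)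
  have hAcont : Continuous A := CFC.continuousOn_sqrt.comp_continuous hBcont hBnn
  have hAA : ∀ t, A t * A t = B t := fun t => CFC.sqrt_mul_sqrt_self _ (hBnn t)
  have hAH : ∀ t, (A t)ᴴ = A t := by
    intro t
    have := CFC.sqrt_nonneg (B t)
    rw [Matrix.nonneg_iff_posSemidef] at this
    exact this.isHermitian
  let E : T → Matrix (Fin N) (Fin N) ℂ := fun t => diagonal fun n => (Real.exp (m t n / 2) : ℂ)
  have hEH : ∀ t, (E t)ᴴ = E t := by
    intro t
    simp only [E, diagonal_conjTranspose]
    congr 1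
    funext n
    simp only [Pi.star_apply]
    exact Complex.conj_ofReal _
  have hEE : ∀ t, E t * E t = diagonal fun n => (Real.exp (m t n) : ℂ) := by
    intro t
    simp only [E, diagonal_mul_diagonal]
    congr 1
    funext n
    rw [← Complex.ofReal_mul, ← Real.exp_add, add_halves]
  refine ⟨fun t => A t * G t * E t, ?_, ?_, ?_⟩
  · refine (hAcont.matrix_mul hG).matrix_mul ?_
    apply Continuous.matrix_diagonal
    fun_prop
  · intro t
    have hu : IsUnit (Sop (G t) (m t)).det := isUnit_iff_ne_zero.mpr (hc t).1
    constructor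
    · have e1 : A t * G t * E t * (A t * G t * E t)ᴴ = A t * Sop (G t) (m t) * A t := by
        rw [conjTranspose_mul, conjTranspose_mul, hAH, hEH, Sop, ← hEE]
        simp only [Matrix.mul_assoc]
      have e2 : (A t) * (c⁻¹ • (A t * Sop (G t) (m t))) = 1 := by
        rw [Matrix.mul_smul, ← Matrix.mul_assoc, hAA]
        simp only [B]
        rw [Matrix.smul_mul, nonsing_inv_mul _ hu, smul_smul, inv_mul_cancel₀ hc0, one_smul]
      have e3 := mul_eq_one_comm.mp e2
      rw [Matrix.smul_mul] at e3
      rw [e1, ← e3, smul_smul, ← hcdef, mul_inv_cancel₀ hc0, one_smul]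
    · intro n
      have e1 : (A t * G t * E t)ᴴ * (A t * G t * E t) =
          c • (E t * ((G t)ᴴ * (Sop (G t) (m t))⁻¹ * G t) * E t) := by
        have : (A t * G t * E t)ᴴ * (A t * G t * E t) = E t * ((G t)ᴴ * (A t * A t) * G t) * E t := by
          rw [conjTranspose_mul, conjTranspose_mul, hAH, hEH]
          simp only [Matrix.mul_assoc]
        rw [this, hAA]
        simp only [B, Matrix.mul_smul, Matrix.smul_mul]
      rw [e1]
      simp only [Matrix.smul_apply, E, mul_diagonal, diagonal_mul]
      have h := (hc t).2 n
      have h2 : (Real.exp (m t n) : ℂ) = (Real.exp (m t n / 2) : ℂ) * (Real.exp (m t n / 2) : ℂ) := by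
        rw [← Complex.ofReal_mul, ← Real.exp_add, add_halves]
      rw [h2] at h
      rw [smul_eq_mul]
      have h3 : c * (d / N : ℂ) = 1 := by rw [hcdef]; field_simp
      rw [← h3, ← h]
      ring
  · intro t ht hmt
    have hE1 : E t = 1 := by
      simp only [E, hmt]
      simp
    have hB1 : B t = 1 := by
      simp only [B]
      have : Sop (G t) (m t) = c • 1 := by
        rw [Sop, ← hEE, hE1, hcdef, ← ht.1]; simp
      rw [this]
      have h4 : (c • (1 : Matrix (Fin d) (Fin d) ℂ))⁻¹ = c⁻¹ • 1 := by
        apply inv_eq_right_inv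
        simp [smul_smul, hc0]
      rw [h4, smul_smul, mul_inv_cancel₀ hc0, one_smul]
    have hA1 : A t = 1 := by
      simp only [A, hB1]
      exact CFC.sqrt_unique (mul_one 1) (by
        rw [Matrix.nonneg_iff_posSemidef]; exact PosSemidef.one)
    simp only [hA1, hE1, Matrix.one_mul, Matrix.mul_one]

end
end FuntfAux

namespace FuntfAux
open Matrix
open scoped ComplexOrder

/-- Real functions constant on the components of the correlation graph. -/
def Vs {N d : ℕ} (F : Matrix (Fin d) (Fin N) ℂ) : Submodule ℝ (Fin N → ℝ) where
  carrier := {x | ∀ m n, (Fᴴ * F) m n ≠ 0 → x m = x n}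
  add_mem' := by
    intro x y hx hy m n h
    simp [hx m n h, hy m n h]
  zero_mem' := by intro m n _; rfl
  smul_mem' := by
    intro r x hx m n h
    simp [hx m n h]

/-- Non-orthodecomposability. -/
def Nd {N d : ℕ} (F : Matrix (Fin d) (Fin N) ℂ) : Prop :=
  ∀ x ∈ Vs F, ∀ m n, x m = x n

lemma smin_zero {N d : ℕ} (hd : 1 ≤ d) (hN : 0 < N) (F : Matrix (Fin d) (Fin N) ℂ)
    (hF : F ∈ FUNTF ℂ N d) (hnd : Nd F) : SMin F 0 := by
  have hd0 : (0 : ℝ) < d := by exact_mod_cast hd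
  have hN0 : (0 : ℝ) < N := by exact_mod_cast hN
  intro y hy
  have hS : (Sop F y).IsHermitian := (Sop_posSemidef F y).isHermitian
  set U : Matrix (Fin d) (Fin d) ℂ := hS.eigenvectorUnitary.1 with hU
  have hUU : Uᴴ * U = 1 := Unitary.coe_star_mul_self hS.eigenvectorUnitary
  have hUU' : U * Uᴴ = 1 := Unitary.coe_mul_star_self hS.eigenvectorUnitary
  set B := Uᴴ * F with hB
  set lam := hS.eigenvalues with hlam
  set c : ℝ := (N : ℝ) / d with hc
  have hc0 : 0 < c := by positivity
  have hspec : Uᴴ * Sop F y * U = diagonal (fun k => (lam k : ℂ)) := by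
    have := hS.conjStarAlgAut_star_eigenvectorUnitary
    rw [Unitary.conjStarAlgAut_star_apply] at this
    exact this
  have hBD : B * diagonal (fun n => (Real.exp (y n) : ℂ)) * Bᴴ =
      diagonal (fun k => (lam k : ℂ)) := by
    rw [← hspec, hB, Sop, conjTranspose_mul, conjTranspose_conjTranspose]
    simp only [Matrix.mul_assoc]
  have hBB : B * Bᴴ = (c : ℂ) • 1 := by
    have h1 := hF.1
    rw [hB, conjTranspose_mul, conjTranspose_conjTranspose]
    calc Uᴴ * F * (Fᴴ * U) = Uᴴ * (F * Fᴴ) * U := by simp only [Matrix.mul_assoc]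
      _ = _ := by rw [h1]; simp [hUU, hc]
  have hBF : Bᴴ * B = Fᴴ * F := by
    rw [hB, conjTranspose_mul, conjTranspose_conjTranspose]
    calc Fᴴ * U * (Uᴴ * F) = Fᴴ * (U * Uᴴ) * F := by simp only [Matrix.mul_assoc]
      _ = _ := by rw [hUU', Matrix.mul_one]
  have h1 : ∀ k, lam k = ∑ n, ‖B k n‖ ^ 2 * Real.exp (y n) := by
    intro k
    have := congrFun (congrFun hBD k) k
    rw [mul_apply, diagonal_apply_eq] at this
    simp only [mul_diagonal, conjTranspose_apply] at this
    apply Complex.ofReal_injective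
    rw [← this, Complex.ofReal_sum]
    refine Finset.sum_congr rfl fun n _ => ?_
    rw [mul_right_comm]
    push_cast
    congr 1
    exact Complex.mul_conj' _
  have h2 : ∀ k, ∑ n, ‖B k n‖ ^ 2 = c := by
    intro k
    have := congrFun (congrFun hBB k) k
    rw [mul_apply] at this
    simp only [conjTranspose_apply, Matrix.smul_apply, one_apply_eq, smul_eq_mul, mul_one] at this
    apply Complex.ofReal_injective
    rw [← this, Complex.ofReal_sum]
    refine Finset.sum_congr rfl fun n _ => ?_
    push_cast
    exact (Complex.mul_conj' _).symm
  have h3 : ∀ n, ∑ k, ‖B k n‖ ^ 2 = 1 := by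
    intro n
    have := hF.2 n
    rw [← hBF, mul_apply] at this
    simp only [conjTranspose_apply] at this
    apply Complex.ofReal_injective
    rw [Complex.ofReal_one, ← this, Complex.ofReal_sum]
    refine Finset.sum_congr rfl fun k _ => ?_
    push_cast
    exact (Complex.conj_mul' _).symm
  set w : Fin d → Fin N → ℝ := fun k n => ‖B k n‖ ^ 2 / c with hw
  have hw0 : ∀ k n, 0 ≤ w k n := fun k n => by simp only [hw]; positivity
  have hw1 : ∀ k, ∑ n, w k n = 1 := by
    intro k
    simp only [hw]
    rw [← Finset.sum_div, h2, div_self hc0.ne']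
  have hlw : ∀ k, lam k = c * ∑ n, w k n • Real.exp (y n) := by
    intro k
    rw [h1, Finset.mul_sum]
    refine Finset.sum_congr rfl fun n _ => ?_
    simp only [hw, smul_eq_mul]
    field_simp
  have hJ : ∀ k, Real.exp (∑ n, w k n • y n) ≤ ∑ n, w k n • Real.exp (y n) := fun k =>
    convexOn_exp.map_sum_le (fun n _ => hw0 k n) (hw1 k) (fun n _ => Set.mem_univ _)
  have hle : ∀ k, c * Real.exp (∑ n, w k n • y n) ≤ lam k := by
    intro k; rw [hlw]; exact mul_le_mul_of_nonneg_left (hJ k) hc0.le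
  have hprod : ∏ k, c * Real.exp (∑ n, w k n • y n) = c ^ d * Real.exp ((d / N : ℝ) * ∑ n, y n) := by
    rw [Finset.prod_mul_distrib, ← Real.exp_sum]
    simp only [Finset.prod_const, Finset.card_univ, Fintype.card_fin]
    congr 2
    rw [Finset.sum_comm, Finset.mul_sum]
    refine Finset.sum_congr rfl fun n _ => ?_
    simp only [smul_eq_mul, hw]
    rw [← Finset.sum_mul, ← Finset.sum_div, h3, hc]
    field_simp
  have hdet : (Sop F y).det.re = ∏ k, lam k := by
    rw [hS.det_eq_prod_eigenvalues]
    have : (∏ i, (hS.eigenvalues i : ℂ)) = ((∏ k, lam k : ℝ) : ℂ) := by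
      push_cast; rfl
    exact (congrArg Complex.re this).trans (Complex.ofReal_re _)
  have hdet0 : (Sop F 0).det.re = c ^ d := by
    have : Sop F 0 = (c : ℂ) • 1 := by
      have h1 := hF.1
      rw [Sop]
      simp [h1, hc]
    rw [this, det_smul]
    simp only [det_one, mul_one, Fintype.card_fin]
    rw [← Complex.ofReal_pow, Complex.ofReal_re]
  have hf : (0 : ℝ) < d.factorial := by exact_mod_cast d.factorial_pos
  rw [Th_eq, Th_eq, hdet, hdet0]
  simp only [Pi.zero_apply, Finset.sum_const_zero, mul_zero, neg_zero, Real.exp_zero, mul_one,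
    ne_eq, OfNat.ofNat_ne_zero, not_false_eq_true, zero_pow, add_zero]
  set s := ∑ n, y n with hs
  have hE : Real.exp ((d / N : ℝ) * s) * Real.exp (-((d / N : ℝ) * s)) = 1 := by
    rw [← Real.exp_add, add_neg_cancel, Real.exp_zero]
  have hEpos := Real.exp_pos (-((d / N : ℝ) * s))
  by_cases hall : ∃ k, Real.exp (∑ n, w k n • y n) < ∑ n, w k n • Real.exp (y n)
  · obtain ⟨k, hk⟩ := hall
    have hlt : ∏ k, c * Real.exp (∑ n, w k n • y n) < ∏ k, lam k := by
      refine Finset.prod_lt_prod (fun k _ => by positivity) (fun k _ => hle k)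
        ⟨k, Finset.mem_univ k, ?_⟩
      rw [hlw]; exact mul_lt_mul_of_pos_left hk hc0
    rw [hprod] at hlt
    have h5 := mul_lt_mul_of_pos_right hlt hEpos
    rw [mul_assoc, hE, mul_one] at h5
    have h6 := mul_lt_mul_of_pos_left h5 hf
    nlinarith [sq_nonneg s]
  · push Not at hall
    have hle' : c ^ d ≤ (∏ k, lam k) * Real.exp (-((d / N : ℝ) * s)) := by
      have : ∏ k, c * Real.exp (∑ n, w k n • y n) ≤ ∏ k, lam k :=
        Finset.prod_le_prod (fun k _ => by positivity) (fun k _ => hle k)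
      rw [hprod] at this
      have h5 := mul_le_mul_of_nonneg_right this hEpos.le
      rwa [mul_assoc, hE, mul_one] at h5
    have hconst : ∀ k m n, B k m ≠ 0 → B k n ≠ 0 → y m = y n := by
      intro k m n hm hn
      have heq := le_antisymm (hJ k) (hall k)
      have := (strictConvexOn_exp.map_sum_eq_iff_of_nonneg (fun n _ => hw0 k n) (hw1 k)
        (fun n _ => Set.mem_univ _)).mp heq
      refine this (Finset.mem_univ m) ?_ (Finset.mem_univ n) ?_
      · simp only [hw]; have := norm_pos_iff.mpr hm; positivity
      · simp only [hw]; have := norm_pos_iff.mpr hn; positivity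
    have hyV : y ∈ Vs F := by
      intro m n hmn
      rw [← hBF, mul_apply] at hmn
      obtain ⟨k, _, hk⟩ := Finset.exists_ne_zero_of_sum_ne_zero hmn
      simp only [conjTranspose_apply] at hk
      refine hconst k m n ?_ ?_
      · intro h; simp [h] at hk
      · intro h; simp [h] at hk
    have hyc := hnd y hyV
    have hs0 : s ≠ 0 := by
      intro h0
      apply hy
      funext n
      have : s = N * y n := by
        rw [hs, Finset.sum_congr rfl fun m _ => hyc m n]; simp
      rw [h0] at this
      simpa [hN0.ne'] using this.symm
    have := sq_pos_of_ne_zero hs0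
    have h6 := mul_le_mul_of_nonneg_left hle' hf.le
    nlinarith

/-- Rotating two columns. -/
def rot {N d : ℕ} (F : Matrix (Fin d) (Fin N) ℂ) (i j : Fin N) (θ : ℝ) :
    Matrix (Fin d) (Fin N) ℂ := fun a n =>
  if n = i then (Real.cos θ : ℂ) * F a i + (Real.sin θ : ℂ) * F a j
  else if n = j then -(Real.sin θ : ℂ) * F a i + (Real.cos θ : ℂ) * F a j else F a n

lemma cs_one (θ : ℝ) : (Real.cos θ : ℂ) * Real.cos θ + (Real.sin θ : ℂ) * Real.sin θ = 1 := by
  have := Real.cos_sq_add_sin_sq θ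
  rw [← Complex.ofReal_mul, ← Complex.ofReal_mul, ← Complex.ofReal_add]
  rw [← sq, ← sq, this, Complex.ofReal_one]

lemma gram_apply {N d : ℕ} (F : Matrix (Fin d) (Fin N) ℂ) (m n : Fin N) :
    (Fᴴ * F) m n = ∑ a, star (F a m) * F a n := by
  rw [mul_apply]; rfl

lemma gram_symm {N d : ℕ} (F : Matrix (Fin d) (Fin N) ℂ) (m n : Fin N) (h : (Fᴴ * F) m n = 0) :
    (Fᴴ * F) n m = 0 := by
  have := (isHermitian_conjTranspose_mul_self F).apply m n
  rw [h] at this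
  exact star_eq_zero.mp this

lemma rot_gram_i {N d : ℕ} (F : Matrix (Fin d) (Fin N) ℂ) (i j : Fin N) (θ : ℝ) (l : Fin N)
    (hi : l ≠ i) (hj : l ≠ j) : ((rot F i j θ)ᴴ * rot F i j θ) l i =
      (Real.cos θ : ℂ) * (Fᴴ * F) l i + (Real.sin θ : ℂ) * (Fᴴ * F) l j := by
  simp only [gram_apply, Finset.mul_sum, ← Finset.sum_add_distrib]
  refine Finset.sum_congr rfl fun a _ => ?_
  simp only [rot, hi, hj, if_true, if_false]
  ring

lemma rot_gram_j {N d : ℕ} (F : Matrix (Fin d) (Fin N) ℂ) (i j : Fin N) (hij : i ≠ j) (θ : ℝ)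
    (l : Fin N) (hi : l ≠ i) (hj : l ≠ j) : ((rot F i j θ)ᴴ * rot F i j θ) l j =
      -(Real.sin θ : ℂ) * (Fᴴ * F) l i + (Real.cos θ : ℂ) * (Fᴴ * F) l j := by
  simp only [gram_apply, Finset.mul_sum, ← Finset.sum_add_distrib]
  refine Finset.sum_congr rfl fun a _ => ?_
  simp only [rot, hi, hj, hij.symm, if_true, if_false]
  ring

lemma rot_gram {N d : ℕ} (F : Matrix (Fin d) (Fin N) ℂ) (i j : Fin N) (θ : ℝ)
    (l m : Fin N) (hi : l ≠ i) (hj : l ≠ j) (hi' : m ≠ i) (hj' : m ≠ j) :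
    ((rot F i j θ)ᴴ * rot F i j θ) l m = (Fᴴ * F) l m := by
  simp only [gram_apply]
  refine Finset.sum_congr rfl fun a _ => ?_
  simp only [rot, hi, hj, hi', hj', if_false]

lemma rot_mem {N d : ℕ} (F : Matrix (Fin d) (Fin N) ℂ) (hF : F ∈ FUNTF ℂ N d) (i j : Fin N)
    (hij : i ≠ j) (h0 : (Fᴴ * F) i j = 0) (θ : ℝ) : rot F i j θ ∈ FUNTF ℂ N d := by
  have h0' := gram_symm F i j h0
  have hi := hF.2 i
  have hj := hF.2 j
  have hcs := cs_one θ
  have hstarc : star (Real.cos θ : ℂ) = (Real.cos θ : ℂ) := Complex.conj_ofReal _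
  have hstars : star (Real.sin θ : ℂ) = (Real.sin θ : ℂ) := Complex.conj_ofReal _
  constructor
  · rw [← hF.1]
    ext a b
    rw [mul_apply, mul_apply]
    rw [← Finset.add_sum_erase _ _ (Finset.mem_univ i),
      ← Finset.add_sum_erase _ _ (Finset.mem_erase.mpr ⟨hij.symm, Finset.mem_univ j⟩),
      ← Finset.add_sum_erase _ _ (Finset.mem_univ i),
      ← Finset.add_sum_erase _ _ (Finset.mem_erase.mpr ⟨hij.symm, Finset.mem_univ j⟩)]
    have hrest : ∑ x ∈ (Finset.univ.erase i).erase j, rot F i j θ a x * (rot F i j θ)ᴴ x b =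
        ∑ x ∈ (Finset.univ.erase i).erase j, F a x * Fᴴ x b := by
      refine Finset.sum_congr rfl fun x hx => ?_
      simp only [Finset.mem_erase] at hx
      simp only [conjTranspose_apply, rot, hx.1, hx.2.1, if_false]
    rw [hrest, ← add_assoc, ← add_assoc]
    congr 1
    simp only [conjTranspose_apply, rot, if_true, hij.symm, if_false, star_add, star_mul', hstarc,
      hstars, star_neg]
    linear_combination (F a i * star (F b i) + F a j * star (F b j)) * hcs
  · intro n
    by_cases h1 : n = i
    · subst h1
      rw [gram_apply] at *
      have : ∑ a, star (rot F n j θ a n) * rot F n j θ a n =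
          (Real.cos θ : ℂ) * Real.cos θ * ∑ a, star (F a n) * F a n +
          (Real.cos θ : ℂ) * Real.sin θ * ∑ a, star (F a n) * F a j +
          (Real.cos θ : ℂ) * Real.sin θ * ∑ a, star (F a j) * F a n +
          (Real.sin θ : ℂ) * Real.sin θ * ∑ a, star (F a j) * F a j := by
        simp only [Finset.mul_sum, ← Finset.sum_add_distrib]
        refine Finset.sum_congr rfl fun a _ => ?_
        simp only [rot, if_true, star_add, star_mul', hstarc, hstars]
        ring
      rw [this, h0, h0', hi, hj]
      linear_combination hcs
    · by_cases h2 : n = j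
      · subst h2
        rw [gram_apply] at *
        have : ∑ a, star (rot F i n θ a n) * rot F i n θ a n =
          (Real.sin θ : ℂ) * Real.sin θ * ∑ a, star (F a i) * F a i -
          (Real.cos θ : ℂ) * Real.sin θ * ∑ a, star (F a i) * F a n -
          (Real.cos θ : ℂ) * Real.sin θ * ∑ a, star (F a n) * F a i +
          (Real.cos θ : ℂ) * Real.cos θ * ∑ a, star (F a n) * F a n := by
          simp only [Finset.mul_sum, ← Finset.sum_add_distrib, ← Finset.sum_sub_distrib]
          refine Finset.sum_congr rfl fun a _ => ?_
          simp only [rot, if_true, if_false, h1, star_add, star_mul', star_neg, hstarc, hstars]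
          ring
        rw [this, h0, h0', hi, hj]
        linear_combination hcs
      · rw [rot_gram F i j θ n n h1 h2 h1 h2, hF.2 n]

lemma rot_joined {N d : ℕ} (F : Matrix (Fin d) (Fin N) ℂ) (hF : F ∈ FUNTF ℂ N d) (i j : Fin N)
    (hij : i ≠ j) (h0 : (Fᴴ * F) i j = 0) (θ : ℝ) :
    JoinedIn (FUNTF ℂ N d) F (rot F i j θ) := by
  refine JoinedIn.ofLine (f := fun t : ℝ => rot F i j (t * θ)) ?_ ?_ ?_ ?_
  · apply Continuous.continuousOn
    refine continuous_pi fun a => continuous_pi fun n => ?_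
    unfold rot
    by_cases h1 : n = i
    · simp only [h1, if_true]; fun_prop
    · by_cases h2 : n = j
      · simp only [h1, h2, hij.symm, if_true, if_false]; fun_prop
      · simp only [h1, h2, if_false]; fun_prop
  · ext a n
    simp only [rot]
    by_cases h1 : n = i
    · simp [h1]
    · by_cases h2 : n = j
      · simp [h2, hij.symm]
      · simp [h1, h2]
  · simp
  · rintro _ ⟨t, _, rfl⟩
    exact rot_mem F hF i j hij h0 _

lemma exists_neighbor {N d : ℕ} (hN : d < N) (F : Matrix (Fin d) (Fin N) ℂ)
    (hF : F ∈ FUNTF ℂ N d) : ∃ k l, k ≠ l ∧ (Fᴴ * F) k l ≠ 0 := by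
  by_contra hcon
  push Not at hcon
  have : Fᴴ * F = 1 := by
    ext k l
    by_cases h : k = l
    · subst h; rw [hF.2 k, one_apply_eq]
    · rw [hcon k l h, one_apply_ne h]
  have h1 := rank_mul_le_right Fᴴ F
  rw [this, rank_one, Fintype.card_fin] at h1
  have h2 := rank_le_height F
  omega

lemma exists_nd {N d : ℕ} (hN : d < N) (V : Submodule ℝ (Fin N → ℝ)) :
    ∀ F : Matrix (Fin d) (Fin N) ℂ, Vs F = V → F ∈ FUNTF ℂ N d →
    ∃ F', Nd F' ∧ JoinedIn (FUNTF ℂ N d) F F' := by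
  induction V using WellFoundedLT.induction with
  | ind V ih =>
  intro F hV hF
  by_cases hnd : Nd F
  · exact ⟨F, hnd, JoinedIn.refl hF⟩
  unfold Nd at hnd
  push Not at hnd
  obtain ⟨x, hx, m, n, hmn⟩ := hnd
  obtain ⟨i, l, hil, hg⟩ := exists_neighbor hN F hF
  obtain ⟨j, hxj⟩ : ∃ j, x i ≠ x j := by
    by_contra hcon
    push Not at hcon
    exact hmn ((hcon m).symm.trans (hcon n))
  have hzero : ∀ a b, x a ≠ x b → (Fᴴ * F) a b = 0 := by
    intro a b hab
    by_contra h
    exact hab (hx a b h)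
  have hij : i ≠ j := by rintro rfl; exact hxj rfl
  have hxl : x i = x l := hx i l hg
  have hlj : l ≠ j := by rintro rfl; exact hxj hxl
  have hg' : (Fᴴ * F) l i ≠ 0 := fun h => hg (gram_symm F l i h)
  have h0 : (Fᴴ * F) i j = 0 := hzero i j hxj
  set θ := Real.pi / 4 with hθ
  have hcos : (Real.cos θ : ℂ) ≠ 0 := by
    rw [hθ, Real.cos_pi_div_four]
    exact_mod_cast (by positivity : (√2 / 2 : ℝ) ≠ 0)
  have hsin : (Real.sin θ : ℂ) ≠ 0 := by
    rw [hθ, Real.sin_pi_div_four]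
    exact_mod_cast (by positivity : (√2 / 2 : ℝ) ≠ 0)
  have hjoin := rot_joined F hF i j hij h0 θ
  have hyij : ∀ y ∈ Vs (rot F i j θ), y i = y j := by
    intro y hy
    have hlj0 : (Fᴴ * F) l j = 0 := hzero l j (by rw [← hxl]; exact hxj)
    have e1 : y l = y i := hy l i (by
      rw [rot_gram_i F i j θ l hil.symm hlj, hlj0]
      rw [mul_zero, add_zero]
      exact mul_ne_zero hcos hg')
    have e2 : y l = y j := hy l j (by
      rw [rot_gram_j F i j hij θ l hil.symm hlj, hlj0]
      rw [mul_zero, add_zero]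
      exact mul_ne_zero (neg_ne_zero.mpr hsin) hg')
    rw [← e1, e2]
  have hkey : ∀ y ∈ Vs (rot F i j θ), ∀ a b, a ≠ i → a ≠ j → (Fᴴ * F) a b ≠ 0 → y a = y b := by
    intro y hy a b ha ha' hab
    by_cases hb : b = i
    · subst hb
      have : (Fᴴ * F) a j = 0 := hzero a j (by rw [hx a b hab]; exact hxj)
      refine hy a b ?_
      rw [rot_gram_i F b j θ a ha ha', this]
      rw [mul_zero, add_zero]
      exact mul_ne_zero hcos hab
    · by_cases hb' : b = j
      · subst hb'
        have : (Fᴴ * F) a i = 0 := hzero a i (by rw [hx a b hab]; exact hxj.symm)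
        rw [← hyij y hy]
        refine hy a i ?_
        rw [rot_gram_i F i b θ a ha ha', this]
        rw [mul_zero, zero_add]
        exact mul_ne_zero hsin hab
      · refine hy a b ?_
        rw [rot_gram F i j θ a b ha ha' hb hb']
        exact hab
  have hle : Vs (rot F i j θ) ≤ Vs F := by
    intro y hy a b hab
    have hba : (Fᴴ * F) b a ≠ 0 := fun h => hab (gram_symm F b a h)
    by_cases ha : a ≠ i ∧ a ≠ j
    · exact hkey y hy a b ha.1 ha.2 hab
    · by_cases hb : b ≠ i ∧ b ≠ j
      · exact (hkey y hy b a hb.1 hb.2 hba).symm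
      · have e1 : y a = y i := by
          by_cases h : a = i
          · rw [h]
          · have : a = j := by tauto
            rw [this, hyij y hy]
        have e2 : y b = y i := by
          by_cases h : b = i
          · rw [h]
          · have : b = j := by tauto
            rw [this, hyij y hy]
        rw [e1, e2]
  have hlt : Vs (rot F i j θ) < V := by
    rw [← hV]
    refine lt_of_le_of_ne hle fun h => ?_
    rw [← h] at hx
    exact hxj (hyij x hx)
  obtain ⟨F', hF', hJ⟩ := ih _ hlt (rot F i j θ) rfl hjoin.target_mem
  exact ⟨F', hF', hjoin.trans hJ⟩

end FuntfAux

namespace FuntfAux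
open Matrix

lemma finite_roots {d : ℕ} (A B : Matrix (Fin d) (Fin d) ℂ) (h : B.det ≠ 0) :
    {z : ℂ | (A + z • (B - A)).det = 0}.Finite := by
  let M : Matrix (Fin d) (Fin d) (Polynomial ℂ) :=
    A.map Polynomial.C + (Polynomial.X : Polynomial ℂ) • (B - A).map Polynomial.C
  have hM : ∀ z, M.det.eval z = (A + z • (B - A)).det := by
    intro z
    have := RingHom.map_det (Polynomial.evalRingHom z) M
    rw [Polynomial.coe_evalRingHom] at this
    rw [this]
    congr 1
    ext i j
    simp [M]
  have hne : M.det ≠ 0 := by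
    intro h0
    have := hM 1
    rw [h0] at this
    simp only [Polynomial.eval_zero, one_smul, add_sub_cancel] at this
    exact h this.symm
  refine (Polynomial.finite_setOf_isRoot hne).subset fun z hz => ?_
  simp only [Set.mem_setOf_eq, Polynomial.IsRoot.def] at *
  rw [hM, hz]

lemma line_joined {N d : ℕ} (Good : Set (Matrix (Fin d) (Fin N) ℂ))
    (F H : Matrix (Fin d) (Fin N) ℂ) (hF : F ∈ Good) (hH : H ∈ Good)
    (hfin : {z : ℂ | F + z • (H - F) ∉ Good}.Finite) : JoinedIn Good F H := by
  have hpc : IsPathConnected ({z : ℂ | F + z • (H - F) ∉ Good}ᶜ) :=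
    hfin.countable.isPathConnected_compl_of_one_lt_rank (by
      rw [Complex.rank_real_complex]; exact Cardinal.one_lt_two)
  have hJ := hpc.joinedIn 0 (by simpa using hF) 1 (by simpa using hH)
  have := hJ.map (f := fun z : ℂ => F + z • (H - F)) (by fun_prop)
  simp only [zero_smul, add_zero, one_smul, add_sub_cancel] at this
  refine this.mono ?_
  rintro _ ⟨z, hz, rfl⟩
  simpa using hz

lemma exists_minor {N d : ℕ} (hd : 1 ≤ d) (hN : 0 < N) (F : Matrix (Fin d) (Fin N) ℂ)
    (hF : F ∈ FUNTF ℂ N d) : ∃ p : Fin d → Fin N, (F.submatrix id p).det ≠ 0 := by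
  by_contra hcon
  push Not at hcon
  have h := det_Sop F 0
  have h1 : Sop F 0 = ((N : ℂ) / d) • 1 := by
    have h1 := hF.1
    rw [Sop]
    simp [h1]
  have hdC : (d : ℂ) ≠ 0 := by exact_mod_cast (by omega : d ≠ 0)
  have hNC : (N : ℂ) ≠ 0 := by exact_mod_cast (by omega : N ≠ 0)
  have hf : (d.factorial : ℂ) ≠ 0 := by exact_mod_cast d.factorial_ne_zero
  rw [h1, det_smul, det_one, mul_one] at h
  have h2 : (d.factorial : ℂ) * ((N : ℂ) / d) ^ Fintype.card (Fin d) ≠ 0 :=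
    mul_ne_zero hf (pow_ne_zero _ (div_ne_zero hNC hdC))
  apply h2
  rw [h]
  simp [hcon]

lemma det_Sop_ne {N d : ℕ} (F : Matrix (Fin d) (Fin N) ℂ) (x : Fin N → ℝ)
    (hF : ∃ p : Fin d → Fin N, (F.submatrix id p).det ≠ 0) : (Sop F x).det ≠ 0 := by
  obtain ⟨p, hp⟩ := hF
  intro h0
  have h := det_Sop F x
  rw [h0, mul_zero] at h
  have h1 : (∑ p : Fin d → Fin N, ‖(F.submatrix id p).det‖ ^ 2 * Real.exp (∑ i, x (p i))) = 0 :=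
    Complex.ofReal_injective (by rw [← h, Complex.ofReal_zero])
  have h2 := (Finset.sum_eq_zero_iff_of_nonneg (fun q _ => by positivity)).mp h1 p
    (Finset.mem_univ p)
  have := norm_pos_iff.mpr hp
  have h3 : 0 < ‖(F.submatrix id p).det‖ ^ 2 * Real.exp (∑ i, x (p i)) := by positivity
  exact absurd h2 (ne_of_gt h3)

/-- Matrices to which the retraction applies. -/
def Good (N d : ℕ) : Set (Matrix (Fin d) (Fin N) ℂ) :=
  {F | (∃ p : Fin d → Fin N, (F.submatrix id p).det ≠ 0) ∧ ∃ x, SMin F x}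

lemma good_of_spark {N d : ℕ} (hd : 1 ≤ d) (hN : d < N) (F : Matrix (Fin d) (Fin N) ℂ)
    (hF : ∀ p : Fin d → Fin N, Function.Injective p → (F.submatrix id p).det ≠ 0) :
    F ∈ Good N d :=
  ⟨⟨Fin.castLE hN.le, hF _ (Fin.castLE_injective _)⟩, exists_smin hd hN F hF⟩

/-- The reference full spark matrix. -/
def Vd (N d : ℕ) : Matrix (Fin d) (Fin N) ℂ := fun a n => ((n : ℕ) : ℂ) ^ (a : ℕ)

lemma Vd_spark (N d : ℕ) (p : Fin d → Fin N) (hp : Function.Injective p) :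
    ((Vd N d).submatrix id p).det ≠ 0 := by
  have : (Vd N d).submatrix id p = (vandermonde fun i => (((p i : Fin N) : ℕ) : ℂ))ᵀ := by
    ext a n
    simp [Vd, vandermonde_apply]
  rw [this, det_transpose, det_vandermonde_ne_zero_iff]
  intro i j hij
  exact hp (Fin.ext (Nat.cast_injective hij))

lemma case_lt {N d : ℕ} (hd : 1 ≤ d) (hN : d < N) :
    ∃ T0 ∈ FUNTF ℂ N d, ∀ F ∈ FUNTF ℂ N d, JoinedIn (FUNTF ℂ N d) F T0 := by
  have hN0 : 0 < N := by omega
  let m : Good N d → Fin N → ℝ := fun F => F.2.2.choose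
  have hm : ∀ F : Good N d, SMin F.1 (m F) := fun F => F.2.2.choose_spec
  have hmc : Continuous m := smin_continuous Subtype.val continuous_subtype_val m hm
  have hc : ∀ F : Good N d, Crit F.1 (m F) := fun F =>
    crit_of_smin hN0 F.1 (m F) (hm F) (det_Sop_ne _ _ F.2.1)
  obtain ⟨R, hR, hRm, hRe⟩ := exists_lift hd hN0 Subtype.val continuous_subtype_val m hmc hc
  have hH : Vd N d ∈ Good N d := good_of_spark hd hN _ (Vd_spark N d)
  refine ⟨R ⟨_, hH⟩, hRm _, fun F0 hF0 => ?_⟩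
  obtain ⟨F, hnd, hJ⟩ := exists_nd hN _ F0 rfl hF0
  refine hJ.trans ?_
  have hF := hJ.target_mem
  have hs := smin_zero hd hN0 F hF hnd
  have hFG : F ∈ Good N d := ⟨exists_minor hd hN0 F hF, 0, hs⟩
  have hm0 : m ⟨F, hFG⟩ = 0 := by
    by_contra hne
    have h1 := hs _ hne
    have h2 := hm ⟨F, hFG⟩ 0 (fun h => hne h.symm)
    exact lt_asymm h1 h2
  have hRF : R ⟨F, hFG⟩ = F := hRe ⟨F, hFG⟩ hF hm0
  have hl : JoinedIn (Good N d) F (Vd N d) := by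
    refine line_joined _ _ _ hFG hH ?_
    have : (⋃ p ∈ {p : Fin d → Fin N | Function.Injective p},
        {z : ℂ | (F.submatrix id p + z • ((Vd N d).submatrix id p - F.submatrix id p)).det = 0}).Finite :=
      Set.Finite.biUnion (Set.toFinite _) fun p hp => finite_roots _ _ (Vd_spark N d p hp)
    refine this.subset fun z hz => ?_
    by_contra hcon
    apply hz
    apply good_of_spark hd hN
    intro p hp h0
    apply hcon
    simp only [Set.mem_iUnion]
    exact ⟨p, hp, h0⟩
  obtain ⟨γ⟩ : Joined (⟨F, hF⟩ : FUNTF ℂ N d) ⟨R ⟨_, hH⟩, hRm _⟩ := by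
    have := (hl.joined_subtype).map (f := fun t => (⟨R t, hRm t⟩ : FUNTF ℂ N d))
      (hR.subtype_mk hRm)
    convert this using 2
    exact hRF.symm
  exact (joinedIn_iff_joined hF (hRm _)).mpr ⟨γ⟩

lemma case_eq {d : ℕ} (hd : 1 ≤ d) :
    ∃ T0 ∈ FUNTF ℂ d d, ∀ F ∈ FUNTF ℂ d d, JoinedIn (FUNTF ℂ d d) F T0 := by
  have hdC : (d : ℂ) ≠ 0 := by exact_mod_cast (by omega : d ≠ 0)
  let Gd : Set (Matrix (Fin d) (Fin d) ℂ) := {F | F.det ≠ 0}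
  have hS : ∀ F : Matrix (Fin d) (Fin d) ℂ, Sop F 0 = F * Fᴴ := by
    intro F; rw [Sop]; simp
  have hc : ∀ F : Gd, Crit F.1 ((fun _ => 0 : Gd → Fin d → ℝ) F) := by
    rintro ⟨F, hF⟩
    have hF' : IsUnit F.det := isUnit_iff_ne_zero.mpr hF
    have hFs : IsUnit Fᴴ.det := by
      rw [det_conjTranspose]; exact isUnit_iff_ne_zero.mpr (star_ne_zero.mpr hF)
    refine ⟨?_, fun n => ?_⟩
    · simp only [hS]
      rw [det_mul]
      exact mul_ne_zero hF hFs.ne_zero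
    · simp only [hS]
      rw [Matrix.mul_inv_rev, ← Matrix.mul_assoc, mul_nonsing_inv _ hFs, Matrix.one_mul,
        nonsing_inv_mul _ hF']
      simp [div_self hdC]
  obtain ⟨R, hR, hRm, hRe⟩ := exists_lift hd (by omega) (Subtype.val : Gd → _)
    continuous_subtype_val (fun _ => 0) continuous_const hc
  have hH : (1 : Matrix (Fin d) (Fin d) ℂ) ∈ Gd := by simp [Gd]
  refine ⟨R ⟨_, hH⟩, hRm _, fun F hF => ?_⟩
  have hFG : F ∈ Gd := by
    intro h0
    have h1 := congrArg det hF.1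
    rw [div_self hdC, one_smul, det_mul, h0, zero_mul, det_one] at h1
    exact zero_ne_one h1
  have hRF : R ⟨F, hFG⟩ = F := hRe ⟨F, hFG⟩ hF rfl
  have hl : JoinedIn Gd F 1 := by
    refine line_joined _ _ _ hFG hH ?_
    refine (finite_roots F 1 (by simp)).subset fun z hz => ?_
    simpa [Gd] using hz
  have hj : Joined (⟨F, hF⟩ : FUNTF ℂ d d) ⟨R ⟨_, hH⟩, hRm _⟩ := by
    have := (hl.joined_subtype).map (f := fun t => (⟨R t, hRm t⟩ : FUNTF ℂ d d))
      (hR.subtype_mk hRm)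
    convert this using 2
    exact hRF.symm
  exact (joinedIn_iff_joined hF (hRm _)).mpr hj

end FuntfAux

/-- The space of complex FUNTFs of `N` vectors in `ℂ^d` is path-connected for `N ≥ d ≥ 1`. -/
theorem funtf_complex_pathConnected (N d : ℕ) (hd : 1 ≤ d) (hN : d ≤ N) :
    IsPathConnected (FUNTF ℂ N d) := by
  obtain ⟨T0, h0, hJ⟩ : ∃ T0 ∈ FUNTF ℂ N d, ∀ F ∈ FUNTF ℂ N d,
      JoinedIn (FUNTF ℂ N d) F T0 := by
    rcases hN.lt_or_eq with h | h
    · exact FuntfAux.case_lt hd h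
    · subst h
      exact FuntfAux.case_eq hd
  exact ⟨T0, h0, fun y hy => (hJ y hy).symm⟩
end
end

section
/- For all integers N and d with N ≥ d + 2 ≥ 4 (i.e., d ≥ 2 and N ≥ d + 2), the space 𝓕_{N,d}^ℝ of real finite unit norm tight frames of N vectors in ℝ^d is path-connected (as a subset of the space of d×N real matrices with its standard topology). -/
noncomputable section

section Aux
open Matrix Topology



/-- orthogonal matrices -/
def OO (n : Type*) [Fintype n] [DecidableEq n] : Set (Matrix n n ℝ) := {U | U * Uᵀ = 1}

section basics
variable {n m : Type*} [Fintype n] [DecidableEq n] [Fintype m] [DecidableEq m]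

lemma OO.mul_tr {U : Matrix n n ℝ} (h : U ∈ OO n) : U * Uᵀ = 1 := h
lemma OO.tr_mul {U : Matrix n n ℝ} (h : U ∈ OO n) : Uᵀ * U = 1 := mul_eq_one_comm.1 h
lemma OO.mul {U V : Matrix n n ℝ} (h : U ∈ OO n) (h' : V ∈ OO n) : U * V ∈ OO n := by
  change U * V * (U * V)ᵀ = 1
  rw [transpose_mul, Matrix.mul_assoc, ← Matrix.mul_assoc V, (OO.mul_tr h'), Matrix.one_mul, (OO.mul_tr h)]
lemma OO.tr {U : Matrix n n ℝ} (h : U ∈ OO n) : Uᵀ ∈ OO n := by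
  change Uᵀ * Uᵀᵀ = 1
  rw [transpose_transpose, (OO.tr_mul h)]
lemma OO.one : (1 : Matrix n n ℝ) ∈ OO n := by
  change (1 : Matrix n n ℝ) * 1ᵀ = 1
  simp
lemma OO.det {U : Matrix n n ℝ} (h : U ∈ OO n) : U.det = 1 ∨ U.det = -1 := by
  have := congrArg Matrix.det (OO.mul_tr h)
  rw [det_mul, det_transpose, det_one] at this
  exact mul_self_eq_one_iff.1 this

/-- Householder reflection -/
def hh (w : n → ℝ) : Matrix n n ℝ := 1 - (2 / (w ⬝ᵥ w)) • vecMulVec w w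

lemma dot_self_ne {w : n → ℝ} (h : w ≠ 0) : w ⬝ᵥ w ≠ 0 := by
  intro h'
  exact h (dotProduct_self_eq_zero.1 h')

lemma hh_tr (w : n → ℝ) : (hh w)ᵀ = hh w := by
  simp [hh, transpose_vecMulVec]

lemma hh_mulVec (w x : n → ℝ) : hh w *ᵥ x = x - (2 * (w ⬝ᵥ x) / (w ⬝ᵥ w)) • w := by
  rw [hh, sub_mulVec, one_mulVec, smul_mulVec, vecMulVec_mulVec]
  ext i
  simp
  ring

lemma hh_mem {w : n → ℝ} (h : w ≠ 0) : hh w ∈ OO n := by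
  change hh w * (hh w)ᵀ = 1
  rw [hh_tr]
  have := dot_self_ne h
  simp only [hh, Matrix.sub_mul, Matrix.mul_sub, Matrix.one_mul, Matrix.mul_one, Matrix.smul_mul,
    Matrix.mul_smul, vecMulVec_mul_vecMulVec, smul_smul]
  ext i j
  simp [vecMulVec_apply]
  field_simp
  ring

lemma hh_det {w : n → ℝ} (h : w ≠ 0) : (hh w).det = -1 := by
  have := dot_self_ne h
  have h1 : hh w = 1 + vecMulVec (-(2 / (w ⬝ᵥ w)) • w) w := by
    rw [hh, smul_vecMulVec]
    simp [sub_eq_add_neg]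
  rw [h1, vecMulVec_eq Unit, det_one_add_replicateCol_mul_replicateRow]
  rw [dotProduct_smul]
  field_simp
  simp
  field_simp
  norm_num

/-- reflection moving x to y -/
lemma hh_swap {x y : n → ℝ} (h : x ⬝ᵥ x = y ⬝ᵥ y) (hxy : x ≠ y) : hh (x - y) *ᵥ x = y := by
  rw [hh_mulVec]
  have h1 : (x - y) ⬝ᵥ (x - y) = 2 * ((x - y) ⬝ᵥ x) := by
    simp only [sub_dotProduct, dotProduct_sub, dotProduct_comm y x]
    linarith
  have h2 := dot_self_ne (sub_ne_zero.2 hxy)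
  rw [← h1, div_self h2]
  simp

lemma hh_fix {w x : n → ℝ} (h : w ⬝ᵥ x = 0) : hh w *ᵥ x = x := by
  rw [hh_mulVec, h]; simp

lemma hh_contAt {w : n → ℝ} (h : w ≠ 0) : ContinuousAt (hh : (n → ℝ) → Matrix n n ℝ) w := by
  have := dot_self_ne h
  unfold hh
  refine ContinuousAt.sub continuousAt_const ?_
  refine ContinuousAt.smul (f := fun w : n → ℝ => 2 / (w ⬝ᵥ w)) (g := fun w => vecMulVec w w) ?_ ?_
  · refine ContinuousAt.div continuousAt_const ?_ this
    exact Continuous.continuousAt (by fun_prop)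
  · exact Continuous.continuousAt (Continuous.matrix_vecMulVec continuous_id continuous_id)

lemma JoinedIn.image_sub {X Y : Type*} [TopologicalSpace X] [TopologicalSpace Y] {A : Set X} {B : Set Y}
    {x y : X} (h : JoinedIn A x y) {f : X → Y} (hf : ContinuousOn f A) (hAB : ∀ a ∈ A, f a ∈ B) :
    JoinedIn B (f x) (f y) :=
  (h.map_continuousOn hf).mono (by rintro _ ⟨a, ha, rfl⟩; exact hAB a ha)

lemma hh_joined [Nontrivial n] {w w' : n → ℝ} (h : w ≠ 0) (h' : w' ≠ 0) :
    JoinedIn (OO n) (hh w) (hh w') := by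
  have hr : 1 < Module.rank ℝ (n → ℝ) := by
    rw [rank_fun']
    exact_mod_cast Fintype.one_lt_card
  have := (isPathConnected_compl_singleton_of_one_lt_rank hr (0 : n → ℝ)).joinedIn w h w' h'
  refine this.image_sub (fun x hx => (hh_contAt hx).continuousWithinAt) (fun a ha => hh_mem ha)

lemma JoinedIn.OO_mul {U U' V V' : Matrix n n ℝ} (h : JoinedIn (OO n) U U') (h' : JoinedIn (OO n) V V') :
    JoinedIn (OO n) (U * V) (U' * V') := by
  have h1 : JoinedIn (OO n) (U * V) (U' * V) :=
    h.image_sub (f := fun x => x * V) (by fun_prop) (fun a ha => OO.mul ha h'.source_mem)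
  have h2 : JoinedIn (OO n) (U' * V) (U' * V') :=
    h'.image_sub (f := fun x => U' * x) (by fun_prop) (fun a ha => OO.mul h.target_mem ha)
  exact h1.trans h2

lemma OO_reduce [Nontrivial n] (w : n → ℝ) (hw : w ≠ 0) (k : ℕ) : ∀ (s : Finset n) (_ : sᶜ.card = k) (U : Matrix n n ℝ)
    (_ : U ∈ OO n) (_ : ∀ i ∈ s, U *ᵥ Pi.single i 1 = Pi.single i 1),
    ∃ j : ℕ, U.det = (-1) ^ j ∧ JoinedIn (OO n) U (hh w ^ j) := by
  induction k with
  | zero =>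
    intro s hs U hU hfix
    have hs' : s = Finset.univ := by
      rw [Finset.card_eq_zero] at hs
      simpa using hs
    have : U = 1 := by
      ext i j
      have := congrFun (hfix j (by simp [hs'])) i
      rw [mulVec_single_one] at this
      simpa [Matrix.one_apply, Pi.single_apply] using this
    subst this
    exact ⟨0, by simp, by simpa using JoinedIn.refl OO.one⟩
  | succ k ih =>
    intro s hs U hU hfix
    obtain ⟨a, ha⟩ : sᶜ.Nonempty := by
      rw [← Finset.card_pos]; omega
    have ha' : a ∉ s := by simpa using ha
    have hcard : (insert a s)ᶜ.card = k := by
      rw [Finset.compl_insert, Finset.card_erase_of_mem ha]; omega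
    by_cases hE : U *ᵥ Pi.single a 1 = Pi.single a 1
    · refine ih (insert a s) hcard U hU ?_
      intro i hi
      rcases Finset.mem_insert.1 hi with rfl | hi
      · exact hE
      · exact hfix i hi
    · set x : n → ℝ := U *ᵥ Pi.single a 1 with hx
      set y : n → ℝ := Pi.single a 1 with hy
      have hiso : ∀ u v : n → ℝ, (U *ᵥ u) ⬝ᵥ (U *ᵥ v) = u ⬝ᵥ v := by
        intro u v
        rw [dotProduct_mulVec, ← mulVec_transpose, mulVec_mulVec, (OO.tr_mul hU), one_mulVec]
      have hne : x - y ≠ 0 := sub_ne_zero.2 hE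
      obtain ⟨j, hj1, hj2⟩ := ih (insert a s) hcard (hh (x - y) * U) (OO.mul (hh_mem hne) hU) (by
        intro i hi
        rw [← mulVec_mulVec]
        rcases Finset.mem_insert.1 hi with rfl | hi
        · exact hh_swap (hiso _ _) hE
        · rw [hfix i hi]
          apply hh_fix
          have : x ⬝ᵥ Pi.single i 1 = y ⬝ᵥ Pi.single i 1 := by
            conv_lhs => rw [← hfix i hi]
            exact hiso _ _
          rw [sub_dotProduct, this, sub_self])
      have h2 : hh (x - y) * (hh (x - y) * U) = U := by
        have := (OO.mul_tr (hh_mem hne))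
        rw [hh_tr] at this
        rw [← Matrix.mul_assoc, this, Matrix.one_mul]
      refine ⟨j + 1, ?_, ?_⟩
      · rw [← h2, det_mul, hj1, hh_det hne]; ring
      · rw [pow_succ', ← h2]
        exact (hh_joined hne hw).OO_mul hj2

lemma OO_joined [Nontrivial n] {U V : Matrix n n ℝ} (hU : U ∈ OO n) (hV : V ∈ OO n)
    (h : U.det = V.det) : JoinedIn (OO n) U V := by
  obtain ⟨a⟩ : Nonempty n := inferInstance
  have hw : (Pi.single a 1 : n → ℝ) ≠ 0 := by simp
  set w : n → ℝ := Pi.single a 1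
  obtain ⟨j, hj, hj'⟩ := OO_reduce w hw _ ∅ rfl U hU (by simp)
  obtain ⟨k, hk, hk'⟩ := OO_reduce w hw _ ∅ rfl V hV (by simp)
  have hsq : hh w * hh w = 1 := by
    have := (OO.mul_tr (hh_mem hw))
    rwa [hh_tr] at this
  have hp : ∀ j : ℕ, hh w ^ j = if Even j then 1 else hh w := by
    intro j
    rcases Nat.even_or_odd' j with ⟨c, rfl | rfl⟩
    · simp [pow_mul, pow_two, hsq]
    · simp [pow_succ, pow_mul, hsq]
  have : Even j ↔ Even k := by
    rw [hj, hk] at h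
    rcases Nat.even_or_odd j with h1 | h1 <;> rcases Nat.even_or_odd k with h2 | h2
    · simp [h1, h2]
    · rw [h1.neg_one_pow, h2.neg_one_pow] at h; norm_num at h
    · rw [h1.neg_one_pow, h2.neg_one_pow] at h; norm_num at h
    · simp [Nat.not_even_iff_odd.2 h1, Nat.not_even_iff_odd.2 h2]
  rw [hp] at hj' hk'
  simp only [this] at hj'
  exact hj'.trans hk'.symm

/-- same Gram of rows implies orthogonally equivalent -/
lemma exists_OO_of_gram {A B : Matrix m n ℝ} (h : A * Aᵀ = B * Bᵀ) : ∃ U ∈ OO n, A = B * U := by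
  classical
  let fA : (EuclideanSpace ℝ m) →ₗ[ℝ] (EuclideanSpace ℝ n) := Matrix.toEuclideanLin Aᵀ
  let fB : (EuclideanSpace ℝ m) →ₗ[ℝ] (EuclideanSpace ℝ n) := Matrix.toEuclideanLin Bᵀ
  have key : ∀ (C : Matrix m n ℝ) (x : EuclideanSpace ℝ m), ‖Matrix.toEuclideanLin Cᵀ x‖ ^ 2
      = x.ofLp ⬝ᵥ ((C * Cᵀ) *ᵥ x.ofLp) := by
    intro C x
    rw [← real_inner_self_eq_norm_sq, Matrix.toLpLin_apply, EuclideanSpace.inner_toLp_toLp]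
    simp [← mulVec_mulVec, dotProduct_mulVec, vecMul_transpose, mulVec_transpose]
  have hnorm : ∀ x, ‖fA x‖ = ‖fB x‖ := by
    intro x
    have : ‖fA x‖ ^ 2 = ‖fB x‖ ^ 2 := by rw [key, key, h]
    exact (sq_eq_sq₀ (norm_nonneg _) (norm_nonneg _)).1 this
  have hker : LinearMap.ker fB ≤ LinearMap.ker fA := by
    intro x hx
    rw [LinearMap.mem_ker] at hx ⊢
    rw [← norm_eq_zero, hnorm, hx, norm_zero]
  -- the map range fB → ...
  let e := fB.quotKerEquivRange
  let L0 : LinearMap.range fB →ₗ[ℝ] EuclideanSpace ℝ n :=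
    ((LinearMap.ker fB).liftQ fA hker).comp e.symm.toLinearMap
  have hL0 : ∀ x, L0 ⟨fB x, LinearMap.mem_range_self _ x⟩ = fA x := by
    intro x
    have : e.symm ⟨fB x, LinearMap.mem_range_self _ x⟩ = (LinearMap.ker fB).mkQ x := by
      rw [LinearEquiv.symm_apply_eq]
      rfl
    simp [L0, this]
  let L1 : LinearMap.range fB →ₗᵢ[ℝ] EuclideanSpace ℝ n := ⟨L0, by
    rintro ⟨_, x, rfl⟩
    rw [hL0 x, hnorm]
    rfl⟩
  let L := L1.extend
  have hL : ∀ x, L (fB x) = fA x := by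
    intro x
    have := L1.extend_apply ⟨fB x, LinearMap.mem_range_self _ x⟩
    exact this.trans (hL0 x)
  let W : Matrix n n ℝ := Matrix.toEuclideanLin.symm L.toLinearMap
  have hW : ∀ x, L x = WithLp.toLp 2 (W *ᵥ x.ofLp) := by
    intro x
    have : Matrix.toEuclideanLin W x = L x := by simp [W]
    rw [← this, Matrix.toLpLin_apply]
  have hWW : Wᵀ * W = 1 := by
    ext i j
    have h1 := L.inner_map_map (WithLp.toLp 2 (Pi.single i 1)) (WithLp.toLp 2 (Pi.single j 1))
    rw [hW, hW, EuclideanSpace.inner_toLp_toLp, EuclideanSpace.inner_toLp_toLp] at h1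
    simp only [mulVec_single_one, star_trivial, dotProduct_single_one] at h1
    have h2 : (Wᵀ * W) i j = W.col j ⬝ᵥ W.col i := by
      rw [dotProduct_comm]
      rfl
    rw [h2, h1, Matrix.one_apply, Pi.single_apply]
  refine ⟨Wᵀ, ?_, ?_⟩
  · change Wᵀ * Wᵀᵀ = 1
    simpa using hWW
  · have : Aᵀ = W * Bᵀ := by
      apply Matrix.ext_of_mulVec_single
      intro j
      have := hL (WithLp.toLp 2 (Pi.single j 1))
      rw [hW] at this
      simp only [fA, fB, Matrix.toLpLin_apply] at this
      rw [← mulVec_mulVec]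
      exact (congrArg WithLp.ofLp this).symm
    rw [← transpose_transpose A, this, transpose_mul, transpose_transpose]

lemma exists_OO_of_gram' {A B : Matrix m n ℝ} (h : Aᵀ * A = Bᵀ * B) : ∃ U ∈ OO m, A = U * B := by
  obtain ⟨U, hU, h1⟩ := exists_OO_of_gram (A := Aᵀ) (B := Bᵀ) (by simpa using h)
  refine ⟨Uᵀ, OO.tr hU, ?_⟩
  rw [← transpose_transpose A, h1, transpose_mul, transpose_transpose]

end basics


/-- Functions that are continuous and analytic at zero. -/
def CA (f : ℝ → ℝ) : Prop := Continuous f ∧ AnalyticAt ℝ f 0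

lemma CA.const (c : ℝ) : CA (fun _ => c) := ⟨continuous_const, analyticAt_const⟩
lemma CA.id : CA (fun t => t) := ⟨continuous_id, analyticAt_id⟩
lemma CA.add {f g : ℝ → ℝ} (hf : CA f) (hg : CA g) : CA (fun t => f t + g t) :=
  ⟨hf.1.add hg.1, hf.2.fun_add hg.2⟩
lemma CA.mul {f g : ℝ → ℝ} (hf : CA f) (hg : CA g) : CA (fun t => f t * g t) :=
  ⟨hf.1.mul hg.1, hf.2.fun_mul hg.2⟩
lemma CA.neg {f : ℝ → ℝ} (hf : CA f) : CA (fun t => - f t) :=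
  ⟨hf.1.neg, hf.2.fun_neg⟩
lemma CA.sub {f g : ℝ → ℝ} (hf : CA f) (hg : CA g) : CA (fun t => f t - g t) :=
  ⟨hf.1.sub hg.1, hf.2.fun_sub hg.2⟩
lemma CA.div {f g : ℝ → ℝ} (hf : CA f) (hg : CA g) (h : ∀ t, g t ≠ 0) : CA (fun t => f t / g t) :=
  ⟨hf.1.div hg.1 h, hf.2.fun_div hg.2 (h 0)⟩
lemma CA.sqrt {f : ℝ → ℝ} (hf : CA f) (h : 0 < f 0) : CA (fun t => √(f t)) := by
  refine ⟨hf.1.sqrt, ?_⟩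
  have h1 : AnalyticAt ℝ (fun t => Real.exp (Real.log (f t) * (1/2))) 0 := by
    refine AnalyticAt.rexp' ?_
    exact (hf.2.log h).fun_mul analyticAt_const
  refine h1.congr ?_
  filter_upwards [hf.1.continuousAt.eventually (lt_mem_nhds h)] with t ht
  rw [Real.sqrt_eq_rpow, Real.rpow_def_of_pos ht]
lemma CA.dslope {f : ℝ → ℝ} (hf : CA f) (h : f 0 = 0) : ∃ b, CA b ∧ ∀ t, f t = t * b t := by
  refine ⟨_root_.dslope f 0, ⟨?_, ?_⟩, ?_⟩
  · rw [← continuousOn_univ, continuousOn_dslope Filter.univ_mem]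
    exact ⟨hf.1.continuousOn, hf.2.differentiableAt⟩
  · obtain ⟨p, hp⟩ := hf.2
    exact ⟨_, hp.has_fpower_series_dslope_fslope⟩
  · intro t
    have := sub_smul_dslope f 0 t
    simp [h] at this
    exact this.symm

lemma CA.root_pos {f : ℝ → ℝ} (hf : CA f) (x y : ℝ) (hxy : x * y < 0) (h0 : 0 < f 0) :
    ∃ s, CA s ∧ (∀ t, t * x + s t ^ 2 * (t * y) + 2 * s t * f t = 0) ∧ s 0 = 0 := by
  have hr : CA (fun t => √(f t * f t - t * t * (x * y))) := by
    refine CA.sqrt ((hf.mul hf).sub ((CA.id.mul CA.id).mul (CA.const _))) ?_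
    simp only [mul_zero, zero_mul, sub_zero]
    positivity
  have hsq : ∀ t, √(f t * f t - t * t * (x * y)) ^ 2 = f t * f t - t * t * (x * y) := by
    intro t
    refine Real.sq_sqrt ?_
    nlinarith [mul_self_nonneg (f t), mul_self_nonneg t]
  have hD : ∀ t, f t + √(f t * f t - t * t * (x * y)) ≠ 0 := by
    intro t ht
    have h1 := hsq t
    have h2 : √(f t * f t - t * t * (x * y)) = - f t := by linarith
    have h3 := Real.sqrt_nonneg (f t * f t - t * t * (x * y))
    have h4 : t * t * (x * y) = 0 := by rw [h2] at h1; linarith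
    have h5 : t = 0 := by
      rcases mul_eq_zero.1 h4 with h | h
      · exact mul_self_eq_zero.1 h
      · exact absurd h hxy.ne
    subst h5
    linarith
  refine ⟨fun t => (- t * x) / (f t + √(f t * f t - t * t * (x * y))),
    ((CA.id.neg).mul (CA.const x)).div (hf.add hr) hD, ?_, by simp⟩
  intro t
  have h1 := hsq t
  have h2 := hD t
  simp only
  set r := √(f t * f t - t * t * (x * y))
  field_simp
  have : t * x * ((f t + r) ^ 2 + t ^ 2 * x * y - 2 * f t * (f t + r)) = 0 := by
    have : (f t + r) ^ 2 + t ^ 2 * x * y - 2 * f t * (f t + r) = 0 := by nlinarith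
    rw [this]; ring
  linarith

lemma CA.root {f : ℝ → ℝ} (hf : CA f) (x y : ℝ) (hxy : x * y < 0) :
    ∃ s, CA s ∧ (∀ t, t * x + s t ^ 2 * (t * y) + 2 * s t * f t = 0) ∧ (f 0 = 0 ∨ s 0 = 0) := by
  rcases lt_trichotomy (f 0) 0 with h0 | h0 | h0
  · obtain ⟨s, hs, h1, h2⟩ := hf.neg.root_pos x y hxy (by linarith)
    refine ⟨fun t => - s t, hs.neg, fun t => ?_, Or.inr (by simp [h2])⟩
    have := h1 t
    linarith
  · obtain ⟨b, hb, hfb⟩ := hf.dslope h0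
    have hy : y ≠ 0 := by rintro rfl; simp at hxy
    have hpos : ∀ t, 0 < b t * b t - x * y := fun t => by nlinarith [mul_self_nonneg (b t)]
    refine ⟨fun t => (- b t + √(b t * b t - x * y)) / y, ?_, ?_, Or.inl h0⟩
    · refine CA.div (hb.neg.add (CA.sqrt ((hb.mul hb).sub (CA.const _)) (hpos 0))) (CA.const y)
        (fun _ => hy)
    · intro t
      rw [hfb t]
      have h1 := Real.sq_sqrt (hpos t).le
      simp only
      set r := √(b t * b t - x * y)
      field_simp
      have : t * (x * y + (r - b t) ^ 2 + 2 * (r - b t) * b t) = 0 := by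
        have : (x * y + (r - b t) ^ 2 + 2 * (r - b t) * b t) = 0 := by nlinarith
        rw [this]; ring
      linarith
  · obtain ⟨s, hs, h1, h2⟩ := hf.root_pos x y hxy h0
    exact ⟨s, hs, h1, Or.inr h2⟩

section giv
variable {n m : Type*} [Fintype n] [DecidableEq n] [Fintype m] [DecidableEq m]

/-- Givens rotation -/
def giv (i j : n) (c s : ℝ) : Matrix n n ℝ := Matrix.of fun a b =>
  if b = i then (if a = i then c else if a = j then s else 0)
  else if b = j then (if a = i then -s else if a = j then c else 0)
  else if a = b then 1 else 0

lemma mul_giv (F : Matrix m n ℝ) {i j : n} (hij : i ≠ j) (c s : ℝ) (a : m) (b : n) :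
    (F * giv i j c s) a b = if b = i then c * F a i + s * F a j
      else if b = j then - s * F a i + c * F a j else F a b := by
  rw [mul_apply]
  simp only [giv, of_apply]
  by_cases h1 : b = i
  · simp only [h1, if_true]
    rw [← Finset.sum_subset (Finset.subset_univ {i, j})]
    · rw [Finset.sum_pair hij]; simp [hij.symm]; ring
    · intro x _ hx; simp at hx; simp [hx]
  · by_cases h2 : b = j
    · simp only [h2, if_true, hij.symm, if_false]
      rw [← Finset.sum_subset (Finset.subset_univ {i, j})]
      · rw [Finset.sum_pair hij]; simp [hij.symm]; ring
      · intro x _ hx; simp at hx; simp [hx]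
    · simp [h1, h2]

lemma giv_tr {i j : n} (hij : i ≠ j) (c s : ℝ) : (giv i j c s)ᵀ = giv i j c (-s) := by
  ext a b
  simp only [transpose_apply, giv, of_apply]
  by_cases h1 : b = i <;> by_cases h2 : b = j <;> by_cases h3 : a = i <;> by_cases h4 : a = j <;>
    simp_all [eq_comm]

lemma giv_mem {i j : n} (hij : i ≠ j) {c s : ℝ} (h : c ^ 2 + s ^ 2 = 1) : giv i j c s ∈ OO n := by
  change _ * _ = _
  rw [giv_tr hij]
  ext a b
  rw [mul_giv _ hij, Matrix.one_apply]
  simp only [giv, of_apply]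
  have hji := hij.symm
  by_cases h1 : b = i <;> by_cases h2 : b = j <;> by_cases h3 : a = i <;> by_cases h4 : a = j <;>
    simp_all <;> first | linarith | (intro h5; subst h5; simp_all)

lemma giv_one {i j : n} (hij : i ≠ j) : giv i j (1 : ℝ) 0 = (1 : Matrix n n ℝ) := by
  have := mul_giv (1 : Matrix n n ℝ) hij 1 0
  ext a b
  rw [Matrix.one_mul] at this
  rw [this]
  by_cases h1 : b = i
  · subst h1; simp
  · by_cases h2 : b = j
    · subst h2; simp [hij.symm]
    · simp [h1, h2]

lemma continuous_giv (i j : n) : Continuous (fun p : ℝ × ℝ => giv i j p.1 p.2) := by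
  refine continuous_matrix fun a b => ?_
  simp only [giv, of_apply]
  split_ifs <;> fun_prop

lemma conj_giv (A : Matrix n n ℝ) {i j : n} (hij : i ≠ j) (c s : ℝ) (a b : n) :
    ((giv i j c s)ᵀ * A * giv i j c s) a b =
      if a = i then c * (A * giv i j c s) i b + s * (A * giv i j c s) j b
      else if a = j then - s * (A * giv i j c s) i b + c * (A * giv i j c s) j b
      else (A * giv i j c s) a b := by
  rw [Matrix.mul_assoc]
  have : ((giv i j c s)ᵀ * (A * giv i j c s)) = ((A * giv i j c s)ᵀ * giv i j c s)ᵀ := by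
    rw [transpose_mul, transpose_transpose]
  rw [this, transpose_apply, mul_giv _ hij]
  simp only [transpose_apply]

lemma conj_giv_diag (A : Matrix n n ℝ) (hA : Aᵀ = A) {i j : n} (hij : i ≠ j) (c s : ℝ) (a : n) :
    ((giv i j c s)ᵀ * A * giv i j c s) a a =
      if a = i then c ^ 2 * A i i + s ^ 2 * A j j + 2 * c * s * A i j
      else if a = j then s ^ 2 * A i i + c ^ 2 * A j j - 2 * c * s * A i j
      else A a a := by
  have hs : A j i = A i j := by
    conv_lhs => rw [← hA]
    rfl
  rw [conj_giv A hij]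
  simp only [mul_giv _ hij]
  by_cases h1 : a = i
  · simp [h1, hs]; ring
  · by_cases h2 : a = j
    · simp [h2, hij.symm, hs]; ring
    · simp [h1, h2]

/-- orthogonal `V` such that `Vᵀ A V` has unit diagonal. -/
def UD (A : Matrix n n ℝ) : Set (Matrix n n ℝ) := {V | V ∈ OO n ∧ ∀ i, (Vᵀ * A * V) i i = 1}

lemma lift_aux (k : ℕ) : ∀ (A : ℝ → Matrix n n ℝ) (δ : n → ℝ), (∀ t, (A t)ᵀ = A t) →
    (∀ a b, CA (fun t => A t a b)) → (∀ t i, A t i i = 1 + t * δ i) → (∑ i, δ i = 0) →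
    (Finset.univ.filter (fun i => δ i ≠ 0)).card ≤ k →
    ∃ U : ℝ → Matrix n n ℝ, Continuous U ∧ (∀ t, U t ∈ UD (A t)) ∧ JoinedIn (UD (A 0)) 1 (U 0) := by
  have base : ∀ (A : ℝ → Matrix n n ℝ) (δ : n → ℝ), (∀ t i, A t i i = 1 + t * δ i) →
      (∀ i, δ i = 0) → 
      ∃ U : ℝ → Matrix n n ℝ, Continuous U ∧ (∀ t, U t ∈ UD (A t)) ∧ JoinedIn (UD (A 0)) 1 (U 0) := by
    intro A δ hd h0
    have : ∀ t, (1 : Matrix n n ℝ) ∈ UD (A t) := fun t => ⟨OO.one, fun i => by simp [hd, h0]⟩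
    exact ⟨fun _ => 1, continuous_const, this, JoinedIn.refl (this 0)⟩
  induction k with
  | zero =>
    intro A δ _ _ hd _ hc
    refine base A δ hd ?_
    intro i
    by_contra h
    have : i ∈ Finset.univ.filter (fun i => δ i ≠ 0) := by simpa using h
    rw [Finset.card_eq_zero.1 (Nat.le_zero.1 hc)] at this
    simp at this
  | succ k ih =>
    intro A δ hsym hCA hd hsum hc
    by_cases hall : ∀ i, δ i = 0
    · exact base A δ hd hall
    have hneg : ∃ i, δ i < 0 := by
      by_contra! hcon
      exact hall fun l =>
        (Finset.sum_eq_zero_iff_of_nonneg (fun i _ => hcon i)).1 hsum l (Finset.mem_univ l)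
    have hpos : ∃ j, 0 < δ j := by
      by_contra! hcon
      exact hall fun l =>
        (Finset.sum_eq_zero_iff_of_nonpos (fun i _ => hcon i)).1 hsum l (Finset.mem_univ l)
    obtain ⟨i, hi⟩ := hneg
    obtain ⟨j, hj⟩ := hpos
    have hij : i ≠ j := by rintro rfl; linarith
    obtain ⟨s, hs, hroot, hor⟩ := (hCA i j).root (δ i) (δ j) (mul_neg_of_neg_of_pos hi hj)
    have hq : CA (fun t => √(1 + s t ^ 2)) := by
      have : CA (fun t => 1 + s t * s t) := (CA.const 1).add (hs.mul hs)
      have h2 := this.sqrt (by nlinarith [mul_self_nonneg (s 0)])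
      simpa [pow_two] using h2
    have hqpos : ∀ t, 0 < √(1 + s t ^ 2) := fun t => Real.sqrt_pos.2 (by positivity)
    have hqsq : ∀ t, √(1 + s t ^ 2) ^ 2 = 1 + s t ^ 2 := fun t => Real.sq_sqrt (by positivity)
    obtain ⟨c, hc_def⟩ : ∃ c : ℝ → ℝ, c = fun t => 1 / √(1 + s t ^ 2) := ⟨_, rfl⟩
    obtain ⟨σ, hσ_def⟩ : ∃ σ : ℝ → ℝ, σ = fun t => s t / √(1 + s t ^ 2) := ⟨_, rfl⟩
    have hcCA : CA c := by rw [hc_def]; exact (CA.const 1).div hq (fun t => (hqpos t).ne')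
    have hσCA : CA σ := by rw [hσ_def]; exact hs.div hq (fun t => (hqpos t).ne')
    have hσ : ∀ t, σ t = s t * c t := by intro t; rw [hc_def, hσ_def]; ring
    have hc2 : ∀ t, c t ^ 2 * (1 + s t ^ 2) = 1 := by
      intro t
      rw [hc_def]
      simp only
      rw [div_pow, hqsq]
      have : 1 + s t ^ 2 ≠ 0 := by positivity
      field_simp
    have hcs : ∀ t, c t ^ 2 + σ t ^ 2 = 1 := by
      intro t; rw [hσ]; linarith [hc2 t]
    let G : ℝ → Matrix n n ℝ := fun t => giv i j (c t) (σ t)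
    have hG : ∀ t, G t ∈ OO n := fun t => giv_mem hij (hcs t)
    have hGc : Continuous G := (continuous_giv i j).comp (hcCA.1.prodMk hσCA.1)
    let δ' : n → ℝ := fun a => δ a - (if a = i then δ i else 0) + (if a = j then δ i else 0)
    have hAi : ∀ t, c t ^ 2 * A t i i + σ t ^ 2 * A t j j + 2 * c t * σ t * A t i j = 1 := by
      intro t
      rw [hd, hd, hσ]
      have h1 := hroot t
      have h2 := hc2 t
      have : c t ^ 2 * (t * δ i + s t ^ 2 * (t * δ j) + 2 * s t * A t i j) = 0 := by
        rw [h1, mul_zero]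
      linarith
    obtain ⟨U, hUc, hU, hUj⟩ := ih (fun t => (G t)ᵀ * A t * G t) δ'
      (by intro t; simp [transpose_mul, hsym, Matrix.mul_assoc])
      (by
        intro a b
        have hAG : ∀ a, CA (fun t => (A t * G t) a b) := by
          intro a
          simp only [G, mul_giv _ hij]
          split_ifs
          · exact (hcCA.mul (hCA _ _)).add (hσCA.mul (hCA _ _))
          · exact (hσCA.neg.mul (hCA _ _)).add (hcCA.mul (hCA _ _))
          · exact hCA _ _
        have : (fun t => ((G t)ᵀ * A t * G t) a b) = fun t =>
            if a = i then c t * (A t * G t) i b + σ t * (A t * G t) j b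
            else if a = j then - σ t * (A t * G t) i b + c t * (A t * G t) j b
            else (A t * G t) a b := by
          funext t
          exact conj_giv (A t) hij (c t) (σ t) a b
        rw [this]
        split_ifs
        · exact (hcCA.mul (hAG _)).add (hσCA.mul (hAG _))
        · exact (hσCA.neg.mul (hAG _)).add (hcCA.mul (hAG _))
        · exact hAG _)
      (by
        intro t a
        simp only [G]
        rw [conj_giv_diag _ (hsym t) hij]
        simp only [δ']
        by_cases h1 : a = i
        · subst h1
          simp [hij, hAi t]
        · by_cases h2 : a = j
          · subst h2
            simp only [h1, if_false, if_true]
            have e1 := hAi t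
            have e2 := hcs t
            have e3 : σ t ^ 2 * A t i i + c t ^ 2 * A t a a - 2 * c t * σ t * A t i a
              = (c t ^ 2 + σ t ^ 2) * (A t i i + A t a a) - 1 := by rw [← e1]; ring
            rw [e3, e2, hd, hd]
            ring
          · simp [h1, h2, hd])
      (by simp [δ', Finset.sum_add_distrib, Finset.sum_sub_distrib, hsum])
      (by
        have hsub : (Finset.univ.filter (fun a => δ' a ≠ 0)) ⊆
            (Finset.univ.filter (fun a => δ a ≠ 0)).erase i := by
          intro a ha
          simp only [Finset.mem_filter, Finset.mem_univ, true_and, δ'] at ha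
          simp only [Finset.mem_erase, Finset.mem_filter, Finset.mem_univ, true_and]
          refine ⟨?_, ?_⟩
          · rintro rfl; simp [hij] at ha
          · intro h0
            by_cases h2 : a = j
            · rw [h2] at h0; linarith
            · apply ha
              have h3 : a ≠ i := by rintro rfl; linarith
              simp [h0, h2, h3]
        have h1 := Finset.card_le_card hsub
        rw [Finset.card_erase_of_mem (by simp [hi.ne])] at h1
        omega)
    have step : ∀ t V, V ∈ UD ((G t)ᵀ * A t * G t) → G t * V ∈ UD (A t) := by
      intro t V hV
      refine ⟨OO.mul (hG t) hV.1, fun l => ?_⟩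
      rw [← hV.2 l, transpose_mul]
      simp only [Matrix.mul_assoc]
    refine ⟨fun t => G t * U t, hGc.mul hUc, fun t => step t _ (hU t), ?_⟩
    have j1 : JoinedIn (UD (A 0)) (G 0 * 1) (G 0 * U 0) :=
      hUj.image_sub (f := fun V => G 0 * V) (by fun_prop) (fun V hV => step 0 V hV)
    rw [Matrix.mul_one] at j1
    refine JoinedIn.trans ?_ j1
    rcases hor with h0 | h0
    · set θ := Real.arctan (s 0)
      have hcos : Real.cos θ = c 0 := by rw [Real.cos_arctan, hc_def]
      have hsin : Real.sin θ = σ 0 := by rw [Real.sin_arctan, hσ_def]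
      refine JoinedIn.ofLine (f := fun τ => giv i j (Real.cos (τ * θ)) (Real.sin (τ * θ))) ?_ ?_ ?_ ?_
      · refine Continuous.continuousOn ?_
        exact (continuous_giv i j).comp (by fun_prop : Continuous fun τ : ℝ => (Real.cos (τ * θ), Real.sin (τ * θ)))
      · simp [giv_one hij]
      · simp [hcos, hsin, G]
      · rintro _ ⟨τ, _, rfl⟩
        refine ⟨giv_mem hij (Real.cos_sq_add_sin_sq _), fun l => ?_⟩
        rw [conj_giv_diag _ (hsym 0) hij, h0, hd, hd, hd]
        have := Real.cos_sq_add_sin_sq (τ * θ)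
        split_ifs <;> simp <;> linarith
    · have : G 0 = 1 := by
        have e1 : σ 0 = 0 := by rw [hσ, h0, zero_mul]
        have e2 : c 0 = 1 := by rw [hc_def]; simp [h0]
        simp only [G, e1, e2, giv_one hij]
      rw [this]
      refine JoinedIn.refl ⟨OO.one, fun l => by simp [hd]⟩

/-- Path lifting for matrices with unit diagonal along segments. -/
lemma lift_segment (H₀ H₁ : Matrix n n ℝ) (h0 : H₀ᵀ = H₀) (h1 : H₁ᵀ = H₁) (hd : ∀ i, H₀ i i = 1)
    (htr : H₁.trace = Fintype.card n) :
    ∃ U : ℝ → Matrix n n ℝ, Continuous U ∧ (∀ t, U t ∈ UD ((1 - t) • H₀ + t • H₁)) ∧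
      JoinedIn (UD H₀) 1 (U 0) := by
  obtain ⟨U, hU, hU1, hU2⟩ := lift_aux _ (fun t => (1 - t) • H₀ + t • H₁) (fun i => H₁ i i - 1)
    (by intro t; simp [h0, h1])
    (by
      intro a b
      simp only [Matrix.add_apply, Matrix.smul_apply, smul_eq_mul]
      exact (((CA.const 1).sub CA.id).mul (CA.const _)).add (CA.id.mul (CA.const _)))
    (by intro t i; simp [hd]; ring)
    (by
      rw [Finset.sum_sub_distrib]
      simp only [trace, diag] at htr
      simp [htr]) le_rfl
  exact ⟨U, hU, hU1, by simpa using hU2⟩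

end giv



/-- tight frames with unit norm columns and frame constant `a`. -/
def TF (ι κ : Type*) [Fintype ι] [DecidableEq ι] [Fintype κ] (a : ℝ) : Set (Matrix ι κ ℝ) :=
  {F | F * Fᵀ = a • 1 ∧ ∀ n, (Fᵀ * F) n n = 1}

section tf
variable {ι κ κ' : Type*} [Fintype ι] [DecidableEq ι] [Fintype κ] [DecidableEq κ]
  [Fintype κ'] [DecidableEq κ'] {a : ℝ}

lemma mem_fromCols {X : Matrix ι κ ℝ} {Y : Matrix ι κ' ℝ} :
    fromCols X Y ∈ TF ι (κ ⊕ κ') a ↔ X * Xᵀ + Y * Yᵀ = a • 1 ∧ (∀ n, (Xᵀ * X) n n = 1) ∧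
      ∀ n, (Yᵀ * Y) n n = 1 := by
  change (_ ∧ _) ↔ _
  rw [transpose_fromCols, fromCols_mul_fromRows, fromRows_mul_fromCols]
  simp [Sum.forall]

lemma continuous_fromCols {T : Type*} [TopologicalSpace T] {X : T → Matrix ι κ ℝ} {Y : T → Matrix ι κ' ℝ}
    (hX : Continuous X) (hY : Continuous Y) : Continuous (fun t => fromCols (X t) (Y t)) := by
  refine continuous_matrix ?_
  rintro i (j | j)
  · simpa using hX.matrix_elem i j
  · simpa using hY.matrix_elem i j

lemma OO.diag {U : Matrix ι ι ℝ} (h : U ∈ OO ι) (n) : (Uᵀ * U) n n = 1 := by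
  rw [OO.tr_mul h]; simp

lemma TF_left {R : Matrix ι ι ℝ} (hR : R ∈ OO ι) {F : Matrix ι κ ℝ} (hF : F ∈ TF ι κ a) :
    R * F ∈ TF ι κ a := by
  refine ⟨?_, fun n => ?_⟩
  · rw [transpose_mul, Matrix.mul_assoc, ← Matrix.mul_assoc F, hF.1]
    simp [OO.mul_tr hR]
  · rw [transpose_mul, Matrix.mul_assoc, ← Matrix.mul_assoc Rᵀ, OO.tr_mul hR, Matrix.one_mul, hF.2]

/-- real spectral theorem -/
lemma spec {S : Matrix ι ι ℝ} (hS : Sᵀ = S) : ∃ (O : Matrix ι ι ℝ) (l : ι → ℝ), O ∈ OO ι ∧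
    S = O * diagonal l * Oᵀ := by
  have hH : S.IsHermitian := by
    rw [Matrix.IsHermitian, conjTranspose_eq_transpose_of_trivial, hS]
  refine ⟨hH.eigenvectorUnitary, hH.eigenvalues, ?_, ?_⟩
  · have := (Matrix.mem_unitaryGroup_iff).1 hH.eigenvectorUnitary.2
    rw [star_eq_conjTranspose, conjTranspose_eq_transpose_of_trivial] at this
    exact this
  · have := hH.spectral_theorem
    rw [Unitary.conjStarAlgAut_apply, star_eq_conjTranspose, conjTranspose_eq_transpose_of_trivial] at this
    exact this

lemma exists_coisometry (h : Fintype.card ι ≤ Fintype.card κ) : ∃ J : Matrix ι κ ℝ, J * Jᵀ = 1 := by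
  obtain ⟨e⟩ := Function.Embedding.nonempty_of_card_le h
  refine ⟨Matrix.of fun i k => if e i = k then 1 else 0, ?_⟩
  ext i j
  simp [Matrix.mul_apply, Matrix.one_apply, e.injective.eq_iff]

lemma TF_nonempty (h : Fintype.card ι ≤ Fintype.card κ) (ha : 0 ≤ a) 
    (hc : a * Fintype.card ι = Fintype.card κ) : (TF ι κ a).Nonempty := by
  obtain ⟨J, hJ⟩ := exists_coisometry h
  obtain ⟨U, -, hU, -⟩ := lift_segment (1 : Matrix κ κ ℝ) (a • (Jᵀ * J)) (by simp) (by simp) (by simp)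
    (by rw [trace_smul, trace_mul_comm, hJ]; simp [hc])
  have hU1 := hU 1
  refine ⟨√a • (J * U 1), ?_, fun n => ?_⟩
  · rw [transpose_smul, Matrix.smul_mul, Matrix.mul_smul, smul_smul, Real.mul_self_sqrt ha, transpose_mul,
      Matrix.mul_assoc, ← Matrix.mul_assoc (U 1), OO.mul_tr hU1.1, Matrix.one_mul, hJ]
  · have := hU1.2 n
    rw [transpose_smul, Matrix.smul_mul, Matrix.mul_smul, smul_smul, Real.mul_self_sqrt ha, transpose_mul]
    simp only [sub_self, zero_smul, one_smul, zero_add, Matrix.mul_smul, Matrix.smul_mul] at this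
    refine Eq.trans ?_ this
    simp only [Matrix.mul_assoc]

lemma gram_diag_nonneg (X : Matrix ι κ ℝ) (i : ι) : 0 ≤ (X * Xᵀ) i i := by
  rw [Matrix.mul_apply]
  exact Finset.sum_nonneg fun j _ => by rw [transpose_apply]; exact mul_self_nonneg _

lemma diag_sq {O : Matrix ι ι ℝ} (hO : O ∈ OO ι) (l : ι → ℝ) (hl : ∀ i, 0 ≤ l i) :
    (O * diagonal (fun i => √(l i)) * Oᵀ) * (O * diagonal (fun i => √(l i)) * Oᵀ) = O * diagonal l * Oᵀ := by
  have : (O * diagonal (fun i => √(l i)) * Oᵀ) * (O * diagonal (fun i => √(l i)) * Oᵀ)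
    = O * (diagonal (fun i => √(l i)) * (Oᵀ * O) * diagonal (fun i => √(l i))) * Oᵀ := by
    simp only [Matrix.mul_assoc]
  rw [this, OO.tr_mul hO, Matrix.mul_one, diagonal_mul_diagonal]
  simp only [Real.mul_self_sqrt (hl _)]

lemma OO_conj {O : Matrix ι ι ℝ} (hO : O ∈ OO ι) {S D : Matrix ι ι ℝ} (h : S = O * D * Oᵀ) : 
    Oᵀ * S * O = D := by
  subst h
  have : Oᵀ * (O * D * Oᵀ) * O = (Oᵀ * O) * D * (Oᵀ * O) := by simp only [Matrix.mul_assoc]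
  rw [this, OO.tr_mul hO]; simp

lemma hub (h : Fintype.card ι ≤ Fintype.card κ) (hc : (a - 1) * Fintype.card ι = Fintype.card κ)
    (ha : 0 ≤ a - 1) 
    {F : Matrix ι (ι ⊕ κ) ℝ} (hF : F ∈ TF ι (ι ⊕ κ) a) : ∃ Q ∈ OO ι, ∃ G ∈ TF ι κ (a - 1),
    JoinedIn (TF ι (ι ⊕ κ) a) F (fromCols Q G) := by
  obtain ⟨F₁, F₂, rfl⟩ : ∃ F₁ F₂, F = fromCols F₁ F₂ := ⟨F.toCols₁, F.toCols₂, by simp⟩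
  obtain ⟨hFF, hF1, hF2⟩ := mem_fromCols.1 hF
  obtain ⟨J, hJ⟩ := exists_coisometry h
  obtain ⟨O, l, hO, hS⟩ := spec (S := F₁ * F₁ᵀ) (by simp)
  have hS2 : F₂ * F₂ᵀ = O * diagonal (fun i => a - l i) * Oᵀ := by
    have e : F₂ * F₂ᵀ = a • 1 - F₁ * F₁ᵀ := by rw [← hFF]; simp
    have e2 : (diagonal (fun i => a - l i) : Matrix ι ι ℝ) = a • 1 - diagonal l := by
      ext i j; by_cases hij : i = j <;> simp [hij, Matrix.one_apply]
    rw [e, hS, e2, Matrix.mul_sub, Matrix.sub_mul]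
    simp [OO.mul_tr hO]
  have hl0 : ∀ i, 0 ≤ l i := by
    intro i
    have h1 := OO_conj hO hS
    have h2 := gram_diag_nonneg (Oᵀ * F₁) i
    rw [transpose_mul, transpose_transpose] at h2
    have : Oᵀ * F₁ * (F₁ᵀ * O) = diagonal l := by rw [← h1]; simp only [Matrix.mul_assoc]
    rw [this] at h2
    simpa using h2
  have hla : ∀ i, 0 ≤ a - l i := by
    intro i
    have h1 := OO_conj hO hS2
    have h2 := gram_diag_nonneg (Oᵀ * F₂) i
    rw [transpose_mul, transpose_transpose] at h2
    have : Oᵀ * F₂ * (F₂ᵀ * O) = diagonal (fun i => a - l i) := by rw [← h1]; simp only [Matrix.mul_assoc]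
    rw [this] at h2
    simpa using h2
  let p : ℝ → ι → ℝ := fun t i => (1 - t) * l i + t
  let q : ℝ → ι → ℝ := fun t i => (1 - t) * (a - l i) + t * (a - 1)
  have hp : ∀ t ∈ Set.Icc (0:ℝ) 1, ∀ i, 0 ≤ p t i := fun t ht i =>
    add_nonneg (mul_nonneg (by linarith [ht.2]) (hl0 i)) ht.1
  have hq : ∀ t ∈ Set.Icc (0:ℝ) 1, ∀ i, 0 ≤ q t i := fun t ht i =>
    add_nonneg (mul_nonneg (by linarith [ht.2]) (hla i)) (mul_nonneg ht.1 ha)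
  let A : ℝ → Matrix ι ι ℝ := fun t => O * diagonal (fun i => √(p t i)) * Oᵀ
  let B : ℝ → Matrix ι ι ℝ := fun t => O * diagonal (fun i => √(q t i)) * Oᵀ
  have hAt : ∀ t, (A t)ᵀ = A t := by intro t; simp [A, Matrix.mul_assoc]
  have hBt : ∀ t, (B t)ᵀ = B t := by intro t; simp [B, Matrix.mul_assoc]
  have hAc : Continuous A := by
    have : Continuous fun t => (fun i => √(p t i)) := by fun_prop
    exact (continuous_const.matrix_mul this.matrix_diagonal).matrix_mul continuous_const
  have hBc : Continuous B := by
    have : Continuous fun t => (fun i => √(q t i)) := by fun_prop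
    exact (continuous_const.matrix_mul this.matrix_diagonal).matrix_mul continuous_const
  have hAA : ∀ t ∈ Set.Icc (0:ℝ) 1, A t * A t = (1 - t) • (F₁ * F₁ᵀ) + t • 1 := by
    intro t ht
    rw [diag_sq hO _ (hp t ht), hS]
    have : (diagonal (p t) : Matrix ι ι ℝ) = (1 - t) • diagonal l + t • 1 := by
      ext i j; by_cases hij : i = j <;> simp [hij, Matrix.one_apply, p]
    rw [this, Matrix.mul_add, Matrix.add_mul]
    simp [OO.mul_tr hO]
  have hBB : ∀ t ∈ Set.Icc (0:ℝ) 1, B t * B t = (1 - t) • (F₂ * F₂ᵀ) + (t * (a - 1)) • 1 := by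
    intro t ht
    rw [diag_sq hO _ (hq t ht), hS2]
    have : (diagonal (q t) : Matrix ι ι ℝ) = (1 - t) • diagonal (fun i => a - l i) + (t * (a - 1)) • 1 := by
      ext i j; by_cases hij : i = j <;> simp [hij, Matrix.one_apply, q]
    rw [this, Matrix.mul_add, Matrix.add_mul]
    simp [OO.mul_tr hO]
  have i0 : (0:ℝ) ∈ Set.Icc (0:ℝ) 1 := by simp
  have i1 : (1:ℝ) ∈ Set.Icc (0:ℝ) 1 := by simp
  obtain ⟨V₁, hV₁, hFV₁⟩ := exists_OO_of_gram (A := F₁) (B := A 0) (by rw [hAt, hAA 0 i0]; simp)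
  obtain ⟨V₂, hV₂, hFV₂⟩ := exists_OO_of_gram (A := F₂) (B := B 0 * J) (by
    rw [transpose_mul, Matrix.mul_assoc, ← Matrix.mul_assoc J, hJ, Matrix.one_mul, hBt, hBB 0 i0]; simp)
  have hJV : (J * V₂) * (J * V₂)ᵀ = 1 := by
    rw [transpose_mul, Matrix.mul_assoc, ← Matrix.mul_assoc V₂, OO.mul_tr hV₂, Matrix.one_mul, hJ]
  set K := J * V₂ with hK
  rw [Matrix.mul_assoc, ← hK] at hFV₂
  obtain ⟨U, hUc, hU, hUj⟩ := lift_segment (F₂ᵀ * F₂) ((a - 1) • (Kᵀ * K)) (by simp) (by simp) hF2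
    (by rw [trace_smul, trace_mul_comm, hJV]; simp [hc])
  have hKBK : ∀ t ∈ Set.Icc (0:ℝ) 1, Kᵀ * (B t * B t) * K =
      (1 - t) • (F₂ᵀ * F₂) + t • ((a - 1) • (Kᵀ * K)) := by
    intro t ht
    have e0 : F₂ᵀ * F₂ = Kᵀ * (B 0 * B 0) * K := by
      conv_lhs => rw [hFV₂, transpose_mul, hBt]
      simp only [Matrix.mul_assoc]
    rw [e0, hBB 0 i0, hBB t ht]
    simp [Matrix.mul_add, Matrix.add_mul, smul_smul]
  refine ⟨V₁, hV₁, B 1 * K * U 1, ?_, ?_⟩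
  · refine ⟨?_, fun n => ?_⟩
    · have : B 1 * K * U 1 * (B 1 * K * U 1)ᵀ = B 1 * (K * (U 1 * (U 1)ᵀ) * Kᵀ) * B 1 := by
        simp only [transpose_mul, hBt, Matrix.mul_assoc]
      rw [this, OO.mul_tr (hU 1).1, Matrix.mul_one, hJV, Matrix.mul_one, hBB 1 i1]
      simp
    · have := (hU 1).2 n
      rw [← hKBK 1 i1] at this
      refine Eq.trans ?_ this
      simp only [transpose_mul, hBt, Matrix.mul_assoc]
  · have j1 : JoinedIn (TF ι (ι ⊕ κ) a) (fromCols F₁ F₂) (fromCols F₁ (F₂ * U 0)) := by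
      have := hUj.image_sub (f := fun V => fromCols F₁ (F₂ * V)) (B := TF ι (ι ⊕ κ) a)
        (continuous_fromCols continuous_const (by fun_prop)).continuousOn (by
          intro V hV
          refine mem_fromCols.2 ⟨?_, hF1, fun n => ?_⟩
          · rw [← hFF, transpose_mul, Matrix.mul_assoc, ← Matrix.mul_assoc V, OO.mul_tr hV.1, Matrix.one_mul]
          · rw [← hV.2 n, transpose_mul]
            simp only [Matrix.mul_assoc])
      simpa using this
    refine j1.trans ?_
    refine JoinedIn.ofLine (f := fun t => fromCols (A t * V₁) (B t * K * U t)) ?_ ?_ ?_ ?_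
    · exact (continuous_fromCols (hAc.matrix_mul continuous_const) 
        ((hBc.matrix_mul continuous_const).matrix_mul hUc)).continuousOn
    · simp only [← hFV₁, ← hFV₂]
    · have : A 1 = 1 := by simp [A, p, OO.mul_tr hO]
      simp [this]
    · rintro _ ⟨t, ht, rfl⟩
      refine mem_fromCols.2 ⟨?_, fun n => ?_, fun n => ?_⟩
      · have e1 : A t * V₁ * (A t * V₁)ᵀ = A t * (V₁ * V₁ᵀ) * A t := by
          simp only [transpose_mul, hAt, Matrix.mul_assoc]
        have e2 : B t * K * U t * (B t * K * U t)ᵀ = B t * (K * (U t * (U t)ᵀ) * Kᵀ) * B t := by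
          simp only [transpose_mul, hBt, Matrix.mul_assoc]
        rw [e1, e2, OO.mul_tr (hU t).1, Matrix.mul_one, hJV, Matrix.mul_one, OO.mul_tr hV₁, Matrix.mul_one,
          hBB t ht, hAA t ht]
        have : F₂ * F₂ᵀ = a • 1 - F₁ * F₁ᵀ := by rw [← hFF]; simp
        rw [this]
        module
      · have e1 : (A t * V₁)ᵀ * (A t * V₁) = V₁ᵀ * (A t * A t) * V₁ := by
          simp only [transpose_mul, hAt, Matrix.mul_assoc]
        have e2 : V₁ᵀ * (F₁ * F₁ᵀ) * V₁ = F₁ᵀ * F₁ := by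
          have e3 : F₁ᵀ * F₁ = V₁ᵀ * (A 0 * A 0) * V₁ := by
            conv_lhs => rw [hFV₁]
            simp only [transpose_mul, hAt, Matrix.mul_assoc]
          rw [e3, hAA 0 i0]; simp
        rw [e1, hAA t ht, Matrix.mul_add, Matrix.add_mul, Matrix.mul_smul, Matrix.smul_mul, e2]
        simp [OO.tr_mul hV₁, hF1 n]
      · have := (hU t).2 n
        rw [← hKBK t ht] at this
        rw [← this]
        simp only [transpose_mul, hBt, Matrix.mul_assoc]

end tf



section moves
variable {ι κ : Type*} [Fintype ι] [DecidableEq ι] [Fintype κ] [DecidableEq κ] {a : ℝ}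

lemma pm_ne {x y : ℝ} (hx : x = 1 ∨ x = -1) (hy : y = 1 ∨ y = -1) (h : x ≠ y) : y = - x := by
  rcases hx with rfl | rfl <;> rcases hy with rfl | rfl <;> simp at *

lemma TF_mul_UD {F : Matrix ι κ ℝ} (hF : F ∈ TF ι κ a) {V : Matrix κ κ ℝ} (hV : V ∈ UD (Fᵀ * F)) :
    F * V ∈ TF ι κ a := by
  refine ⟨?_, fun n => ?_⟩
  · rw [← hF.1, transpose_mul, Matrix.mul_assoc, ← Matrix.mul_assoc V, OO.mul_tr hV.1, Matrix.one_mul]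
  · rw [← hV.2 n, transpose_mul]
    simp only [Matrix.mul_assoc]

lemma rot_move {F : Matrix ι κ ℝ} (hF : F ∈ TF ι κ a) {i j : κ} (hij : i ≠ j) (ho : (Fᵀ * F) i j = 0)
    (θ : ℝ) : JoinedIn (TF ι κ a) F (F * giv i j (Real.cos θ) (Real.sin θ)) := by
  refine JoinedIn.ofLine (f := fun τ => F * giv i j (Real.cos (τ * θ)) (Real.sin (τ * θ))) ?_ ?_ ?_ ?_
  · refine Continuous.continuousOn (continuous_const.matrix_mul ?_)
    exact (continuous_giv i j).comp (by fun_prop : Continuous fun τ : ℝ => (Real.cos (τ * θ), Real.sin (τ * θ)))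
  · simp [giv_one hij]
  · simp
  · rintro _ ⟨τ, _, rfl⟩
    refine TF_mul_UD hF ⟨giv_mem hij (Real.cos_sq_add_sin_sq _), fun l => ?_⟩
    rw [conj_giv_diag _ (by simp) hij, ho, hF.2, hF.2, hF.2]
    have := Real.cos_sq_add_sin_sq (τ * θ)
    split_ifs <;> simp <;> linarith

/-- swap columns `i`, `j` with one sign. -/
def sw (F : Matrix ι κ ℝ) (i j : κ) : Matrix ι κ ℝ :=
  Matrix.of fun a b => if b = i then F a j else if b = j then - F a i else F a b

lemma sw_move {F : Matrix ι κ ℝ} (hF : F ∈ TF ι κ a) {i j : κ} (hij : i ≠ j) (ho : (Fᵀ * F) i j = 0) :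
    JoinedIn (TF ι κ a) F (sw F i j) := by
  have := rot_move hF hij ho (Real.pi / 2)
  have e : F * giv i j (Real.cos (Real.pi / 2)) (Real.sin (Real.pi / 2)) = sw F i j := by
    ext x y
    rw [mul_giv _ hij]
    simp [sw]
  rwa [e] at this

/-- negate columns -/
def sg (F : Matrix ι κ ℝ) (s : κ → ℝ) : Matrix ι κ ℝ := Matrix.of fun a b => s b * F a b

lemma flip_move {F : Matrix ι κ ℝ} (hF : F ∈ TF ι κ a) {i j : κ} (hij : i ≠ j) (ho : (Fᵀ * F) i j = 0) :
    JoinedIn (TF ι κ a) F (sg F (fun b => if b = i ∨ b = j then -1 else 1)) := by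
  have := rot_move hF hij ho Real.pi
  have e : F * giv i j (Real.cos Real.pi) (Real.sin Real.pi) =
      sg F (fun b => if b = i ∨ b = j then -1 else 1) := by
    ext x y
    rw [mul_giv _ hij]
    by_cases h1 : y = i
    · simp [sg, h1]
    · by_cases h2 : y = j
      · subst h2; simp [sg, h1]
      · simp [sg, h1, h2]
  rwa [e] at this

lemma triple_move {F : Matrix ι κ ℝ} (hF : F ∈ TF ι κ a) {i j k : κ} (hij : i ≠ j) (hjk : j ≠ k)
    (hik : i ≠ k) (h1 : (Fᵀ * F) i j = 0) (h2 : (Fᵀ * F) j k = 0) :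
    JoinedIn (TF ι κ a) F (Matrix.of fun x b => if b = i then F x k else if b = j then - F x j else
      if b = k then F x i else F x b) := by
  have j1 := sw_move hF hij h1
  have j2 := sw_move j1.target_mem hik (by
    rw [Matrix.mul_apply] at h2 ⊢
    rw [← h2]
    refine Finset.sum_congr rfl fun x _ => ?_
    simp [sw, hik.symm, hjk.symm, hij.symm])
  have j3 := sw_move j2.target_mem hjk (by
    rw [Matrix.mul_apply] at h1 ⊢
    rw [← h1]
    refine Finset.sum_congr rfl fun x _ => ?_
    simp [sw, hik.symm, hjk.symm, hij.symm, hjk])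
  convert (j1.trans j2).trans j3 using 1
  ext x b
  simp only [sw, Matrix.of_apply]
  by_cases e1 : b = i
  · subst e1; simp [hij, hik, hjk.symm, hij.symm, hik.symm]
  by_cases e2 : b = j
  · subst e2; simp [hij, hik, hjk.symm, hij.symm, hik.symm]
  by_cases e3 : b = k
  · subst e3; simp [hij, hik, hjk.symm, hij.symm, hik.symm, hjk]
  simp [e1, e2, e3]

lemma hub_mem {Q : Matrix ι ι ℝ} (hQ : Q ∈ OO ι) {G : Matrix ι κ ℝ} (hG : G ∈ TF ι κ (a - 1)) :
    fromCols Q G ∈ TF ι (ι ⊕ κ) a := by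
  refine mem_fromCols.2 ⟨?_, OO.diag hQ, hG.2⟩
  rw [OO.mul_tr hQ, hG.1]; module

lemma hub_left [Nontrivial ι] {Q Q' : Matrix ι ι ℝ} (hQ : Q ∈ OO ι) (hQ' : Q' ∈ OO ι) (hd : Q.det = Q'.det)
    {G : Matrix ι κ ℝ} (hG : G ∈ TF ι κ (a - 1)) :
    JoinedIn (TF ι (ι ⊕ κ) a) (fromCols Q G) (fromCols Q' G) :=
  (OO_joined hQ hQ' hd).image_sub (f := fun X => fromCols X G)
    (continuous_fromCols continuous_id continuous_const).continuousOn (fun X hX => hub_mem hX hG)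

lemma hub_right {Q : Matrix ι ι ℝ} (hQ : Q ∈ OO ι) 
    {G G' : Matrix ι κ ℝ} (hG : JoinedIn (TF ι κ (a - 1)) G G') :
    JoinedIn (TF ι (ι ⊕ κ) a) (fromCols Q G) (fromCols Q G') :=
  hG.image_sub (f := fun X => fromCols Q X)
    (continuous_fromCols continuous_const continuous_id).continuousOn (fun X hX => hub_mem hQ hX)

lemma TF_joined_left [Nontrivial ι] {R R' : Matrix ι ι ℝ} (hR : R ∈ OO ι) (hR' : R' ∈ OO ι)
    (hd : R.det = R'.det) {G : Matrix ι κ ℝ} (hG : G ∈ TF ι κ a) :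
    JoinedIn (TF ι κ a) (R * G) (R' * G) :=
  (OO_joined hR hR' hd).image_sub (f := fun X => X * G) (by fun_prop) (fun X hX => TF_left hX hG)

lemma exists_unit_orth (k : ℕ) (h : k < Fintype.card ι) (g : Fin k → ι → ℝ) :
    ∃ u : ι → ℝ, u ⬝ᵥ u = 1 ∧ ∀ i, g i ⬝ᵥ u = 0 := by
  have hk := LinearMap.ker_ne_bot_of_finrank_lt (K := ℝ) (f := Matrix.mulVecLin (Matrix.of g)) (by simpa using h)
  obtain ⟨w, hw, hw0⟩ := Submodule.exists_mem_ne_zero_of_ne_bot hk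
  have hw' : Matrix.of g *ᵥ w = 0 := hw
  have hp : 0 < w ⬝ᵥ w := lt_of_le_of_ne (by simpa using dotProduct_star_self_nonneg w) (dot_self_ne hw0).symm
  refine ⟨(√(w ⬝ᵥ w))⁻¹ • w, ?_, fun i => ?_⟩
  · rw [smul_dotProduct, dotProduct_smul, smul_smul, smul_eq_mul, ← mul_inv, Real.mul_self_sqrt hp.le]
    exact inv_mul_cancel₀ hp.ne'
  · rw [dotProduct_smul]
    have := congrFun hw' i
    simp only [mulVec, Matrix.of_apply, Pi.zero_apply] at this
    change g i ⬝ᵥ w = 0 at this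
    rw [this]; simp

lemma exists_OO_col [Nontrivial ι] {u : ι → ℝ} (hu : u ⬝ᵥ u = 1) (i : ι) (ε : ℝ) (hε : ε = 1 ∨ ε = -1) :
    ∃ Q ∈ OO ι, Q.det = ε ∧ ∀ x, Q x i = u x := by
  obtain ⟨j, hj⟩ := exists_ne i
  have key : ∃ Q ∈ OO ι, ∀ x, Q x i = u x := by
    by_cases h : Pi.single i 1 = u
    · refine ⟨1, OO.one, fun x => ?_⟩
      rw [← h]; simp [Matrix.one_apply, Pi.single_apply]
    · refine ⟨hh (Pi.single i 1 - u), hh_mem (sub_ne_zero.2 h), fun x => ?_⟩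
      have := hh_swap (x := Pi.single i 1) (y := u) (by simp [hu]) h
      have h2 := congrFun this x
      rw [mulVec_single_one] at h2
      exact h2
  obtain ⟨Q, hQ, hQu⟩ := key
  by_cases hd : Q.det = ε
  · exact ⟨Q, hQ, hd, hQu⟩
  · have hne : (Pi.single j 1 : ι → ℝ) ≠ 0 := by simp
    refine ⟨Q * hh (Pi.single j 1), OO.mul hQ (hh_mem hne), ?_, fun x => ?_⟩
    · rw [det_mul, hh_det hne]
      rw [pm_ne (OO.det hQ) hε hd]; ring
    · have h1 : hh (Pi.single j 1) *ᵥ (Pi.single i 1) = Pi.single i 1 := hh_fix (by simp [hj])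
      have h2 : (Q * hh (Pi.single j 1)) *ᵥ (Pi.single i 1) = Q *ᵥ Pi.single i 1 := by
        rw [← mulVec_mulVec, h1]
      have := congrFun h2 x
      simp only [mulVec_single_one] at this
      rw [← hQu]; exact this

lemma sg_eq (F : Matrix ι κ ℝ) (s : κ → ℝ) : sg F s = F * diagonal s := by
  ext x y; simp [sg, mul_comm]

lemma sg_mem {F : Matrix ι κ ℝ} (hF : F ∈ TF ι κ a) {s : κ → ℝ} (hs : ∀ i, s i = 1 ∨ s i = -1) :
    sg F s ∈ TF ι κ a := by
  have h2 : ∀ i, s i * s i = 1 := fun i => by rcases hs i with h | h <;> simp [h]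
  rw [sg_eq]
  refine TF_mul_UD hF ⟨?_, fun i => ?_⟩
  · change _ * _ = _
    simp [h2]
  · simp [mul_right_comm, h2, hF.2]

lemma sg_OO {F : Matrix ι ι ℝ} (hF : F ∈ OO ι) {s : ι → ℝ} (hs : ∀ i, s i = 1 ∨ s i = -1) :
    sg F s ∈ OO ι := by
  have h2 : ∀ i, s i * s i = 1 := fun i => by rcases hs i with h | h <;> simp [h]
  rw [sg_eq]
  refine OO.mul hF ?_
  change _ * _ = _
  simp [h2]

lemma sg_det (F : Matrix ι ι ℝ) (s : ι → ℝ) : (sg F s).det = F.det * ∏ i, s i := by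
  rw [sg_eq, det_mul, det_diagonal]

lemma sg_sg (F : Matrix ι κ ℝ) (s t : κ → ℝ) : sg (sg F s) t = sg F (s * t) := by
  ext; simp [sg]; ring

lemma M1 [Nontrivial ι] {Q Q' : Matrix ι ι ℝ} (hQ : Q ∈ OO ι) (hQ' : Q' ∈ OO ι) (hd : Q'.det = - Q.det)
    {G : Matrix ι κ ℝ} (hG : G ∈ TF ι κ (a - 1)) (k : κ) :
    JoinedIn (TF ι (ι ⊕ κ) a) (fromCols Q G) (fromCols Q' (sg G (Function.update 1 k (-1)))) := by
  obtain ⟨u, hu, hgu⟩ := exists_unit_orth 1 (Fintype.one_lt_card (α := ι)) (fun _ x => G x k)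
  obtain ⟨i⟩ : Nonempty ι := inferInstance
  obtain ⟨P, hP, hPd, hPu⟩ := exists_OO_col hu i Q.det (OO.det hQ)
  have j1 : JoinedIn (TF ι (ι ⊕ κ) a) _ _ := hub_left hQ hP hPd.symm hG
  have j2 := flip_move j1.target_mem (i := Sum.inl i) (j := Sum.inr k) (by simp) (by
    rw [Matrix.mul_apply]
    simp only [transpose_apply, fromCols_apply_inl, fromCols_apply_inr, hPu]
    have := hgu 0
    rw [dotProduct_comm] at this
    exact this)
  have e : sg (P.fromCols G) (fun b => if b = Sum.inl i ∨ b = Sum.inr k then -1 else 1) =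
      fromCols (sg P (Function.update 1 i (-1))) (sg G (Function.update 1 k (-1))) := by
    ext x (y | y)
    · simp [sg, Function.update_apply]
    · simp [sg, Function.update_apply]
  rw [e] at j2
  have hs : ∀ {κ : Type _} [DecidableEq κ] (k : κ), ∀ i, (Function.update (1 : κ → ℝ) k (-1)) i = 1 ∨ 
      (Function.update (1 : κ → ℝ) k (-1)) i = -1 := by
    intro κ _ k i; by_cases h : i = k <;> simp [Function.update_apply, h]
  refine (j1.trans j2).trans (hub_left (sg_OO hP (hs i)) hQ' ?_ (sg_mem hG ?_))
  · rw [sg_det, Finset.prod_update_of_mem (Finset.mem_univ i), hPd, hd]; simp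
  · intro i; by_cases h : i = k <;> simp [Function.update_apply, h]

lemma signs_move [Nontrivial ι] (t : Finset κ) : ∀ {Q Q' : Matrix ι ι ℝ} (_ : Q ∈ OO ι) (_ : Q' ∈ OO ι)
    (_ : Q'.det = (-1) ^ t.card * Q.det)
    {G : Matrix ι κ ℝ} (_ : G ∈ TF ι κ (a - 1)),
    JoinedIn (TF ι (ι ⊕ κ) a) (fromCols Q G) (fromCols Q' (sg G (fun b => if b ∈ t then -1 else 1))) := by
  induction t using Finset.induction_on with
  | empty =>
    intro Q Q' hQ hQ' hd G hG
    have : sg G (fun b => if b ∈ (∅ : Finset κ) then -1 else 1) = G := by ext; simp [sg]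
    rw [this]
    exact hub_left hQ hQ' (by simpa using hd.symm) hG
  | insert k t hk ih =>
    intro Q Q' hQ hQ' hd G hG
    rw [Finset.card_insert_of_notMem hk] at hd
    obtain ⟨i⟩ : Nonempty ι := inferInstance
    have hs : ∀ b, (if b ∈ t then (-1:ℝ) else 1) = 1 ∨ (if b ∈ t then (-1:ℝ) else 1) = -1 := by
      intro b; split_ifs <;> simp
    have hs' : ∀ j, (Function.update (1 : ι → ℝ) i (-1)) j = 1 ∨ 
      (Function.update (1 : ι → ℝ) i (-1)) j = -1 := by
      intro j; by_cases h : j = i <;> simp [Function.update_apply, h]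
    have hP := sg_OO hQ' hs'
    have hPd : (sg Q' (Function.update (1 : ι → ℝ) i (-1))).det = - Q'.det := by
      rw [sg_det, Finset.prod_update_of_mem (Finset.mem_univ i)]; simp
    have j1 := ih hQ hP (by rw [hPd, hd]; ring) hG
    have j2 : JoinedIn (TF ι (ι ⊕ κ) a) _ _ := M1 hP hQ' (by rw [hPd]; ring) (sg_mem hG hs) k
    rw [sg_sg] at j2
    convert j1.trans j2 using 3
    ext b
    by_cases hb : b = k
    · subst hb; simp [hk]
    · simp [hb, Function.update_apply]

lemma signs_move' [Nontrivial ι] {s : κ → ℝ} (hs : ∀ i, s i = 1 ∨ s i = -1)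
     {Q Q' : Matrix ι ι ℝ} (hQ : Q ∈ OO ι) (hQ' : Q' ∈ OO ι)
    (hd : Q'.det = (∏ i, s i) * Q.det) {G : Matrix ι κ ℝ} (hG : G ∈ TF ι κ (a - 1)) :
    JoinedIn (TF ι (ι ⊕ κ) a) (fromCols Q G) (fromCols Q' (sg G s)) := by
  have e : s = fun b => if b ∈ (Finset.univ.filter fun i => s i = -1) then -1 else 1 := by
    ext b
    rcases hs b with h | h <;> simp [h]
  have := signs_move (a := a) (Finset.univ.filter fun i => s i = -1) hQ hQ' (by
    have e2 : ∏ i, s i = (-1) ^ (Finset.univ.filter fun i => s i = -1).card := by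
      rw [Finset.prod_congr rfl (fun i _ => congrFun e i), Finset.prod_ite]
      simp
    rw [hd, e2]) hG
  rwa [← e] at this

lemma caseA [Nontrivial ι] [Nonempty κ] (h : Fintype.card ι ≤ Fintype.card κ) 
    (hc : (a - 1) * Fintype.card ι = Fintype.card κ)
    (ha : 0 ≤ a - 1) (hconn : IsPathConnected (TF ι κ (a - 1))) : IsPathConnected (TF ι (ι ⊕ κ) a) := by
  rw [isPathConnected_iff]
  obtain ⟨k⟩ : Nonempty κ := inferInstance
  refine ⟨?_, fun F hF F' hF' => ?_⟩
  · obtain ⟨G, hG⟩ := hconn.nonempty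
    exact ⟨_, hub_mem OO.one hG⟩
  obtain ⟨Q, hQ, G, hG, j1⟩ := hub h hc ha hF
  obtain ⟨Q', hQ', G', hG', j2⟩ := hub h hc ha hF'
  refine j1.trans (JoinedIn.trans ?_ j2.symm)
  by_cases hd : Q.det = Q'.det
  · exact (hub_left hQ hQ' hd hG).trans (hub_right hQ' (hconn.joinedIn _ hG _ hG'))
  · refine (M1 hQ hQ' ?_ hG k).trans (hub_right hQ' (hconn.joinedIn _ (sg_mem hG ?_) _ hG'))
    · exact pm_ne (OO.det hQ) (OO.det hQ') hd
    · intro i; by_cases h : i = k <;> simp [Function.update_apply, h]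

lemma caseB [Nontrivial ι] : IsPathConnected (TF ι (ι ⊕ ι) 2) := by
  have hTF : ∀ {X : Matrix ι ι ℝ}, X ∈ OO ι → X ∈ TF ι ι ((2:ℝ) - 1) := by
    intro X hX
    exact ⟨by rw [OO.mul_tr hX]; norm_num, OO.diag hX⟩
  have hTF' : ∀ {X : Matrix ι ι ℝ}, X ∈ TF ι ι ((2:ℝ) - 1) → X ∈ OO ι := by
    intro X hX
    change _ * _ = _
    rw [hX.1]; norm_num
  refine ⟨fromCols 1 1, hub_mem OO.one (hTF OO.one), fun {F} hF => JoinedIn.symm ?_⟩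
  obtain ⟨Q, hQ, G, hG, j1⟩ := hub (a := 2) le_rfl (by norm_num) (by norm_num) hF
  refine j1.trans ?_
  obtain ⟨i, j, hij⟩ := exists_pair_ne ι
  have hs : ∀ j, (Function.update (1 : ι → ℝ) i (-1)) j = 1 ∨ 
      (Function.update (1 : ι → ℝ) i (-1)) j = -1 := by
    intro j; by_cases h : j = i <;> simp [Function.update_apply, h]
  have hsd : ∀ G : Matrix ι ι ℝ, (sg G (Function.update 1 i (-1))).det = - G.det := by
    intro G
    rw [sg_det, Finset.prod_update_of_mem (Finset.mem_univ i)]; simp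
  have key1 : ∀ {G : Matrix ι ι ℝ}, G ∈ OO ι → G.det = 1 →
      JoinedIn (TF ι (ι ⊕ ι) 2) (fromCols 1 G) (fromCols 1 1) := by
    intro G hG hd
    have := TF_joined_left hG OO.one (by simp [hd]) (hTF (X := 1) OO.one)
    simp only [Matrix.mul_one] at this
    exact hub_right OO.one this
  have key : ∀ {G : Matrix ι ι ℝ}, G ∈ OO ι → JoinedIn (TF ι (ι ⊕ ι) 2) (fromCols 1 G) (fromCols 1 1) := by
    intro G hG
    rcases OO.det hG with h | h
    · exact key1 hG h
    · have hm : fromCols 1 1 ∈ TF ι (ι ⊕ ι) 2 := hub_mem OO.one (hTF OO.one)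
      have j2 := triple_move hm (i := Sum.inl j) (j := Sum.inr i) (k := Sum.inr j) (by simp) (by simpa using hij) (by simp)
        (by rw [Matrix.mul_apply]; simp [Matrix.one_apply, hij, hij.symm])
        (by rw [Matrix.mul_apply]; simp [Matrix.one_apply, hij, hij.symm])
      have e : (Matrix.of fun x b => if b = Sum.inl j then fromCols (1 : Matrix ι ι ℝ) (1 : Matrix ι ι ℝ) x (Sum.inr j) else 
          if b = Sum.inr i then - fromCols (1 : Matrix ι ι ℝ) (1 : Matrix ι ι ℝ) x (Sum.inr i) else
          if b = Sum.inr j then fromCols (1 : Matrix ι ι ℝ) (1 : Matrix ι ι ℝ) x (Sum.inl j) else fromCols (1 : Matrix ι ι ℝ) (1 : Matrix ι ι ℝ) x b) = 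
          fromCols 1 (sg 1 (Function.update 1 i (-1))) := by
        ext x (b | b)
        · by_cases hb : b = j <;> simp [hb]
        · by_cases hb : b = i
          · simp [hb, sg]
          · by_cases hb2 : b = j
            · simp [hb2, sg, hij.symm]
            · simp [hb, hb2, sg]
      rw [e] at j2
      refine JoinedIn.trans ?_ j2.symm
      have := TF_joined_left hG (sg_OO OO.one hs) (by rw [hsd]; simp [h]) (hTF (X := 1) OO.one)
      simp only [Matrix.mul_one] at this
      exact hub_right OO.one this
  rcases OO.det hQ with h | h
  · exact (hub_left hQ OO.one (by simp [h]) hG).trans (key (hTF' hG))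
  · exact (M1 hQ OO.one (by simp [h]) hG i).trans (key (sg_OO (hTF' hG) hs))

end moves



section caseC
variable {ι κ : Type*} [Fintype ι] [DecidableEq ι] [Fintype κ] [DecidableEq κ] {a b : ℝ}

lemma simplex_v (hκ : Fintype.card κ = Fintype.card ι + 1) (hb : 0 < b) {G : Matrix ι κ ℝ}
    (hG : G ∈ TF ι κ b) : ∃ v : κ → ℝ, Gᵀ * G = b • (1 - vecMulVec v v) := by
  obtain ⟨v, hv, hGv⟩ := exists_unit_orth (ι := κ) (Fintype.card ι) (by omega)
    (fun i => G ((Fintype.equivFin ι).symm i))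
  refine ⟨v, ?_⟩
  have hGv' : ∀ i, G i ⬝ᵥ v = 0 := by
    intro i; simpa using hGv (Fintype.equivFin ι i)
  have hs : √b * √b = b := Real.mul_self_sqrt hb.le
  have hs0 : √b ≠ 0 := (Real.sqrt_pos.2 hb).ne'
  let W : Matrix (ι ⊕ Unit) κ ℝ := fromRows ((√b)⁻¹ • G) (replicateRow Unit v)
  have hW : W * Wᵀ = 1 := by
    simp only [W]
    rw [transpose_fromRows, fromRows_mul_fromCols, ← fromBlocks_one]
    congr 1
    · rw [transpose_smul, Matrix.smul_mul, Matrix.mul_smul, smul_smul, hG.1, smul_smul, ← mul_inv, hs,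
        inv_mul_cancel₀ hb.ne', one_smul]
    · ext i j
      have := hGv' i
      simp only [dotProduct] at this
      simp [Matrix.mul_apply, mul_assoc, ← Finset.mul_sum, this]
    · ext j i
      have := hGv' i
      simp only [dotProduct] at this
      simp [Matrix.mul_apply, mul_comm (v _), mul_assoc, ← Finset.mul_sum, this]
    · ext i j
      simp only [dotProduct] at hv
      simp [Matrix.mul_apply, hv]
  have hW2 : Wᵀ * W = 1 := (Matrix.mul_eq_one_comm_of_card_eq _ _ _ (by simp [hκ])).1 hW
  simp only [W] at hW2
  rw [transpose_fromRows, fromCols_mul_fromRows, transpose_smul, Matrix.smul_mul, Matrix.mul_smul, smul_smul,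
     ← mul_inv, hs] at hW2
  have e : (replicateRow Unit v)ᵀ * replicateRow Unit v = vecMulVec v v := by
    ext i j; simp [Matrix.mul_apply, vecMulVec_apply]
  rw [e] at hW2
  rw [← hW2, add_sub_cancel_right, smul_smul, mul_inv_cancel₀ hb.ne', one_smul]

lemma simplex_sq (hb : 0 < b) {G : Matrix ι κ ℝ}
    (hG : G ∈ TF ι κ b) {v : κ → ℝ} (hv : Gᵀ * G = b • (1 - vecMulVec v v)) (k : κ) : v k * v k = 1 - b⁻¹ := by
  have := hG.2 k
  rw [hv] at this
  simp [vecMulVec_apply] at this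
  field_simp
  linarith

lemma simplex_rel (hκ : Fintype.card κ = Fintype.card ι + 1) (hb : 1 < b) {G G' : Matrix ι κ ℝ}
    (hG : G ∈ TF ι κ b) (hG' : G' ∈ TF ι κ b) : ∃ R ∈ OO ι, ∃ s : κ → ℝ, (∀ i, s i = 1 ∨ s i = -1) ∧
      G' = sg (R * G) s := by
  have hb0 : 0 < b := by linarith
  obtain ⟨v, hv⟩ := simplex_v hκ hb0 hG
  obtain ⟨v', hv'⟩ := simplex_v hκ hb0 hG'
  have h1 := simplex_sq hb0 hG hv
  have h2 := simplex_sq hb0 hG' hv'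
  have hpos : 0 < 1 - b⁻¹ := by
    have := inv_lt_one_of_one_lt₀ hb
    linarith
  have hv0 : ∀ k, v k ≠ 0 := by
    intro k h
    have := h1 k
    rw [h] at this; linarith
  let s : κ → ℝ := fun k => v' k / v k
  have hs : ∀ k, v' k = s k * v k := fun k => by simp [s, hv0 k]
  have hs1 : ∀ i, s i * s i = 1 := by
    intro i
    have := h2 i
    rw [hs, ← h1 i] at this
    have h3 : (s i * s i - 1) * (v i * v i) = 0 := by linarith
    rcases mul_eq_zero.1 h3 with h | h
    · linarith
    · exact absurd h (by simp [hv0])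
  obtain ⟨R, hR, hRG⟩ := exists_OO_of_gram' (A := G') (B := sg G s) (by
    rw [sg_eq, transpose_mul, diagonal_transpose, Matrix.mul_assoc, ← Matrix.mul_assoc Gᵀ, hv, hv']
    ext i j
    by_cases hij : i = j
    · subst hij
      simp [vecMulVec_apply, hs, Matrix.one_apply]
      linear_combination (-b) * hs1 i
    · simp [vecMulVec_apply, hs, Matrix.one_apply, hij]
      ring)
  refine ⟨R, hR, s, fun i => mul_self_eq_one_iff.1 (hs1 i), ?_⟩
  rw [hRG, sg_eq, sg_eq, Matrix.mul_assoc]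

lemma caseC [Nontrivial ι] (hκ : Fintype.card κ = Fintype.card ι + 1) 
    (hc : (a - 1) * Fintype.card ι = Fintype.card κ) (Q0 Q1 R1 : Matrix ι ι ℝ) (S : Matrix ι κ ℝ)
    (hQ0 : Q0 ∈ OO ι) (hQ1 : Q1 ∈ OO ι) (hR1 : R1 ∈ OO ι) (hS : S ∈ TF ι κ (a - 1)) (hdR : R1.det = -1)
    (hdQ : Q1.det = - Q0.det) (hX : JoinedIn (TF ι (ι ⊕ κ) a) (fromCols Q0 S) (fromCols Q1 (R1 * S))) :
    IsPathConnected (TF ι (ι ⊕ κ) a) := by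
  have hb : 1 < a - 1 := by
    have h1 : (0:ℝ) < Fintype.card ι := by exact_mod_cast Fintype.card_pos
    rw [hκ] at hc
    push_cast at hc
    by_contra! h
    nlinarith
  refine ⟨fromCols Q0 S, hub_mem hQ0 hS, fun {F} hF => JoinedIn.symm ?_⟩
  obtain ⟨Q', hQ', G, hG, j1⟩ := hub (by omega) hc (by linarith) hF
  refine j1.trans ?_
  obtain ⟨R, hR, s, hs, rfl⟩ := simplex_rel hκ hb hS hG
  have hsame : ∀ {Q Q' R R' : Matrix ι ι ℝ}, Q ∈ OO ι → Q' ∈ OO ι → R ∈ OO ι → R' ∈ OO ι → 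
      Q.det = Q'.det → R.det = R'.det → JoinedIn (TF ι (ι ⊕ κ) a) (fromCols Q (R * S)) (fromCols Q' (R' * S)) := by
    intro Q Q' R R' hQ hQ' hR hR' h1 h2
    exact (hub_left hQ hQ' h1 (TF_left hR hS)).trans (hub_right hQ' (TF_joined_left hR hR' h2 hS))
  have hX' : ∀ {Q R : Matrix ι ι ℝ}, Q ∈ OO ι → R ∈ OO ι → Q.det = - Q0.det → R.det = -1 → 
      JoinedIn (TF ι (ι ⊕ κ) a) (fromCols Q (R * S)) (fromCols Q0 S) := by
    intro Q R hQ hR h1 h2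
    exact (hsame hQ hQ1 hR hR1 (by rw [h1, hdQ]) (by rw [h2, hdR])).trans hX.symm
  have h00 : ∀ {Q R : Matrix ι ι ℝ}, Q ∈ OO ι → R ∈ OO ι → Q.det = Q0.det → R.det = 1 → 
      JoinedIn (TF ι (ι ⊕ κ) a) (fromCols Q (R * S)) (fromCols Q0 S) := by
    intro Q R hQ hR h1 h2
    have := hsame hQ hQ0 hR OO.one h1 (by simp [h2])
    rwa [Matrix.one_mul] at this
  have hneg : ∀ {R : Matrix ι ι ℝ}, R ∈ OO ι → -R ∈ OO ι := by
    intro R hR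
    change _ * _ = _
    simp [OO.mul_tr hR]
  have hF1 : ∀ {Q Q' R : Matrix ι ι ℝ}, Q ∈ OO ι → Q' ∈ OO ι → R ∈ OO ι →
      Q'.det = (-1) ^ (Fintype.card ι + 1) * Q.det →
      JoinedIn (TF ι (ι ⊕ κ) a) (fromCols Q (R * S)) (fromCols Q' ((-R) * S)) := by
    intro Q Q' R hQ hQ' hR h1
    have := signs_move' (a := a) (s := fun _ => -1) (fun _ => Or.inr rfl) hQ hQ' (by simp [h1, hκ]) (TF_left hR hS)
    convert this using 2
    ext; simp [sg]
  have hall : ∀ {Q R : Matrix ι ι ℝ}, Q ∈ OO ι → R ∈ OO ι → 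
      JoinedIn (TF ι (ι ⊕ κ) a) (fromCols Q (R * S)) (fromCols Q0 S) := by
    intro Q R hQ hR
    have hdn : (-R).det = (-1) ^ (Fintype.card ι) * R.det := det_neg R
    have hQcase : Q.det = Q0.det ∨ Q.det = - Q0.det := by
      by_cases h : Q0.det = Q.det
      · exact Or.inl h.symm
      · exact Or.inr (pm_ne (OO.det hQ0) (OO.det hQ) h)
    rcases Nat.even_or_odd (Fintype.card ι) with he | ho
    · rw [he.neg_one_pow, one_mul] at hdn
      rcases hQcase with h1 | h1 <;> rcases OO.det hR with h2 | h2
      · exact h00 hQ hR h1 h2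
      · exact (hF1 hQ hQ1 hR (by rw [he.add_one.neg_one_pow, hdQ, h1]; ring)).trans 
          (hX' hQ1 (hneg hR) hdQ (by rw [hdn, h2]))
      · exact (hF1 hQ hQ0 hR (by rw [he.add_one.neg_one_pow, h1]; ring)).trans 
          (h00 hQ0 (hneg hR) rfl (by rw [hdn, h2]))
      · exact hX' hQ hR h1 h2
    · rw [ho.neg_one_pow] at hdn
      rcases hQcase with h1 | h1 <;> rcases OO.det hR with h2 | h2
      · exact h00 hQ hR h1 h2
      · exact (hF1 hQ hQ hR (by rw [ho.add_one.neg_one_pow]; ring)).trans 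
          (h00 hQ (hneg hR) h1 (by rw [hdn, h2]; ring))
      · exact (hF1 hQ hQ hR (by rw [ho.add_one.neg_one_pow]; ring)).trans 
          (hX' hQ (hneg hR) h1 (by rw [hdn, h2]; ring))
      · exact hX' hQ hR h1 h2
  have hprod : ∏ i, s i = 1 ∨ ∏ i, s i = -1 := by
    refine Finset.prod_induction s (fun x => x = 1 ∨ x = -1) ?_ (Or.inl rfl) (fun i _ => hs i)
    rintro x y (rfl | rfl) (rfl | rfl) <;> simp
  have hss : sg (sg (R * S) s) s = R * S := by
    rw [sg_sg]
    ext x y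
    rcases hs y with h | h <;> simp [sg, h]
  rcases hprod with hp | hp
  · have := signs_move' (a := a) hs hQ' hQ' (by simp [hp]) hG
    rw [hss] at this
    exact this.trans (hall hQ' hR)
  · have hQ'' : ∃ P ∈ OO ι, P.det = - Q'.det := by
      by_cases h : Q'.det = Q0.det
      · exact ⟨Q1, hQ1, by rw [hdQ, h]⟩
      · exact ⟨Q0, hQ0, pm_ne (OO.det hQ') (OO.det hQ0) h⟩
    obtain ⟨P, hP, hPd⟩ := hQ''
    have := signs_move' (a := a) hs hQ' hP (by simp [hp, hPd]) hG
    rw [hss] at this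
    exact this.trans (hall hP hR)

lemma caseC_big (h3 : 3 ≤ Fintype.card ι) (hκ : Fintype.card κ = Fintype.card ι + 1) 
    (hc : (a - 1) * Fintype.card ι = Fintype.card κ) : IsPathConnected (TF ι (ι ⊕ κ) a) := by
  have : Nontrivial ι := Fintype.one_lt_card_iff_nontrivial.1 (by omega)
  have hb : 1 < a - 1 := by
    have h1 : (0:ℝ) < Fintype.card ι := by exact_mod_cast Fintype.card_pos
    rw [hκ] at hc
    push_cast at hc
    by_contra! h
    nlinarith
  obtain ⟨S, hS⟩ := TF_nonempty (a := a - 1) (by omega) (by linarith) hc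
  obtain ⟨v, hv⟩ := simplex_v hκ (by linarith) hS
  have hvsq := simplex_sq (by linarith) hS hv
  obtain ⟨k, l, hkl, hvkl⟩ := Fintype.exists_ne_map_eq_of_card_lt (fun k => decide (0 < v k))
    (by rw [Fintype.card_bool]; omega)
  have hvv : v k = v l := by
    simp only [decide_eq_decide] at hvkl
    rcases mul_self_eq_mul_self_iff.1 ((hvsq k).trans (hvsq l).symm) with h | h
    · exact h
    · exfalso
      have hpos : 0 < 1 - (a - 1)⁻¹ := by
        have := inv_lt_one_of_one_lt₀ hb
        linarith
      have h5 := hvsq k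
      by_cases h6 : 0 < v k
      · have := hvkl.1 h6; linarith
      · have h7 : ¬ 0 < v l := fun h => h6 (hvkl.2 h)
        have : v k = 0 := by linarith
        rw [this] at h5; linarith
  have hgram : ∀ p q, (fun x => S x p) ⬝ᵥ (fun x => S x q) = (a - 1) * ((1 : Matrix κ κ ℝ) p q - v p * v q) := by
    intro p q
    have := congrFun (congrFun hv p) q
    rw [Matrix.mul_apply] at this
    simp only [transpose_apply, Matrix.smul_apply, Matrix.sub_apply, vecMulVec_apply, smul_eq_mul] at this
    exact this
  have hne : (fun x => S x k) - (fun x => S x l) ≠ 0 := by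
    intro h
    have h1 := hgram k k
    have h2 := hgram k l
    rw [← sub_eq_zero.1 h, h1, ← hvv] at h2
    simp [hkl] at h2
    linarith
  have hnorm : ∀ p, (fun x => S x p) ⬝ᵥ (fun x => S x p) = 1 := by
    intro p; have := hS.2 p; rwa [Matrix.mul_apply] at this
  set H := hh ((fun x => S x k) - (fun x => S x l)) with hH
  obtain ⟨u, hu, hgu⟩ := exists_unit_orth 2 (by omega) ![fun x => S x k, fun x => S x l]
  have hu1 : (fun x => S x k) ⬝ᵥ u = 0 := hgu 0
  have hu2 : (fun x => S x l) ⬝ᵥ u = 0 := hgu 1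
  obtain ⟨i⟩ : Nonempty ι := inferInstance
  obtain ⟨Q, hQ, hQd, hQu⟩ := exists_OO_col hu i 1 (Or.inl rfl)
  have hs : ∀ j, (Function.update (1 : ι → ℝ) i (-1)) j = 1 ∨ 
      (Function.update (1 : ι → ℝ) i (-1)) j = -1 := by
    intro j; by_cases h : j = i <;> simp [Function.update_apply, h]
  have hsd : ∀ G : Matrix ι ι ℝ, (sg G (Function.update 1 i (-1))).det = - G.det := by
    intro G
    rw [sg_det, Finset.prod_update_of_mem (Finset.mem_univ i)]; simp
  refine caseC hκ hc Q (sg Q (Function.update 1 i (-1))) H S hQ (sg_OO hQ hs) (hh_mem hne) hS (hh_det hne) 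
    (hsd Q) ?_
  have hm : fromCols Q S ∈ TF ι (ι ⊕ κ) a := hub_mem hQ hS
  have j1 := triple_move hm (i := Sum.inr k) (j := Sum.inl i) (k := Sum.inr l) (by simp) (by simp) (by simpa using hkl)
    (by
      rw [Matrix.mul_apply]
      simp only [transpose_apply, fromCols_apply_inl, fromCols_apply_inr, hQu]
      exact hu1)
    (by
      rw [Matrix.mul_apply]
      simp only [transpose_apply, fromCols_apply_inl, fromCols_apply_inr, hQu]
      rw [dotProduct_comm] at hu2
      exact hu2)
  convert j1 using 1
  have hcol : ∀ x y, (H * S) x y = (H *ᵥ (fun x => S x y)) x := fun x y => rfl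
  have hk1 : H *ᵥ (fun x => S x k) = (fun x => S x l) :=
    hh_swap (by rw [hnorm, hnorm]) (sub_ne_zero.1 hne)
  have hk2 : H *ᵥ (fun x => S x l) = (fun x => S x k) := by
    rw [← hk1, mulVec_mulVec]
    have : H * H = 1 := by
      have := OO.mul_tr (hh_mem hne)
      rwa [hh_tr] at this
    rw [this, one_mulVec]
  have hk3 : ∀ y, y ≠ k → y ≠ l → H *ᵥ (fun x => S x y) = (fun x => S x y) := by
    intro y h1 h2
    refine hh_fix ?_
    rw [sub_dotProduct, hgram, hgram, hvv]
    simp [Matrix.one_apply, h1.symm, h2.symm]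
  ext x (y | y)
  · by_cases h : y = i
    · subst h; simp [sg]
    · simp [sg, h]
  · rw [fromCols_apply_inr, hcol]
    by_cases h1 : y = k
    · subst h1; simp [hk1]
    · by_cases h2 : y = l
      · subst h2; simp [hk2, h1]
      · rw [hk3 y h1 h2]; simp [h1, h2]

end caseC



section caseC2

lemma caseC_two : IsPathConnected (TF (Fin 2) (Fin 2 ⊕ Fin 3) (5/2)) := by
  let X : ℝ → Matrix (Fin 2) (Fin 2) ℝ := fun c => !![√(3/4 - c^2), √(3/4 - c^2); √(1/4 + c^2), -√(1/4 + c^2)]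
  let Y : ℝ → Matrix (Fin 2) (Fin 3) ℝ := fun c => !![c, c, 1; √(1 - c^2), -√(1 - c^2), 0]
  have hX : Continuous X := by
    refine continuous_matrix fun i j => ?_
    fin_cases i <;> fin_cases j <;> simp [X] <;> fun_prop
  have hY : Continuous Y := by
    refine continuous_matrix fun i j => ?_
    fin_cases i <;> fin_cases j <;> simp [Y] <;> fun_prop
  have hmem : ∀ c : ℝ, c^2 ≤ 1/4 → fromCols (X c) (Y c) ∈ TF (Fin 2) (Fin 2 ⊕ Fin 3) (5/2) := by
    intro c hc
    have h1 := Real.mul_self_sqrt (show 0 ≤ 3/4 - c^2 by linarith)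
    have h2 := Real.mul_self_sqrt (show 0 ≤ 1/4 + c^2 by positivity)
    have h3 := Real.mul_self_sqrt (show 0 ≤ 1 - c^2 by linarith)
    simp only [X, Y]
    generalize √(3/4 - c^2) = p at *
    generalize √(1/4 + c^2) = q at *
    generalize √(1 - c^2) = r at *
    refine mem_fromCols.2 ⟨?_, ?_, ?_⟩
    · ext i j
      simp only [Matrix.add_apply, Matrix.mul_apply, transpose_apply, Fin.sum_univ_succ, Matrix.smul_apply]
      fin_cases i <;> fin_cases j <;> simp <;> nlinarith
    · intro j
      fin_cases j <;> simp [X, Y, Matrix.mul_apply, Fin.sum_univ_succ] <;> nlinarith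
    · intro j
      fin_cases j <;> simp [X, Y, Matrix.mul_apply, Fin.sum_univ_succ] <;> nlinarith
  have hXY : X (-(1/2)) = X (1/2) := by simp [X]
  have jn : JoinedIn (TF (Fin 2) (Fin 2 ⊕ Fin 3) (5/2)) (fromCols (X (1/2)) (Y (1/2)))
      (fromCols (X (-(1/2))) (Y (-(1/2)))) := by
    refine JoinedIn.ofLine (f := fun t => fromCols (X (1/2 - t)) (Y (1/2 - t))) ?_ ?_ ?_ ?_
    · exact (continuous_fromCols (hX.comp (by fun_prop)) (hY.comp (by fun_prop))).continuousOn
    · simp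
    · norm_num
    · rintro _ ⟨t, ⟨h0, h1⟩, rfl⟩
      exact hmem _ (by nlinarith)
  rw [hXY] at jn
  have hr := Real.mul_self_sqrt (show (0:ℝ) ≤ 1/2 by norm_num)
  have hX12 : X (1/2) = !![√(1/2), √(1/2); √(1/2), -√(1/2)] := by
    simp only [X]; norm_num
  have hQ : X (1/2) ∈ OO (Fin 2) := by
    change _ * _ = _
    rw [hX12]
    generalize √(1/2) = r at *
    ext i j
    simp only [Matrix.mul_apply, transpose_apply, Fin.sum_univ_succ]
    fin_cases i <;> fin_cases j <;> simp <;> nlinarith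
  have hS : ∀ c : ℝ, c ^ 2 = 1/4 → Y c ∈ TF (Fin 2) (Fin 3) ((5/2 : ℝ) - 1) := by
    intro c hc
    have h3 := Real.mul_self_sqrt (show 0 ≤ 1 - c^2 by linarith)
    simp only [Y]
    generalize √(1 - c^2) = r at *
    refine ⟨?_, ?_⟩
    · ext i j
      simp only [Matrix.mul_apply, transpose_apply, Fin.sum_univ_succ, Matrix.smul_apply]
      fin_cases i <;> fin_cases j <;> simp <;> nlinarith
    · intro j
      fin_cases j <;> simp [Y, Matrix.mul_apply, Fin.sum_univ_succ] <;> nlinarith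
  have hR : (!![-1, 0; 0, 1] : Matrix (Fin 2) (Fin 2) ℝ) ∈ OO (Fin 2) := by
    change _ * _ = _
    ext i j
    simp only [Matrix.mul_apply, transpose_apply, Fin.sum_univ_succ]
    fin_cases i <;> fin_cases j <;> simp
  have hRd : (!![-1, 0; 0, 1] : Matrix (Fin 2) (Fin 2) ℝ).det = -1 := by simp [det_fin_two]
  have hQR := OO.mul hQ hR
  have hQRd : (X (1/2) * !![-1, 0; 0, 1]).det = - (X (1/2)).det := by
    rw [det_mul, hRd]; ring
  have j2 : JoinedIn (TF (Fin 2) (Fin 2 ⊕ Fin 3) (5/2)) _ _ := 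
    M1 hQ hQR hQRd (hS (-(1/2)) (by norm_num)) 2
  refine caseC (by simp) (by norm_num) (X (1/2)) (X (1/2) * !![-1, 0; 0, 1]) !![-1, 0; 0, 1] (Y (1/2)) 
    hQ hQR hR (hS _ (by norm_num)) hRd hQRd ?_
  convert jn.trans j2 using 2
  ext i j
  fin_cases i <;> fin_cases j <;> simp [sg, Y, Function.update_apply, Matrix.mul_apply, Fin.sum_univ_succ]

end caseC2



section naimark
variable {ι ι' κ : Type*} [Fintype ι] [DecidableEq ι] [Fintype ι'] [DecidableEq ι'] [Fintype κ] [DecidableEq κ]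

lemma skew_det {X : Matrix κ κ ℝ} (hX : Xᵀ = -X) : (1 - X).det ≠ 0 := by
  intro h
  obtain ⟨v, hv, hv0⟩ := Matrix.exists_mulVec_eq_zero_iff.2 h
  have h1 : X *ᵥ v = v := by
    rw [sub_mulVec, one_mulVec, sub_eq_zero] at hv0
    exact hv0.symm
  have h2 : v ⬝ᵥ (X *ᵥ v) = - (v ⬝ᵥ (X *ᵥ v)) := by
    conv_lhs => rw [dotProduct_mulVec, ← mulVec_transpose, hX, neg_mulVec, neg_dotProduct, dotProduct_comm]
  rw [h1] at h2
  exact dot_self_ne hv (by linarith)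

/-- skew matrix whose Cayley transform moves `A` to `B`. -/
def skx (A B : Matrix ι κ ℝ) : Matrix κ κ ℝ :=
  (A + B)ᵀ * ((A + B) * (A + B)ᵀ)⁻¹ * (B - A) - (B - A)ᵀ * ((A + B) * (A + B)ᵀ)⁻¹ * (A + B)
    - (A + B)ᵀ * ((A + B) * (A + B)ᵀ)⁻¹ * ((B - A) * (A + B)ᵀ) * ((A + B) * (A + B)ᵀ)⁻¹ * (A + B)

/-- Cayley transform -/
def cay (X : Matrix κ κ ℝ) : Matrix κ κ ℝ := (1 + X) * (1 - X)⁻¹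

lemma cay_mem {X : Matrix κ κ ℝ} (hX : Xᵀ = -X) : cay X ∈ OO κ := by
  have hu : IsUnit (1 - X).det := isUnit_iff_ne_zero.2 (skew_det hX)
  have ht : (1 - X)ᵀ = 1 + X := by simp [hX]
  have ht' : (1 + X)ᵀ = 1 - X := by simp [hX, sub_eq_add_neg]
  have hu' : IsUnit (1 + X).det := by rw [← ht, det_transpose]; exact hu
  change cay X * (cay X)ᵀ = 1
  rw [mul_eq_one_comm, cay, transpose_mul, transpose_nonsing_inv, ht, ht']
  have hcomm : (1 - X) * (1 + X) = (1 + X) * (1 - X) := by noncomm_ring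
  calc (1 + X)⁻¹ * (1 - X) * ((1 + X) * (1 - X)⁻¹) = (1 + X)⁻¹ * ((1 - X) * (1 + X)) * (1 - X)⁻¹ := by
        simp only [Matrix.mul_assoc]
    _ = ((1 + X)⁻¹ * (1 + X)) * ((1 - X) * (1 - X)⁻¹) := by
        rw [hcomm]; simp only [Matrix.mul_assoc]
    _ = 1 := by rw [nonsing_inv_mul _ hu', mul_nonsing_inv _ hu, Matrix.one_mul]

lemma cay_det {X : Matrix κ κ ℝ} (hX : Xᵀ = -X) : (cay X).det = 1 := by
  have ht : (1 - X)ᵀ = 1 + X := by simp [hX]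
  rw [cay, det_mul, ← ht, det_transpose, ← det_mul, 
    mul_nonsing_inv _ (isUnit_iff_ne_zero.2 (skew_det hX)), det_one]

lemma skx_anti {A B : Matrix ι κ ℝ} (hA : A * Aᵀ = 1) (hB : B * Bᵀ = 1) :
    (A + B) * (B - A)ᵀ = - ((B - A) * (A + B)ᵀ) := by
  simp only [transpose_add, transpose_sub, Matrix.add_mul, Matrix.mul_add, Matrix.sub_mul, Matrix.mul_sub, hA, hB]
  abel

lemma skx_skew {A B : Matrix ι κ ℝ} (hA : A * Aᵀ = 1) (hB : B * Bᵀ = 1) : (skx A B)ᵀ = - skx A B := by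
  have h := skx_anti hA hB
  have hM : (((A + B) * (A + B)ᵀ)⁻¹)ᵀ = ((A + B) * (A + B)ᵀ)⁻¹ := by
    rw [transpose_nonsing_inv, transpose_mul, transpose_transpose]
  unfold skx
  generalize ((A + B) * (A + B)ᵀ)⁻¹ = N at *
  generalize A + B = C at *
  generalize B - A = D at *
  simp only [transpose_sub, transpose_mul, transpose_transpose, hM]
  have e : Cᵀ * (N * (C * Dᵀ * (N * C))) = - (Cᵀ * N * (D * Cᵀ) * N * C) := by
    rw [h]; simp only [Matrix.mul_assoc, Matrix.neg_mul, Matrix.mul_neg]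
  rw [e]
  simp only [Matrix.mul_assoc]
  abel

lemma skx_mul {A B : Matrix ι κ ℝ} (hA : A * Aᵀ = 1) (hB : B * Bᵀ = 1) 
    (hu : ((A + B) * (A + B)ᵀ).det ≠ 0) : A * cay (skx A B) = B := by
  have h := skx_anti hA hB
  have hX := skx_skew hA hB
  have hC : (A + B) * skx A B = B - A := by
    have hM := mul_nonsing_inv _ (isUnit_iff_ne_zero.2 hu)
    unfold skx
    generalize ((A + B) * (A + B)ᵀ)⁻¹ = N at *
    generalize A + B = C at *
    generalize B - A = D at *
    have e1 : C * (Cᵀ * N * D - Dᵀ * N * C - Cᵀ * N * (D * Cᵀ) * N * C) =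
      (C * Cᵀ * N) * D - (C * Dᵀ) * N * C - (C * Cᵀ * N) * (D * Cᵀ) * N * C := by
      simp only [Matrix.mul_sub, Matrix.mul_assoc]
    rw [e1, hM, h]
    simp only [Matrix.one_mul, Matrix.neg_mul]
    abel
  have hu : IsUnit (1 - skx A B).det := isUnit_iff_ne_zero.2 (skew_det hX)
  generalize skx A B = X at *
  have : A * (1 + X) = B * (1 - X) := by
    rw [Matrix.add_mul] at hC
    rw [Matrix.mul_add, Matrix.mul_sub, Matrix.mul_one, Matrix.mul_one]
    have h3 : A * X = B - A - B * X := by rw [← hC]; abel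
    rw [h3]; abel
  rw [cay, ← Matrix.mul_assoc, this, Matrix.mul_assoc, mul_nonsing_inv _ hu, Matrix.mul_one]

lemma skx_self (A : Matrix ι κ ℝ) : skx A A = 0 := by simp [skx]
lemma cay_zero : cay (0 : Matrix κ κ ℝ) = 1 := by simp [cay]

lemma contAt_inv {T : Type*} [TopologicalSpace T] {f : T → Matrix κ κ ℝ} {t : T} (hf : ContinuousAt f t) 
    (h : (f t).det ≠ 0) : ContinuousAt (fun t => (f t)⁻¹) t := by
  refine ContinuousAt.comp (g := Inv.inv) (continuousAt_matrix_inv _ ?_) hf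
  rw [Ring.inverse_eq_inv']
  exact continuousAt_inv₀ h

lemma contAt_mul {l m n T : Type*} [Fintype m] [TopologicalSpace T] {f : T → Matrix l m ℝ} {g : T → Matrix m n ℝ} {t : T} 
    (hf : ContinuousAt f t) (hg : ContinuousAt g t) : ContinuousAt (fun t => f t * g t) t := by
  have : Continuous (fun p : Matrix l m ℝ × Matrix m n ℝ => p.1 * p.2) := continuous_fst.matrix_mul continuous_snd
  exact this.continuousAt.comp (f := fun t => (f t, g t)) (hf.prodMk hg)

lemma contAt_cay {A : Matrix ι κ ℝ} {γ : ℝ → Matrix ι κ ℝ} (hγ : Continuous γ) (t : ℝ)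
    (hA : A * Aᵀ = 1) (hB : γ t * (γ t)ᵀ = 1) 
    (hu : ((A + γ t) * (A + γ t)ᵀ).det ≠ 0) : ContinuousAt (fun t => cay (skx A (γ t))) t := by
  have hC : Continuous fun t => A + γ t := by fun_prop
  have hC' : Continuous fun t => (A + γ t)ᵀ := by fun_prop
  have hD : Continuous fun t => γ t - A := by fun_prop
  have hD' : Continuous fun t => (γ t - A)ᵀ := by fun_prop
  have hN : ContinuousAt (fun t => ((A + γ t) * (A + γ t)ᵀ)⁻¹) t :=
    contAt_inv (f := fun t => (A + γ t) * (A + γ t)ᵀ) (hC.matrix_mul hC').continuousAt hu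
  have hX : ContinuousAt (fun t => skx A (γ t)) t := by
    unfold skx
    refine ContinuousAt.sub (ContinuousAt.sub ?_ ?_) ?_
    · exact contAt_mul (contAt_mul hC'.continuousAt hN) hD.continuousAt
    · exact contAt_mul (contAt_mul hD'.continuousAt hN) hC.continuousAt
    · exact contAt_mul (contAt_mul (contAt_mul (contAt_mul hC'.continuousAt hN) 
        (hD.matrix_mul hC').continuousAt) hN) hC.continuousAt
  unfold cay
  refine contAt_mul (continuousAt_const.add hX) ?_
  exact contAt_inv (f := fun t => 1 - skx A (γ t)) (continuousAt_const.sub hX) (skew_det (skx_skew hA hB))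

/-- Lifting of paths of coisometries to orthogonal matrices. -/
lemma stiefel_lift (J : Matrix ι κ ℝ) (W : Set (Matrix ι κ ℝ)) (hW : ∀ A ∈ W, A * Aᵀ = 1)
    {A B : Matrix ι κ ℝ} (h : JoinedIn W A B) {V : Matrix κ κ ℝ} (hV : V ∈ OO κ) (hJV : J * V = A) :
    ∃ V', J * V' = B ∧ V'.det = V.det ∧ JoinedIn {V | V ∈ OO κ ∧ J * V ∈ W} V V' := by
  obtain ⟨p, hp⟩ := h
  let γ : ℝ → Matrix ι κ ℝ := p.extend
  have hγ : Continuous γ := p.continuous_extend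
  have hγW : ∀ t, γ t ∈ W := by
    intro t
    have : γ t ∈ Set.range p.extend := ⟨t, rfl⟩
    rw [Path.extend_range] at this
    obtain ⟨s, hs⟩ := this
    rw [← hs]; exact hp s
  have h0 : γ 0 = A := p.extend_zero
  have h1 : γ 1 = B := p.extend_one
  let P : ℝ → ℝ → Prop := fun s t => ∀ V ∈ OO κ, J * V = γ s → ∃ V', J * V' = γ t ∧ V'.det = V.det ∧ 
    JoinedIn {V | V ∈ OO κ ∧ J * V ∈ W} V V'
  have main : P 0 1 := by
    refine PreconnectedSpace.induction₂' P ?_ ⟨?_⟩ 0 1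
    · intro t₀
      have hc : Continuous fun t => ((γ t₀ + γ t) * (γ t₀ + γ t)ᵀ).det := by
        refine Continuous.matrix_det ?_
        exact Continuous.matrix_mul (by fun_prop) (by fun_prop)
      have hne : ((γ t₀ + γ t₀) * (γ t₀ + γ t₀)ᵀ).det ≠ 0 := by
        have : (γ t₀ + γ t₀) * (γ t₀ + γ t₀)ᵀ = (4:ℝ) • 1 := by
          rw [transpose_add, Matrix.add_mul, Matrix.mul_add, hW _ (hγW t₀)]
          module
        rw [this, det_smul]; simp
      have hev := hc.continuousAt.eventually_ne hne
      obtain ⟨ε, hε, hball⟩ := Metric.eventually_nhds_iff_ball.1 hev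
      filter_upwards [Metric.ball_mem_nhds t₀ hε] with t ht
      have hbc : IsPathConnected (Metric.ball t₀ ε) := (convex_ball t₀ ε).isPathConnected ⟨t₀, Metric.mem_ball_self hε⟩
      have hR : ∀ s ∈ Metric.ball t₀ ε, γ t₀ * cay (skx (γ t₀) (γ s)) = γ s := fun s hs =>
        skx_mul (hW _ (hγW _)) (hW _ (hγW _)) (hball s hs)
      have hRO : ∀ s, cay (skx (γ t₀) (γ s)) ∈ OO κ := fun s =>
        cay_mem (skx_skew (hW _ (hγW _)) (hW _ (hγW _)))
      have hRd : ∀ s, (cay (skx (γ t₀) (γ s))).det = 1 := fun s =>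
        cay_det (skx_skew (hW _ (hγW _)) (hW _ (hγW _)))
      have key : ∀ V ∈ OO κ, J * V = γ t₀ → 
          JoinedIn {V | V ∈ OO κ ∧ J * V ∈ W} V (V * cay (skx (γ t₀) (γ t))) := by
        intro V hV hJV
        have := (hbc.joinedIn t₀ (Metric.mem_ball_self hε) t ht).image_sub 
          (f := fun s => V * cay (skx (γ t₀) (γ s))) (B := {V | V ∈ OO κ ∧ J * V ∈ W})
          (fun s hs => (contAt_mul continuousAt_const 
            (contAt_cay hγ s (hW _ (hγW _)) (hW _ (hγW _)) (hball s hs))).continuousWithinAt) 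
          (fun s hs => ⟨OO.mul hV (hRO s), by rw [← Matrix.mul_assoc, hJV, hR s hs]; exact hγW s⟩)
        simpa [skx_self, cay_zero] using this
      refine ⟨fun V hV hJV => ⟨_, ?_, ?_, key V hV hJV⟩, fun V hV hJV => ?_⟩
      · rw [← Matrix.mul_assoc, hJV, hR t ht]
      · rw [det_mul, hRd, mul_one]
      · set R := cay (skx (γ t₀) (γ t)) with hRdef
        have e1 : J * (V * Rᵀ) = γ t₀ := by
          rw [← Matrix.mul_assoc, hJV, ← hR t ht, Matrix.mul_assoc, OO.mul_tr (hRO t), Matrix.mul_one]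
        have := key (V * Rᵀ) (OO.mul hV (OO.tr (hRO t))) e1
        rw [Matrix.mul_assoc, OO.tr_mul (hRO t), Matrix.mul_one] at this
        refine ⟨_, e1, ?_, this.symm⟩
        rw [det_mul, det_transpose, hRd, mul_one]
    · intro x y z hxy hyz V hV hJV
      obtain ⟨V', h1, h2, h3⟩ := hxy V hV hJV
      obtain ⟨V'', h4, h5, h6⟩ := hyz V' h3.target_mem.1 h1
      exact ⟨V'', h4, h5.trans h2, h3.trans h6⟩
  obtain ⟨V', h2, h3, h4⟩ := main V hV (hJV.trans h0.symm)
  exact ⟨V', h2.trans h1, h3, h4⟩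

lemma naimark [Nonempty ι] [Nontrivial ι'] {b b' : ℝ} (e : ι ⊕ ι' ≃ κ) (hb : 0 < b) (hb' : 0 < b') 
    (hbb : b⁻¹ + b'⁻¹ = 1) (hne : (TF ι' κ b').Nonempty)
    (hconn : IsPathConnected (TF ι κ b)) : IsPathConnected (TF ι' κ b') := by
  rw [isPathConnected_iff]
  refine ⟨hne, fun G hG G' hG' => ?_⟩
  let J : Matrix ι κ ℝ := Matrix.of fun i k => if e (Sum.inl i) = k then 1 else 0
  let J' : Matrix ι' κ ℝ := Matrix.of fun i k => if e (Sum.inr i) = k then 1 else 0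
  have hJ : J * Jᵀ = 1 := by
    ext i j; simp [J, Matrix.mul_apply, Matrix.one_apply]
  have hJ' : J' * J'ᵀ = 1 := by
    ext i j; simp [J', Matrix.mul_apply, Matrix.one_apply]
  have hJJ' : J' * Jᵀ = 0 := by
    ext i j; simp [J, J', Matrix.mul_apply]
  have hJJ'' : J * J'ᵀ = 0 := by
    have := congrArg transpose hJJ'
    simpa using this
  have hsum : Jᵀ * J + J'ᵀ * J' = 1 := by
    let E : Matrix (ι ⊕ ι') κ ℝ := fromRows J J'
    have hE : E * Eᵀ = 1 := by
      simp only [E]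
      rw [transpose_fromRows, fromRows_mul_fromCols, hJ, hJ', hJJ', hJJ'', fromBlocks_one]
    have hE2 : Eᵀ * E = 1 := (Matrix.mul_eq_one_comm_of_card_eq _ _ _ (Fintype.card_congr e)).1 hE
    simp only [E] at hE2
    rwa [transpose_fromRows, fromCols_mul_fromRows] at hE2
  have hs' : √b' * √b' = b' := Real.mul_self_sqrt hb'.le
  have hs : √b * √b = b := Real.mul_self_sqrt hb.le
  have hs0 : √b ≠ 0 := (Real.sqrt_pos.2 hb).ne'
  have hs0' : √b' ≠ 0 := (Real.sqrt_pos.2 hb').ne'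
  have compl : ∀ {G : Matrix ι' κ ℝ}, G ∈ TF ι' κ b' → ∃ U ∈ OO κ, G = √b' • (J' * U) := by
    intro G hG
    obtain ⟨U, hU, hGU⟩ := exists_OO_of_gram (A := (√b')⁻¹ • G) (B := J') (by
      rw [hJ', transpose_smul, Matrix.smul_mul, Matrix.mul_smul, smul_smul, hG.1, ← mul_inv, hs', smul_smul,
        inv_mul_cancel₀ hb'.ne', one_smul])
    refine ⟨U, hU, ?_⟩
    rw [← hGU, smul_smul, mul_inv_cancel₀ hs0', one_smul]
  -- the key set
  let W : Set (Matrix ι κ ℝ) := {A | √b • A ∈ TF ι κ b}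
  have hW : ∀ A ∈ W, A * Aᵀ = 1 := by
    intro A hA
    have := hA.1
    rw [transpose_smul, Matrix.smul_mul, Matrix.mul_smul, smul_smul, hs] at this
    exact smul_right_injective _ hb.ne' this
  have hdiag : ∀ {U : Matrix κ κ ℝ}, U ∈ OO κ → ∀ n, ((J * U)ᵀ * (J * U)) n n + ((J' * U)ᵀ * (J' * U)) n n = 1 := by
    intro U hU n
    have : (J * U)ᵀ * (J * U) + (J' * U)ᵀ * (J' * U) = Uᵀ * (Jᵀ * J + J'ᵀ * J') * U := by
      simp only [transpose_mul, Matrix.mul_add, Matrix.add_mul, Matrix.mul_assoc]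
    rw [← Matrix.add_apply, this, hsum, Matrix.mul_one, OO.tr_mul hU, Matrix.one_apply_eq]
  have toTF' : ∀ V ∈ OO κ, J * V ∈ W → √b' • (J' * V) ∈ TF ι' κ b' := by
    intro V hV hJV
    refine ⟨?_, fun n => ?_⟩
    · rw [transpose_smul, Matrix.smul_mul, Matrix.mul_smul, smul_smul, hs', transpose_mul, Matrix.mul_assoc,
        ← Matrix.mul_assoc V, OO.mul_tr hV, Matrix.one_mul, hJ']
    · have h1 := hJV.2 n
      have h2 := hdiag hV n
      rw [transpose_smul, Matrix.smul_mul, Matrix.mul_smul, smul_smul, Matrix.smul_apply, smul_eq_mul, hs] at h1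
      rw [transpose_smul, Matrix.smul_mul, Matrix.mul_smul, smul_smul, Matrix.smul_apply, smul_eq_mul, hs']
      have h3 : ((J * V)ᵀ * (J * V)) n n = b⁻¹ := by field_simp; linarith
      have h4 : ((J' * V)ᵀ * (J' * V)) n n = b'⁻¹ := by linarith
      rw [h4, mul_inv_cancel₀ hb'.ne']
  have toW : ∀ V ∈ OO κ, √b' • (J' * V) ∈ TF ι' κ b' → J * V ∈ W := by
    intro V hV hJV
    refine ⟨?_, fun n => ?_⟩
    · rw [transpose_smul, Matrix.smul_mul, Matrix.mul_smul, smul_smul, hs, transpose_mul, Matrix.mul_assoc,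
        ← Matrix.mul_assoc V, OO.mul_tr hV, Matrix.one_mul, hJ]
    · have h1 := hJV.2 n
      have h2 := hdiag hV n
      rw [transpose_smul, Matrix.smul_mul, Matrix.mul_smul, smul_smul, Matrix.smul_apply, smul_eq_mul, hs'] at h1
      rw [transpose_smul, Matrix.smul_mul, Matrix.mul_smul, smul_smul, Matrix.smul_apply, smul_eq_mul, hs]
      have h3 : ((J' * V)ᵀ * (J' * V)) n n = b'⁻¹ := by field_simp; linarith
      have h4 : ((J * V)ᵀ * (J * V)) n n = b⁻¹ := by linarith
      rw [h4, mul_inv_cancel₀ hb.ne']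
  obtain ⟨U, hU, hGU⟩ := compl hG
  have compl2 : ∃ U' ∈ OO κ, U.det = U'.det ∧ G' = √b' • (J' * U') := by
    obtain ⟨U', hU', hGU'⟩ := compl hG'
    by_cases hd : U'.det = U.det
    · exact ⟨U', hU', hd.symm, hGU'⟩
    · obtain ⟨i⟩ : Nonempty ι := inferInstance
      have hw : (Pi.single (e (Sum.inl i)) 1 : κ → ℝ) ≠ 0 := by simp
      refine ⟨hh (Pi.single (e (Sum.inl i)) 1) * U', OO.mul (hh_mem hw) hU', ?_, ?_⟩
      · rw [det_mul, hh_det hw, pm_ne (OO.det hU') (OO.det hU) hd]; ring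
      · have : J' * hh (Pi.single (e (Sum.inl i)) 1) = J' := by
          rw [hh, Matrix.mul_sub, Matrix.mul_one, Matrix.mul_smul]
          have : J' * vecMulVec (Pi.single (e (Sum.inl i)) 1 : κ → ℝ) (Pi.single (e (Sum.inl i)) 1 : κ → ℝ) = 0 := by
            ext x y
            simp [J', Matrix.mul_apply, vecMulVec_apply, Pi.single_apply]
          rw [this]; simp
        rw [← Matrix.mul_assoc, this]; exact hGU'
  obtain ⟨U', hU', hdet, hGU'⟩ := compl2
  have hA : J * U ∈ W := toW U hU (by rw [← hGU]; exact hG)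
  have hA' : J * U' ∈ W := toW U' hU' (by rw [← hGU']; exact hG')
  have hjW : JoinedIn W (J * U) (J * U') := by
    have := (hconn.joinedIn _ hA _ hA').image_sub (f := fun X => (√b)⁻¹ • X) (B := W) (by fun_prop)
      (fun X hX => by
        change √b • ((√b)⁻¹ • X) ∈ TF ι κ b
        rw [smul_smul, mul_inv_cancel₀ hs0, one_smul]; exact hX)
    simpa [smul_smul, inv_mul_cancel₀ hs0] using this
  obtain ⟨V, hJV, hVd, hj⟩ := stiefel_lift J W hW hjW hU rfl
  have hV : V ∈ OO κ := hj.target_mem.1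
  have j1 : JoinedIn (TF ι' κ b') G (√b' • (J' * V)) := by
    rw [hGU]
    exact hj.image_sub (f := fun X => √b' • (J' * X)) (by fun_prop) (fun X hX => toTF' X hX.1 hX.2)
  refine j1.trans ?_
  set T := V * U'ᵀ with hT
  have hTO : T ∈ OO κ := OO.mul hV (OO.tr hU')
  have hTd : T.det = 1 := by
    rw [hT, det_mul, det_transpose, hVd, hdet, ← sq]
    rcases OO.det hU' with h | h <;> simp [h]
  have hJT : J * T = J := by
    rw [hT, ← Matrix.mul_assoc, hJV, Matrix.mul_assoc, OO.mul_tr hU', Matrix.mul_one]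
  have hTJ : T * Jᵀ = Jᵀ := by
    have h1 : J = J * Tᵀ := by
      conv_rhs => rw [← hJT, Matrix.mul_assoc, OO.mul_tr hTO, Matrix.mul_one]
    have := congrArg transpose h1
    rw [transpose_mul, transpose_transpose] at this
    exact this.symm
  have hVT : V = T * U' := by rw [hT, Matrix.mul_assoc, OO.tr_mul hU', Matrix.mul_one]
  obtain ⟨C, hC⟩ : ∃ C, C = J' * T * J'ᵀ := ⟨_, rfl⟩
  have hJ'T : J' * T = C * J' := by
    calc J' * T = J' * T * (Jᵀ * J + J'ᵀ * J') := by rw [hsum, Matrix.mul_one]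
      _ = J' * (T * Jᵀ) * J + C * J' := by rw [hC]; simp only [Matrix.mul_add, Matrix.mul_assoc]
      _ = C * J' := by rw [hTJ, hJJ', Matrix.zero_mul, zero_add]
  have hCO : C ∈ OO ι' := by
    change C * Cᵀ = 1
    calc C * Cᵀ = (C * J') * (C * J')ᵀ := by
          rw [transpose_mul, Matrix.mul_assoc, ← Matrix.mul_assoc J', hJ', Matrix.one_mul]
      _ = J' * (T * Tᵀ) * J'ᵀ := by rw [← hJ'T, transpose_mul]; simp only [Matrix.mul_assoc]
      _ = 1 := by rw [OO.mul_tr hTO, Matrix.mul_one, hJ']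
  have hCd : C.det = 1 := by
    have hE : fromRows J J' * (fromRows J J')ᵀ = 1 := by
      rw [transpose_fromRows, fromRows_mul_fromCols, hJ, hJ', hJJ', hJJ'', fromBlocks_one]
    have hE2 : (fromRows J J')ᵀ * fromRows J J' = 1 := by
      rw [transpose_fromRows, fromCols_mul_fromRows, hsum]
    have := det_conj_of_mul_eq_one (N := T) hE hE2
    rw [fromRows_mul, transpose_fromRows, fromRows_mul_fromCols, hJT, hJ, hJJ'', ← hC, det_fromBlocks_zero₁₂, det_one, one_mul] at this
    rw [this, hTd]
  have e1 : √b' • (J' * V) = C * G' := by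
    rw [hGU', hVT, ← Matrix.mul_assoc, hJ'T, Matrix.mul_smul, Matrix.mul_assoc]
  rw [e1]
  have := TF_joined_left hCO OO.one (by simp [hCd]) hG'
  rwa [Matrix.one_mul] at this

end naimark


theorem TF_reindex {ι κ κ' : Type*} [Fintype ι] [DecidableEq ι] [Fintype κ] [DecidableEq κ]
    [Fintype κ'] [DecidableEq κ'] {a : ℝ} (e : κ ≃ κ') (h : IsPathConnected (TF ι κ a)) :
    IsPathConnected (TF ι κ' a) := by
  have : TF ι κ' a = Set.image (fun F : Matrix ι κ ℝ => F.submatrix id e.symm) (TF ι κ a) := by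
    ext F
    constructor
    · rintro ⟨h1, h2⟩
      refine ⟨F.submatrix id e, ⟨?_, fun n => ?_⟩, ?_⟩
      · rw [transpose_submatrix, submatrix_mul_equiv, h1]; simp
      · rw [transpose_submatrix]
        exact h2 (e n)
      · ext i j; simp
    · rintro ⟨G, ⟨h1, h2⟩, rfl⟩
      refine ⟨?_, fun n => ?_⟩
      · change G.submatrix id e.symm * (G.submatrix id e.symm)ᵀ = _
        rw [transpose_submatrix, submatrix_mul_equiv, h1]; simp
      · exact h2 (e.symm n)
  rw [this]
  exact h.image (by fun_prop)

theorem TF_big (N : ℕ) (ih : ∀ m < N, ∀ d, 2 ≤ d → d + 2 ≤ m →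
      IsPathConnected (TF (Fin d) (Fin m) ((m : ℝ) / d))) (d : ℕ) (hd : 2 ≤ d) (hN : 2 * d ≤ N) :
    IsPathConnected (TF (Fin d) (Fin N) ((N : ℝ) / d)) := by
  have hd0 : (d : ℝ) ≠ 0 := by positivity
  haveI : Nontrivial (Fin d) := Fin.nontrivial_iff_two_le.2 hd
  obtain ⟨m, rfl⟩ : ∃ m, N = d + m := ⟨N - d, by omega⟩
  have hm : (((d + m : ℕ) : ℝ) / d - 1) = (m : ℝ) / d := by push_cast; field_simp; ring
  refine TF_reindex (finSumFinEquiv (m := d) (n := m)) ?_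
  by_cases h1 : m = d
  · subst h1
    have : (((m + m : ℕ) : ℝ) / m) = 2 := by push_cast; field_simp; ring
    rw [this]
    exact caseB
  by_cases h2 : m = d + 1
  · subst h2
    by_cases h3 : 3 ≤ d
    · exact caseC_big (by simpa using h3) (by simp) (by rw [hm]; simp; field_simp)
    · obtain rfl : d = 2 := by omega
      have : (((2 + (2 + 1) : ℕ) : ℝ) / (2 : ℕ)) = 5 / 2 := by norm_num
      rw [this]
      exact caseC_two
  · haveI : Nonempty (Fin m) := ⟨⟨0, by omega⟩⟩
    refine caseA (by simp; omega) (by rw [hm]; simp; field_simp) (by rw [hm]; positivity) ?_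
    rw [hm]
    exact ih m (by omega) d hd (by omega)

theorem TF_all (N : ℕ) : ∀ d, 2 ≤ d → d + 2 ≤ N →
    IsPathConnected (TF (Fin d) (Fin N) ((N : ℝ) / d)) := by
  induction N using Nat.strong_induction_on with
  | _ N ih =>
    intro d hd hN
    by_cases h : 2 * d ≤ N
    · exact TF_big N ih d hd h
    · obtain ⟨k, rfl⟩ : ∃ k, N = k + d := ⟨N - d, by omega⟩
      have hk : 2 ≤ k := by omega
      have hd0 : (0 : ℝ) < d := by positivity
      have hk0 : (0 : ℝ) < k := by positivity
      haveI : Nontrivial (Fin d) := Fin.nontrivial_iff_two_le.2 hd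
      haveI : Nonempty (Fin k) := ⟨⟨0, by omega⟩⟩
      refine naimark (ι := Fin k) (b := ((k + d : ℕ) : ℝ) / k) finSumFinEquiv (by positivity)
        (by positivity) (by push_cast; field_simp) ?_ (TF_big _ ih k hk (by omega))
      exact TF_nonempty (by simp) (by positivity) (by simp; field_simp)

theorem FUNTF_eq_TF (N d : ℕ) : FUNTF ℝ N d = TF (Fin d) (Fin N) ((N : ℝ) / d) := by
  ext F
  simp [FUNTF, TF, conjTranspose_eq_transpose_of_trivial]



end Aux

/-- The space of real FUNTFs of `N` vectors in `ℝ^d` is path-connected for `N ≥ d + 2 ≥ 4`. -/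
theorem funtf_real_pathConnected (N d : ℕ) (hd : 2 ≤ d) (hN : d + 2 ≤ N) :
    IsPathConnected (FUNTF ℝ N d) := by
  rw [FUNTF_eq_TF]
  exact TF_all N d hd hN
end
end
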